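/- Let θ:[0,∞)→[0,∞) be a convex cost function with θ(t)=t² for t∈[0,t₀] for some t₀>0 and with ∫₀^∞ θ(d₁x+d₂) e^{−x} dx < ∞ for all d₁,d₂>0, and let μ be a probability measure on ℝ which is not a Dirac mass. Then the following are equivalent: (i) there exists a>0 such that μ satisfies T̄(θ(a·)); (ii) there exists b>0 such that Δ_μ(h) ≤ (1/b)·θ^{-1}(t₀²+h) for all h>0. Moreover, (i) implies (ii) with b=κ₁ a where κ₁ = t₀/(8 θ^{-1}(log 3 + t₀²)), and (ii) implies (i) with a=κ₂ b where κ₂ = min(1,t₀)/(210 θ^{-1}(2+t₀²)). -/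

import Mathlib

open MeasureTheory ProbabilityTheory Real Set Filter Topology
open scoped ENNReal NNReal

/-- The generalized inverse `F_μ^{-1}(t) = inf {y : F_μ(y) ≥ t}` of the cumulative
distribution function `F_μ(y) = μ((-∞, y])`. -/
noncomputable def invCDF (μ : Measure ℝ) (t : ℝ) : ℝ :=
  sInf {y : ℝ | t ≤ (μ (Iic y)).toReal}

/-- The cumulative distribution function of the symmetric exponential measure `τ`
with density `(1/2) e^{-|x|}`. -/
noncomputable def expCDF (x : ℝ) : ℝ :=
  if x < 0 then Real.exp x / 2 else 1 - Real.exp (-x) / 2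

/-- `U_μ = F_μ^{-1} ∘ F_τ`, the unique left-continuous non-decreasing map
transporting `τ` onto `μ`. -/
noncomputable def Umap (μ : Measure ℝ) (x : ℝ) : ℝ :=
  invCDF μ (expCDF x)

open scoped Classical in
/-- `Ent_μ(g) = ∫ g ln g dμ − (∫ g dμ) ln (∫ g dμ)` if `∫ g ln g dμ < ∞`, and `+∞`
otherwise (for nonnegative `g` this quantity is nonnegative, so it is recorded in `ℝ≥0∞`). -/
noncomputable def Ent (μ : Measure ℝ) (g : ℝ → ℝ) : ℝ≥0∞ :=
  if Integrable (fun x => g x * Real.log (g x)) μ then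
    ENNReal.ofReal ((∫ x, g x * Real.log (g x) ∂μ) -
      (∫ x, g x ∂μ) * Real.log (∫ x, g x ∂μ))
  else ⊤

open scoped Classical in
/-- The relative entropy `H(ν|μ) = ∫ log (dν/dμ) dν`, `+∞` if `ν` is not absolutely
continuous w.r.t. `μ` (for probability measures it is nonnegative, hence valued in `ℝ≥0∞`). -/
noncomputable def relEnt {α : Type*} [MeasurableSpace α] (ν μ : Measure α) : ℝ≥0∞ :=
  if ν ≪ μ ∧ Integrable (fun x => Real.log ((ν.rnDeriv μ x).toReal)) ν then
    ENNReal.ofReal (∫ x, Real.log ((ν.rnDeriv μ x).toReal) ∂ν)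
  else ⊤

/-- The weak (barycentric) transport cost
`T̄_θ(μ₂|μ₁) = inf_π ∫ θ(|x − ∫ y p(x,dy)|) μ₁(dx)`, the infimum running over all
couplings `π(dxdy) = p(x,dy) μ₁(dx)` of `μ₁` and `μ₂` (described by their
disintegration kernels `p`). -/
noncomputable def weakCost (θ : ℝ → ℝ) (μ₂ μ₁ : Measure ℝ) : ℝ≥0∞ :=
  ⨅ (p : Kernel ℝ ℝ) (_ : IsMarkovKernel p) (_ : μ₁.bind (fun x => p x) = μ₂),
    ∫⁻ x, ENNReal.ofReal (θ |x - ∫ y, y ∂(p x)|) ∂μ₁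

/-- `μ` satisfies `T̄⁻(θ)`: `T̄_θ(μ|ν) ≤ H(ν|μ)` for every probability measure `ν`
with finite first moment. -/
def Tminus (θ : ℝ → ℝ) (μ : Measure ℝ) : Prop :=
  ∀ ν : Measure ℝ, IsProbabilityMeasure ν → Integrable (fun x => x) ν →
    weakCost θ μ ν ≤ relEnt ν μ

/-- `μ` satisfies `T̄⁺(θ)`: `T̄_θ(ν|μ) ≤ H(ν|μ)` for every probability measure `ν`
with finite first moment. -/
def Tplus (θ : ℝ → ℝ) (μ : Measure ℝ) : Prop :=
  ∀ ν : Measure ℝ, IsProbabilityMeasure ν → Integrable (fun x => x) ν →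
    weakCost θ ν μ ≤ relEnt ν μ

/-- The inverse of an increasing cost function `θ` on `[0,∞)`:
`θ⁻¹(u) = inf {t ≥ 0 : θ(t) ≥ u}`. -/
noncomputable def cinv (θ : ℝ → ℝ) (u : ℝ) : ℝ :=
  sInf {t : ℝ | 0 ≤ t ∧ u ≤ θ t}

section WTproof

open MeasureTheory ProbabilityTheory Real Set Filter Topology
open scoped ENNReal NNReal

set_option linter.unusedVariables false
namespace WT

structure GoodCost (θ : ℝ → ℝ) (t₀ : ℝ) : Prop where
  pos : 0 < t₀
  nn : ∀ t ≥ (0:ℝ), 0 ≤ θ t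
  conv : ConvexOn ℝ (Set.Ici 0) θ
  quad : ∀ t ∈ Set.Icc (0:ℝ) t₀, θ t = t ^ 2

variable {θ : ℝ → ℝ} {t₀ : ℝ}

lemma GoodCost.zero (H : GoodCost θ t₀) : θ 0 = 0 := by
  rw [H.quad 0 ⟨le_rfl, H.pos.le⟩]; norm_num

lemma GoodCost.smul (H : GoodCost θ t₀) {c x : ℝ} (hc : 0 ≤ c) (hc1 : c ≤ 1) (hx : 0 ≤ x) :
    θ (c * x) ≤ c * θ x := by
  have := H.conv.2 (x := x) (y := 0) hx (le_refl (0:ℝ)) hc (by linarith : 0 ≤ 1 - c) (by ring)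
  simpa [H.zero] using this

lemma GoodCost.mono (H : GoodCost θ t₀) {x y : ℝ} (hx : 0 ≤ x) (hxy : x ≤ y) : θ x ≤ θ y := by
  rcases hx.eq_or_lt with h | h
  · rw [← h, H.zero]; exact H.nn y (by linarith)
  have hy : 0 < y := by linarith
  have h1 := H.smul (c := x / y) (x := y) (by positivity) ((div_le_one hy).2 hxy) hy.le
  rw [div_mul_cancel₀ _ hy.ne'] at h1
  have h2 : x / y * θ y ≤ 1 * θ y :=
    mul_le_mul_of_nonneg_right ((div_le_one hy).2 hxy) (H.nn y hy.le)
  linarith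

lemma GoodCost.tangent (H : GoodCost θ t₀) {t : ℝ} (ht : 0 ≤ t) : 2 * t₀ * t - t₀ ^ 2 ≤ θ t := by
  rcases le_or_gt t t₀ with h | h
  · rw [H.quad t ⟨ht, h⟩]; nlinarith [sq_nonneg (t - t₀)]
  have key : ∀ s ∈ Ioo 0 t₀, (t₀ + s) * (t - t₀) ≤ θ t - t₀ ^ 2 := by
    intro s hs
    have := H.conv.slope_mono_adjacent (x := s) (y := t₀) (z := t) hs.1.le ht hs.2 h
    rw [H.quad s ⟨hs.1.le, hs.2.le⟩, H.quad t₀ ⟨H.pos.le, le_rfl⟩] at this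
    have e : (t₀ ^ 2 - s ^ 2) / (t₀ - s) = t₀ + s := by
      rw [div_eq_iff (by linarith [hs.2])]; ring
    rw [e, le_div_iff₀ (by linarith)] at this
    exact this
  have : (t₀ + t₀) * (t - t₀) ≤ θ t - t₀ ^ 2 := by
    have hc : Tendsto (fun s => (t₀ + s) * (t - t₀)) (𝓝[<] t₀) (𝓝 ((t₀ + t₀) * (t - t₀))) := by
      apply Tendsto.mono_left _ nhdsWithin_le_nhds
      exact (Continuous.tendsto (by fun_prop) _)
    refine le_of_tendsto hc ?_
    filter_upwards [Ioo_mem_nhdsLT H.pos] with s hs using key s hs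
  nlinarith

lemma GoodCost.ptpos (H : GoodCost θ t₀) {t : ℝ} (ht : 0 < t) : 0 < θ t := by
  rcases le_or_gt t t₀ with h | h
  · rw [H.quad t ⟨ht.le, h⟩]; positivity
  have := H.tangent ht.le
  nlinarith [H.pos]

lemma GoodCost.strict (H : GoodCost θ t₀) {x y : ℝ} (hx : 0 ≤ x) (hxy : x < y) : θ x < θ y := by
  have hy : 0 < y := by linarith
  have h1 := H.smul (c := x / y) (x := y) (by positivity) ((div_le_one hy).2 hxy.le) hy.le
  rw [div_mul_cancel₀ _ hy.ne'] at h1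
  have h2 : x / y * θ y < 1 * θ y :=
    mul_lt_mul_of_pos_right ((div_lt_one hy).2 hxy) (H.ptpos hy)
  linarith

/-- the even-type extension -/
noncomputable def cext (θ : ℝ → ℝ) (t : ℝ) : ℝ := θ (max t 0)

lemma cext_of_nonneg {t : ℝ} (ht : 0 ≤ t) : cext θ t = θ t := by simp [cext, ht]

lemma GoodCost.ext_mono (H : GoodCost θ t₀) : Monotone (cext θ) := fun x y hxy =>
  H.mono (le_max_right _ _) (max_le_max hxy le_rfl)

lemma GoodCost.ext_nonneg (H : GoodCost θ t₀) (t : ℝ) : 0 ≤ cext θ t := H.nn _ (le_max_right _ _)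

lemma GoodCost.ext_convex (H : GoodCost θ t₀) : ConvexOn ℝ univ (cext θ) := by
  refine ⟨convex_univ, fun x _ y _ a b ha hb hab => ?_⟩
  have h1 := H.conv.2 (x := max x 0) (y := max y 0) (mem_Ici.2 (le_max_right _ _)) (mem_Ici.2 (le_max_right _ _)) ha hb hab
  refine le_trans (H.mono (le_max_right _ _) ?_) h1
  simp only [smul_eq_mul]
  apply max_le
  · nlinarith [le_max_left x 0, le_max_left y 0, mul_le_mul_of_nonneg_left (le_max_left x 0) ha,
      mul_le_mul_of_nonneg_left (le_max_left y 0) hb]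
  · have := le_max_right x 0
    have := le_max_right y 0
    positivity

lemma GoodCost.ext_cont (H : GoodCost θ t₀) : Continuous (cext θ) := by
  have := H.ext_convex.continuousOn isOpen_univ
  exact continuousOn_univ.1 this

lemma GoodCost.superadd (H : GoodCost θ t₀) {x y : ℝ} (hx : 0 ≤ x) (hy : 0 ≤ y) :
    θ x + θ y ≤ θ (x + y) := by
  rcases (add_nonneg hx hy).eq_or_lt with h | h
  · have : x = 0 := by linarith
    have : y = 0 := by linarith
    subst x; subst y; simp [H.zero]
  have h1 := H.smul (c := x / (x + y)) (x := x + y) (by positivity)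
    ((div_le_one h).2 (by linarith)) h.le
  have h2 := H.smul (c := y / (x + y)) (x := x + y) (by positivity)
    ((div_le_one h).2 (by linarith)) h.le
  rw [div_mul_cancel₀ _ h.ne'] at h1 h2
  have : x / (x + y) * θ (x + y) + y / (x + y) * θ (x + y) = θ (x + y) := by
    field_simp
  linarith

lemma GoodCost.surj (H : GoodCost θ t₀) {u : ℝ} (hu : 0 ≤ u) : ∃ s, 0 ≤ s ∧ θ s = u := by
  set T := t₀ + u / (2 * t₀) with hT
  have hp := H.pos
  have hT0 : 0 ≤ T := by positivity
  have hTu : u ≤ θ T := by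
    have := H.tangent hT0
    have e : 2 * t₀ * T = 2 * t₀ ^ 2 + u := by rw [hT]; field_simp
    nlinarith
  have := intermediate_value_Icc hT0 (H.ext_cont.continuousOn (s := Icc 0 T))
  have hm : u ∈ Icc (cext θ 0) (cext θ T) := by
    rw [cext_of_nonneg le_rfl, cext_of_nonneg hT0, H.zero]; exact ⟨hu, hTu⟩
  obtain ⟨s, hs, hs'⟩ := this hm
  exact ⟨s, hs.1, by rw [← hs', cext_of_nonneg hs.1]⟩

lemma GoodCost.cinv_eq (H : GoodCost θ t₀) {s : ℝ} (hs : 0 ≤ s) : cinv θ (θ s) = s := by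
  apply le_antisymm
  · exact csInf_le ⟨0, fun t ht => ht.1⟩ ⟨hs, le_rfl⟩
  · refine le_csInf ⟨s, hs, le_rfl⟩ ?_
    rintro t ⟨ht, h⟩
    by_contra! hlt
    exact absurd (H.strict ht hlt) (not_lt.2 h)

lemma GoodCost.c1 (H : GoodCost θ t₀) {u : ℝ} (hu : 0 ≤ u) : θ (cinv θ u) = u := by
  obtain ⟨s, hs, rfl⟩ := H.surj hu
  rw [H.cinv_eq hs]

lemma GoodCost.c0 (H : GoodCost θ t₀) {u : ℝ} (hu : 0 ≤ u) : 0 ≤ cinv θ u := by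
  obtain ⟨s, hs, rfl⟩ := H.surj hu
  rwa [H.cinv_eq hs]

lemma GoodCost.c2 (H : GoodCost θ t₀) {t u : ℝ} (hu : 0 ≤ u) (h : θ t ≤ u) (ht : 0 ≤ t) :
    t ≤ cinv θ u := by
  obtain ⟨s, hs, rfl⟩ := H.surj hu
  rw [H.cinv_eq hs]
  by_contra! hlt
  exact absurd (H.strict hs hlt) (not_lt.2 h)

/-- upper bound -/
lemma GoodCost.c2' (H : GoodCost θ t₀) {t u : ℝ} (hu : 0 ≤ u) (h : u ≤ θ t) (ht : 0 ≤ t) :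
    cinv θ u ≤ t := by
  obtain ⟨s, hs, rfl⟩ := H.surj hu
  rw [H.cinv_eq hs]
  by_contra! hlt
  exact absurd (H.strict ht hlt) (not_lt.2 h)

lemma GoodCost.c3 (H : GoodCost θ t₀) {u v : ℝ} (hu : 0 ≤ u) (huv : u ≤ v) :
    cinv θ u ≤ cinv θ v :=
  H.c2 (hu.trans huv) (by rw [H.c1 hu]; exact huv) (H.c0 hu)

lemma GoodCost.c4 (H : GoodCost θ t₀) : cinv θ (t₀ ^ 2) = t₀ := by
  conv_lhs => rw [← H.quad t₀ ⟨H.pos.le, le_rfl⟩]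
  exact H.cinv_eq H.pos.le

lemma GoodCost.c5 (H : GoodCost θ t₀) {u v : ℝ} (hu : 0 ≤ u) (hv : 0 ≤ v) :
    cinv θ (u + v) ≤ cinv θ u + cinv θ v := by
  apply H.c2' (by linarith) _ (add_nonneg (H.c0 hu) (H.c0 hv))
  have := H.superadd (H.c0 hu) (H.c0 hv)
  rwa [H.c1 hu, H.c1 hv] at this

lemma GoodCost.c7 (H : GoodCost θ t₀) {s : ℝ} (hs : 0 ≤ s) :
    cinv θ (t₀ ^ 2 + s) ≤ t₀ + s / (2 * t₀) := by
  have hp := H.pos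
  apply H.c2' (by positivity) _ (by positivity)
  have := H.tangent (t := t₀ + s / (2 * t₀)) (by positivity)
  have e : 2 * t₀ * (t₀ + s / (2 * t₀)) = 2 * t₀ ^ 2 + s := by field_simp
  linarith

lemma GoodCost.c8 (H : GoodCost θ t₀) {s : ℝ} (hs : 0 ≤ s) : t₀ ≤ cinv θ (t₀ ^ 2 + s) := by
  conv_lhs => rw [← H.c4]
  exact H.c3 (by positivity) (by linarith)

/-- Jensen, lintegral form. -/
lemma GoodCost.jensen (H : GoodCost θ t₀) {α : Type*} [MeasurableSpace α] (ρ : Measure α)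
    [IsProbabilityMeasure ρ] {g : α → ℝ} (hg : Integrable g ρ) :
    ENNReal.ofReal (cext θ (∫ x, g x ∂ρ)) ≤ ∫⁻ x, ENNReal.ofReal (cext θ (g x)) ∂ρ := by
  by_cases hi : Integrable (fun x => cext θ (g x)) ρ
  · rw [← ofReal_integral_eq_lintegral_ofReal hi (ae_of_all _ fun x => H.ext_nonneg _)]
    apply ENNReal.ofReal_le_ofReal
    exact H.ext_convex.map_integral_le H.ext_cont.continuousOn isClosed_univ (ae_of_all _ fun _ => mem_univ _) hg hi
  · have : ∫⁻ x, ENNReal.ofReal (cext θ (g x)) ∂ρ = ⊤ := by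
      by_contra hne
      apply hi
      refine ⟨H.ext_cont.comp_aestronglyMeasurable hg.1, ?_⟩
      rw [hasFiniteIntegral_iff_ofReal (ae_of_all _ fun x => H.ext_nonneg _)]
      exact lt_top_iff_ne_top.2 hne
    rw [this]; exact le_top

end WT

open MeasureTheory ProbabilityTheory Real Set Filter Topology
open scoped ENNReal NNReal
set_option linter.unusedVariables false

namespace WT

/-- uniform measure on `(0,1)` -/
noncomputable def lam : Measure ℝ := volume.restrict (Ioo 0 1)

instance : IsProbabilityMeasure lam := ⟨by simp [lam]⟩

lemma lam_apply {s : Set ℝ} (hs : MeasurableSet s) : lam s = volume (s ∩ Ioo 0 1) := by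
  rw [lam, Measure.restrict_apply hs]

lemma ae_lam : ∀ᵐ s ∂lam, s ∈ Ioo (0:ℝ) 1 := by
  rw [lam]; exact ae_restrict_mem measurableSet_Ioo

open scoped Classical in
/-- quantile function cut off outside `(0,1)` -/
noncomputable def V (μ : Measure ℝ) (s : ℝ) : ℝ := if s ∈ Ioo (0:ℝ) 1 then invCDF μ s else 0

section
variable (μ : Measure ℝ) [IsProbabilityMeasure μ]

lemma V_le_iff {s y : ℝ} (hs : s ∈ Ioo (0:ℝ) 1) : V μ s ≤ y ↔ s ≤ (μ (Iic y)).toReal := by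
  have hF : ∀ y, (μ (Iic y)).toReal = cdf μ y := fun y => by
    rw [cdf_eq_real]; rfl
  simp only [V, hs, if_true, invCDF, hF]
  set S := {y : ℝ | s ≤ cdf μ y} with hS
  have hne : S.Nonempty := by
    have := (tendsto_cdf_atTop μ).eventually (lt_mem_nhds hs.2)
    obtain ⟨y, hy⟩ := this.exists
    exact ⟨y, hy.le⟩
  have hbb : BddBelow S := by
    have := (tendsto_cdf_atBot μ).eventually (gt_mem_nhds hs.1)
    obtain ⟨y, hy⟩ := this.exists
    refine ⟨y, fun z hz => ?_⟩
    by_contra! hlt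
    have := monotone_cdf μ hlt.le
    have : s ≤ cdf μ z := hz
    linarith
  constructor
  · intro h
    have key : ∀ z > y, s ≤ cdf μ z := by
      intro z hz
      obtain ⟨w, hw, hwz⟩ := exists_lt_of_csInf_lt hne (lt_of_le_of_lt h hz)
      exact le_trans hw (monotone_cdf μ hwz.le)
    have hc := ((cdf μ).right_continuous y).mono (Ioi_subset_Ici_self)
    exact ge_of_tendsto hc (by filter_upwards [self_mem_nhdsWithin] with z hz using key z hz)
  · intro h
    exact csInf_le hbb h

lemma V_mono {s t : ℝ} (hs : 0 < s) (hst : s ≤ t) (ht : t < 1) : V μ s ≤ V μ t := by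
  rw [V_le_iff μ ⟨hs, by linarith⟩]
  exact hst.trans ((V_le_iff μ ⟨by linarith, ht⟩).1 le_rfl)

lemma measurable_V : Measurable (V μ) := by
  apply measurable_of_Iic
  intro y
  have : V μ ⁻¹' Iic y = (Ioo 0 1 ∩ Iic ((μ (Iic y)).toReal)) ∪ ((Ioo 0 1)ᶜ ∩ {s | (0:ℝ) ≤ y}) := by
    ext s
    by_cases hs : s ∈ Ioo (0:ℝ) 1
    · have := V_le_iff μ (y := y) hs
      simp only [mem_preimage, mem_Iic, this, mem_union, mem_inter_iff, hs, true_and, mem_compl_iff,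
        not_true, false_and, or_false]
    · simp only [mem_preimage, mem_Iic, V, hs, if_false, mem_union, mem_inter_iff, false_and, false_or,
        mem_compl_iff, not_false_iff, true_and, mem_setOf_eq]
  rw [this]
  measurability

lemma map_V : lam.map (V μ) = μ := by
  have : IsProbabilityMeasure (lam.map (V μ)) :=
    Measure.isProbabilityMeasure_map (measurable_V μ).aemeasurable
  apply Measure.ext_of_Iic
  intro y
  rw [Measure.map_apply (measurable_V μ) measurableSet_Iic]
  have h1 : lam (V μ ⁻¹' Iic y) = lam (Iic ((μ (Iic y)).toReal)) := by
    apply measure_congr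
    filter_upwards [ae_lam] with s hs
    exact propext (V_le_iff μ hs)
  rw [h1, lam_apply measurableSet_Iic]
  have h0 : 0 ≤ (μ (Iic y)).toReal := ENNReal.toReal_nonneg
  have h1 : (μ (Iic y)).toReal ≤ 1 := by
    apply ENNReal.toReal_le_of_le_ofReal zero_le_one; simpa using prob_le_one
  have : volume (Iic ((μ (Iic y)).toReal) ∩ Ioo 0 1) = volume (Ioc 0 ((μ (Iic y)).toReal)) := by
    apply measure_congr
    have : ∀ᵐ s : ℝ, s ≠ 1 := by simp [ae_iff]
    filter_upwards [this] with s hs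
    apply propext
    show (s ≤ _ ∧ 0 < s ∧ s < 1) ↔ (0 < s ∧ s ≤ _)
    constructor
    · rintro ⟨a, b, c⟩; exact ⟨b, a⟩
    · rintro ⟨a, b⟩; exact ⟨b, a, lt_of_le_of_ne (b.trans h1) hs⟩
  rw [this, Real.volume_Ioc, sub_zero, ENNReal.ofReal_toReal (measure_ne_top _ _)]

lemma expCDF_mem (x : ℝ) : expCDF x ∈ Ioo (0:ℝ) 1 := by
  unfold expCDF
  split_ifs with h
  · have := Real.exp_pos x
    have : Real.exp x < 1 := by rw [Real.exp_lt_one_iff]; exact h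
    constructor <;> linarith
  · have := Real.exp_pos (-x)
    have : Real.exp (-x) ≤ 1 := by rw [Real.exp_le_one_iff]; linarith
    constructor <;> linarith

lemma Umap_eq (x : ℝ) : Umap μ x = V μ (expCDF x) := by
  simp only [Umap, V, expCDF_mem x, if_true]

end

lemma relEnt_eq_klDiv {α : Type*} [MeasurableSpace α] (ν μ : Measure α) [IsProbabilityMeasure ν]
    [IsProbabilityMeasure μ] : relEnt ν μ = InformationTheory.klDiv ν μ := by
  unfold relEnt
  by_cases h1 : ν ≪ μ
  · by_cases h2 : Integrable (fun x => Real.log ((ν.rnDeriv μ x).toReal)) ν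
    · rw [if_pos ⟨h1, h2⟩, InformationTheory.klDiv_of_ac_of_integrable h1 h2]
      simp [llr]
    · rw [if_neg (fun h => h2 h.2), InformationTheory.klDiv_of_not_integrable h2]
  · rw [if_neg (fun h => h1 h.1), InformationTheory.klDiv_of_not_ac h1]

lemma map_withDensity_comp {α : Type*} [MeasurableSpace α] (ρ : Measure α) {T : α → ℝ} (hT : Measurable T)
    {φ : ℝ → ℝ≥0∞} (hφ : Measurable φ) :
    (ρ.withDensity (φ ∘ T)).map T = (ρ.map T).withDensity φ := by
  ext s hs
  rw [Measure.map_apply hT hs, withDensity_apply _ (hT hs), withDensity_apply _ hs,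
    setLIntegral_map hs hφ hT]
  rfl

/-- every `ν ≪ μ` with finite entropy comes from a density on the uniform level -/
lemma exists_density (μ ν : Measure ℝ) [IsProbabilityMeasure μ] [IsProbabilityMeasure ν]
    (h : ν ≪ μ) : ∃ f : ℝ → ℝ, Measurable f ∧ (∀ x, 0 ≤ f x) ∧
      IsProbabilityMeasure (lam.withDensity fun x => ENNReal.ofReal (f x)) ∧
      (lam.withDensity fun x => ENNReal.ofReal (f x)).map (V μ) = ν ∧
      relEnt ν μ = ∫⁻ x, ENNReal.ofReal (InformationTheory.klFun (f x)) ∂lam := by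
  set φ := ν.rnDeriv μ
  have hφ : Measurable φ := Measure.measurable_rnDeriv _ _
  have hfin : ∀ᵐ x ∂lam, ENNReal.ofReal ((φ (V μ x)).toReal) = φ (V μ x) := by
    have : ∀ᵐ x ∂μ, φ x < ⊤ := Measure.rnDeriv_lt_top ν μ
    rw [← map_V μ] at this
    have := ae_of_ae_map (measurable_V μ).aemeasurable this
    filter_upwards [this] with x hx
    exact ENNReal.ofReal_toReal hx.ne
  have hwd : (lam.withDensity fun x => ENNReal.ofReal ((φ (V μ x)).toReal)).map (V μ) = ν := by
    rw [withDensity_congr_ae hfin]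
    have := map_withDensity_comp lam (measurable_V μ) hφ
    rw [map_V, Measure.withDensity_rnDeriv_eq _ _ h] at this
    exact this
  refine ⟨fun x => (φ (V μ x)).toReal, (hφ.comp (measurable_V μ)).ennreal_toReal,
    fun x => ENNReal.toReal_nonneg, ⟨?_⟩, hwd, ?_⟩
  · have : ν univ = 1 := measure_univ
    rw [← hwd, Measure.map_apply (measurable_V μ) MeasurableSet.univ] at this
    simpa using this
  · rw [relEnt_eq_klDiv, InformationTheory.klDiv_eq_lintegral_klFun_of_ac h]
    conv_lhs => rw [← map_V μ]
    rw [lintegral_map _ (measurable_V μ)]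
    · rw [map_V]
    · rw [map_V]
      exact (InformationTheory.measurable_klFun.comp hφ.ennreal_toReal).ennreal_ofReal

lemma relEnt_map_le (μ : Measure ℝ) [IsProbabilityMeasure μ] (P : Measure ℝ) [IsProbabilityMeasure P] :
    relEnt (P.map (V μ)) μ ≤ InformationTheory.klDiv P lam := by
  have : IsProbabilityMeasure (P.map (V μ)) :=
    Measure.isProbabilityMeasure_map (measurable_V μ).aemeasurable
  rw [relEnt_eq_klDiv]
  conv_lhs => rw [← map_V μ]
  rw [map_V]
  have := InformationTheory.klDiv_map_le P lam (measurable_V μ)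
  rwa [map_V] at this

end WT

open MeasureTheory ProbabilityTheory Real Set Filter Topology
open scoped ENNReal NNReal
set_option linter.unusedVariables false
set_option linter.unusedSectionVars false

namespace WT

/-- barycenter -/
noncomputable def bary (p : Kernel ℝ ℝ) (x : ℝ) : ℝ := ∫ y, y ∂(p x)

lemma measurable_bary (p : Kernel ℝ ℝ) [IsMarkovKernel p] : Measurable (bary p) := by
  have : StronglyMeasurable (fun x => ∫ y, (id y : ℝ) ∂(p x)) :=
    MeasureTheory.StronglyMeasurable.integral_kernel stronglyMeasurable_id
  exact this.measurable

section bind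
variable {P₁ P₂ : Measure ℝ} (p : Kernel ℝ ℝ) [IsMarkovKernel p] (hb : P₁.bind (fun x => p x) = P₂)
include hb

lemma ae_ae_bind {q : ℝ → Prop} (h : ∀ᵐ y ∂P₂, q y) : ∀ᵐ x ∂P₁, ∀ᵐ y ∂(p x), q y := by
  subst hb
  exact Measure.ae_ae_of_ae_comp h

lemma ae_int_bind [SFinite P₁] (h : Integrable (fun y => y) P₂) : ∀ᵐ x ∂P₁, Integrable (fun y => y) (p x) := by
  subst hb
  exact Measure.ae_integrable_of_integrable_comp h

lemma int_bary [SFinite P₁] (h : Integrable (fun y => y) P₂) : Integrable (bary p) P₁ := by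
  subst hb
  have := Measure.integrable_integral_norm_of_integrable_comp h
  refine this.mono (measurable_bary p).aestronglyMeasurable (ae_of_all _ fun x => ?_)
  refine (norm_integral_le_integral_norm _).trans (le_abs_self _)

lemma integral_bary [SFinite P₁] (h : Integrable (fun y => y) P₂) :
    ∫ x, bary p x ∂P₁ = ∫ y, y ∂P₂ := by
  subst hb
  have e : P₁.bind (fun x => p x) = (p ∘ₖ Kernel.const Unit P₁) () := Measure.comp_eq_comp_const_apply
  rw [e] at h ⊢
  rw [Kernel.integral_comp h]
  simp [bary]

lemma pos_bary [SFinite P₁] (h : Integrable (fun y => y) P₂) (σ u : ℝ) :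
    ∫⁻ x, ENNReal.ofReal (σ * (bary p x - u)) ∂P₁ ≤ ∫⁻ y, ENNReal.ofReal (σ * (y - u)) ∂P₂ := by
  have hi := ae_int_bind p hb h
  rw [← hb, Measure.lintegral_bind p.aemeasurable (by fun_prop)]
  apply lintegral_mono_ae
  filter_upwards [hi] with x hx
  have e : σ * (bary p x - u) = ∫ y, σ * (y - u) ∂(p x) := by
    rw [integral_const_mul, integral_sub hx (integrable_const _)]
    simp [bary]
  rw [e]
  have hI : Integrable (fun y => σ * (y - u)) (p x) := (hx.sub (integrable_const _)).const_mul _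
  calc ENNReal.ofReal (∫ y, σ * (y - u) ∂(p x))
      ≤ ENNReal.ofReal (∫ y, max (σ * (y - u)) 0 ∂(p x)) := by
        apply ENNReal.ofReal_le_ofReal
        exact integral_mono hI hI.pos_part fun y => le_max_left _ _
    _ = ∫⁻ y, ENNReal.ofReal (max (σ * (y - u)) 0) ∂(p x) := by
        rw [ofReal_integral_eq_lintegral_ofReal hI.pos_part (ae_of_all _ fun y => le_max_right _ _)]
    _ = _ := by
        congr 1; ext y
        rcases le_total (σ * (y - u)) 0 with h | h
        · simp [h, ENNReal.ofReal_of_nonpos h]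
        · simp [h]

end bind

variable {θ : ℝ → ℝ} {t₀ : ℝ}

lemma cost_pull (H : GoodCost θ t₀) {a : ℝ} (ha : 0 < a) (P : Measure ℝ) {T : ℝ → ℝ} (hT : Measurable T)
    (p : Kernel ℝ ℝ) [IsMarkovKernel p] :
    ∫⁻ x, ENNReal.ofReal (θ (a * |x - ∫ y, y ∂(p x)|)) ∂(P.map T) =
      ∫⁻ s, ENNReal.ofReal (cext θ (a * |T s - bary p (T s)|)) ∂P := by
  have : ∀ x, θ (a * |x - ∫ y, y ∂(p x)|) = cext θ (a * |x - bary p x|) := fun x => by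
    rw [cext_of_nonneg (by positivity)]; rfl
  simp_rw [this]
  rw [lintegral_map _ hT]
  have := measurable_bary p
  have := H.ext_cont.measurable
  fun_prop

lemma jensenSet (H : GoodCost θ t₀) {A : Set ℝ} (hA : MeasurableSet A) (hA0 : lam A ≠ 0) {g : ℝ → ℝ}
    (hg : IntegrableOn g A lam) :
    ENNReal.ofReal ((lam A).toReal * cext θ ((lam A).toReal⁻¹ * ∫ s in A, g s ∂lam)) ≤
      ∫⁻ s in A, ENNReal.ofReal (cext θ (g s)) ∂lam := by
  have : IsProbabilityMeasure (cond lam A) := cond_isProbabilityMeasure hA0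
  have hi : Integrable g (cond lam A) := by
    rw [ProbabilityTheory.cond]; exact hg.smul_measure (by simp [hA0])
  have h := H.jensen (cond lam A) hi
  rw [ProbabilityTheory.cond, integral_smul_measure, lintegral_smul_measure] at h
  rw [ENNReal.ofReal_mul ENNReal.toReal_nonneg, ENNReal.ofReal_toReal (measure_ne_top _ _)]
  rw [ENNReal.toReal_inv, smul_eq_mul, smul_eq_mul] at h
  calc _ ≤ lam A * ((lam A)⁻¹ * ∫⁻ s in A, ENNReal.ofReal (cext θ (g s)) ∂lam) := by gcongr
    _ = _ := by rw [← mul_assoc, ENNReal.mul_inv_cancel hA0 (measure_ne_top _ _), one_mul]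

/-- entropy of a density -/
lemma klDiv_withDensity {f : ℝ → ℝ} (hf : Measurable f) (hf0 : ∀ x, 0 ≤ f x)
    [IsFiniteMeasure (lam.withDensity fun x => ENNReal.ofReal (f x))] :
    InformationTheory.klDiv (lam.withDensity fun x => ENNReal.ofReal (f x)) lam =
      ∫⁻ x, ENNReal.ofReal (InformationTheory.klFun (f x)) ∂lam := by
  rw [InformationTheory.klDiv_eq_lintegral_klFun_of_ac (withDensity_absolutelyContinuous _ _)]
  apply lintegral_congr_ae
  filter_upwards [Measure.rnDeriv_withDensity lam hf.ennreal_ofReal] with x hx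
  rw [hx, ENNReal.toReal_ofReal (hf0 x)]

/-- test measures -/
noncomputable def testP (A B : Set ℝ) : Measure ℝ :=
  lam.restrict Bᶜ + (lam B / lam A) • lam.restrict A

section test
variable {A B : Set ℝ} (hA : MeasurableSet A) (hB : MeasurableSet B) (hAB : A ⊆ B) (hA0 : lam A ≠ 0)
include hA hB hA0

lemma testP_prob : IsProbabilityMeasure (testP A B) := by
  constructor
  simp only [testP, Measure.add_apply, Measure.smul_apply, Measure.restrict_apply_univ, smul_eq_mul]
  rw [ENNReal.div_mul_cancel hA0 (measure_ne_top _ _), add_comm, prob_add_prob_compl hB]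

include hAB
open scoped Classical in
lemma testP_entropy : InformationTheory.klDiv (testP A B) lam =
    ENNReal.ofReal ((lam B).toReal * Real.log ((lam B).toReal / (lam A).toReal)) := by
  have := testP_prob hA hB hA0
  set β := (lam B).toReal with hβ
  set α := (lam A).toReal with hα
  have hα0 : 0 < α := ENNReal.toReal_pos hA0 (measure_ne_top _ _)
  have hαβ : α ≤ β := ENNReal.toReal_mono (measure_ne_top _ _) (measure_mono hAB)
  set G : ℝ → ℝ := fun s => if s ∈ A then β / α else if s ∈ B then 0 else 1 with hG
  have hGm : Measurable G := Measurable.ite hA measurable_const (Measurable.ite hB measurable_const measurable_const)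
  have hG0 : ∀ x, 0 ≤ G x := fun x => by
    simp only [hG]; split_ifs <;> positivity
  have hr : lam B / lam A = ENNReal.ofReal (β / α) := by
    rw [ENNReal.ofReal_div_of_pos hα0, hβ, hα, ENNReal.ofReal_toReal (measure_ne_top _ _),
      ENNReal.ofReal_toReal (measure_ne_top _ _)]
  have e : testP A B = lam.withDensity fun x => ENNReal.ofReal (G x) := by
    have : (fun x => ENNReal.ofReal (G x)) =
        (fun x => Bᶜ.indicator 1 x + A.indicator (fun _ => lam B / lam A) x) := by
      ext x
      by_cases h1 : x ∈ A
      · have h2 := hAB h1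
        simp [hG, h1, h2, hr]
      · by_cases h2 : x ∈ B
        · simp [hG, h1, h2]
        · simp [hG, h1, h2]
    rw [this]
    have h2 := withDensity_add_left (μ := lam) (f := Bᶜ.indicator 1)
      (measurable_one.indicator hB.compl) (A.indicator (fun _ => lam B / lam A))
    rw [show (fun x => Bᶜ.indicator 1 x + A.indicator (fun _ => lam B / lam A) x) =
      (Bᶜ.indicator 1 + A.indicator (fun _ => lam B / lam A)) from rfl, h2,
      withDensity_indicator hB.compl, withDensity_indicator hA, withDensity_const, withDensity_one]
    rfl
  have hfin : IsFiniteMeasure (lam.withDensity fun x => ENNReal.ofReal (G x)) := by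
    rw [← e]; infer_instance
  rw [e, klDiv_withDensity hGm hG0]
  have : (fun x => ENNReal.ofReal (InformationTheory.klFun (G x))) =
      (fun x => A.indicator (fun _ => ENNReal.ofReal (InformationTheory.klFun (β / α))) x +
        (B \ A).indicator (fun _ => 1) x) := by
    ext x
    by_cases h1 : x ∈ A
    · simp [hG, h1]
    · by_cases h2 : x ∈ B
      · simp [hG, h1, h2, InformationTheory.klFun]
      · simp [hG, h1, h2, InformationTheory.klFun]
  rw [this, lintegral_add_right _ (measurable_const.indicator (hB.diff hA)),
    lintegral_indicator_const hA, lintegral_indicator_const (hB.diff hA), one_mul,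
    measure_sdiff hAB hA.nullMeasurableSet (measure_ne_top _ _)]
  rw [← ENNReal.ofReal_toReal (measure_ne_top lam A), ← ENNReal.ofReal_toReal (measure_ne_top lam B),
    ← ENNReal.ofReal_mul (InformationTheory.klFun_nonneg (by positivity)), ← ENNReal.ofReal_sub _ hα0.le,
    ← ENNReal.ofReal_add]
  · congr 1
    rw [← hα, ← hβ, InformationTheory.klFun]
    field_simp
    ring
  · exact mul_nonneg (InformationTheory.klFun_nonneg (by positivity)) hα0.le
  · linarith

end test

end WT

open MeasureTheory ProbabilityTheory Real Set Filter Topology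
open scoped ENNReal NNReal
set_option linter.unusedVariables false
set_option linter.unusedSectionVars false

namespace WT
variable {θ : ℝ → ℝ} {t₀ : ℝ}

lemma cond_entropy (μ : Measure ℝ) [IsProbabilityMeasure μ] {s : Set ℝ} (hs : MeasurableSet s)
    (h0 : μ s ≠ 0) : relEnt (cond μ s) μ ≠ ⊤ := by
  have : IsProbabilityMeasure (cond μ s) := cond_isProbabilityMeasure h0
  have hac : cond μ s ≪ μ := cond_absolutelyContinuous
  rw [relEnt_eq_klDiv, InformationTheory.klDiv_eq_lintegral_klFun_of_ac hac]
  have e : cond μ s = μ.withDensity (s.indicator fun _ => (μ s)⁻¹) := by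
    rw [withDensity_indicator hs, withDensity_const]; rfl
  have hm : Measurable (s.indicator fun _ => (μ s)⁻¹) := measurable_const.indicator hs
  have h1 : ∀ᵐ x ∂μ, (cond μ s).rnDeriv μ x = s.indicator (fun _ => (μ s)⁻¹) x := by
    rw [e]; exact Measure.rnDeriv_withDensity μ hm
  have : ∫⁻ x, ENNReal.ofReal (InformationTheory.klFun ((cond μ s).rnDeriv μ x).toReal) ∂μ ≤
      ∫⁻ x, (ENNReal.ofReal (InformationTheory.klFun ((μ s)⁻¹).toReal) + 1) ∂μ := by
    apply lintegral_mono_ae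
    filter_upwards [h1] with x hx
    rw [hx]
    by_cases hxs : x ∈ s
    · simp [hxs]
    · simp [hxs, InformationTheory.klFun]
  refine ne_top_of_le_ne_top ?_ this
  simp

lemma moment_of_Tplus (H : GoodCost θ t₀) (μ : Measure ℝ) [IsProbabilityMeasure μ] {a : ℝ} (ha : 0 < a)
    (h : Tplus (fun t => θ (a * t)) μ) : Integrable (fun x => x) μ := by
  obtain ⟨M, hM⟩ : ∃ M : ℕ, μ (Icc (-(M:ℝ)) M) ≠ 0 := by
    by_contra! hc
    have : μ (⋃ M : ℕ, Icc (-(M:ℝ)) M) = 0 := measure_iUnion_null hc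
    have hu : (⋃ M : ℕ, Icc (-(M:ℝ)) M) = univ := by
      ext x
      obtain ⟨n, hn⟩ := exists_nat_ge |x|
      simp only [mem_iUnion, mem_univ, iff_true]
      exact ⟨n, abs_le.1 hn⟩
    rw [hu, measure_univ] at this
    exact one_ne_zero this
  set S := Icc (-(M:ℝ)) M
  have hS : MeasurableSet S := measurableSet_Icc
  have hpr : IsProbabilityMeasure (cond μ S) := cond_isProbabilityMeasure hM
  have hmem : ∀ᵐ y ∂(cond μ S), y ∈ S := ae_cond_mem hS
  have hintg : Integrable (fun x => x) (cond μ S) := by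
    refine Integrable.of_bound (C := M) measurable_id.aestronglyMeasurable ?_
    filter_upwards [hmem] with y hy using abs_le.2 hy
  have h1 := h _ hpr hintg
  have h2 : weakCost (fun t => θ (a * t)) (cond μ S) μ < ⊤ :=
    lt_of_le_of_lt h1 (lt_top_iff_ne_top.2 (cond_entropy μ hS hM))
  rw [weakCost] at h2
  simp only [iInf_lt_iff] at h2
  obtain ⟨p, hp, hb, hc⟩ := h2
  have hbd : ∀ᵐ x ∂μ, |bary p x| ≤ M := by
    filter_upwards [ae_ae_bind p hb hmem] with x hx
    have := norm_integral_le_of_norm_le_const (μ := p x) (f := fun y => y) (C := M)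
      (by filter_upwards [hx] with y hy using abs_le.2 hy)
    simpa [bary] using this
  have key : ∀ᵐ x ∂μ, ‖x‖ₑ ≤ ENNReal.ofReal (M + t₀ / (2 * a)) +
      ENNReal.ofReal (1 / (2 * t₀ * a)) * ENNReal.ofReal (θ (a * |x - ∫ y, y ∂(p x)|)) := by
    filter_upwards [hbd] with x hx
    have hp0 := H.pos
    have h3 := H.tangent (t := a * |x - bary p x|) (by positivity)
    have h4 : |x| ≤ |x - bary p x| + |bary p x| := by
      have := abs_add_le (x - bary p x) (bary p x); simpa using this
    rw [← ENNReal.ofReal_mul (by positivity), ← ENNReal.ofReal_add (by positivity)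
      (mul_nonneg (by positivity) (H.nn _ (by positivity))), ← ofReal_norm]
    apply ENNReal.ofReal_le_ofReal
    rw [Real.norm_eq_abs]
    change _ ≤ _ + 1 / (2 * t₀ * a) * θ (a * |x - bary p x|)
    have h5 : 1 / (2 * t₀ * a) * (2 * t₀ * (a * |x - bary p x|) - t₀ ^ 2) ≤
        1 / (2 * t₀ * a) * θ (a * |x - bary p x|) := by gcongr
    have h6 : 1 / (2 * t₀ * a) * (2 * t₀ * (a * |x - bary p x|) - t₀ ^ 2) =
      |x - bary p x| - t₀ / (2 * a) := by field_simp
    linarith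
  refine ⟨measurable_id.aestronglyMeasurable, ?_⟩
  refine lt_of_le_of_lt (lintegral_mono_ae key) ?_
  rw [lintegral_add_left measurable_const, lintegral_const_mul' _ _ ENNReal.ofReal_ne_top]
  simp only [lintegral_const, measure_univ, mul_one]
  exact ENNReal.add_lt_top.2 ⟨ENNReal.ofReal_lt_top, ENNReal.mul_lt_top ENNReal.ofReal_lt_top hc⟩

section
variable (H : GoodCost θ t₀) (μ : Measure ℝ) [IsProbabilityMeasure μ] {a : ℝ} (ha : 0 < a)
  {A B : Set ℝ} (hA : MeasurableSet A) (hB : MeasurableSet B) (hAB : A ⊆ B) (hA0 : lam A ≠ 0)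
  (hm : Integrable (fun x => x) μ)

include hm in
lemma int_V : Integrable (V μ) lam := by
  rw [← map_V μ] at hm
  exact (integrable_map_measure measurable_id.aestronglyMeasurable (measurable_V μ).aemeasurable).1 hm

include hA hB hA0 hm in
lemma int_testP : Integrable (fun x => x) ((testP A B).map (V μ)) := by
  rw [integrable_map_measure measurable_id'.aestronglyMeasurable (measurable_V μ).aemeasurable]
  show Integrable (V μ) _
  have := int_V μ hm
  rw [testP, integrable_add_measure]
  refine ⟨this.restrict, this.restrict.smul_measure ?_⟩
  exact ENNReal.div_ne_top (measure_ne_top _ _) hA0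

include H ha hA hB hAB hA0 hm in
/-- `T⁻` consequence -/
lemma Tminus_core (σ : ℝ) (hσ : |σ| = 1) (h : Tminus (fun t => θ (a * t)) μ)
    (hu : (∃ u, (∀ s ∈ Ioo (0:ℝ) 1, s ∈ B → σ * u ≤ σ * V μ s) ∧
      (∀ s ∈ Ioo (0:ℝ) 1, s ∉ B → σ * V μ s ≤ σ * u)) ∨ B = univ) :
    a * ((lam A).toReal⁻¹ * (∫ s in A, σ * V μ s ∂lam) - (lam B).toReal⁻¹ * (∫ s in B, σ * V μ s ∂lam)) ≤
      cinv θ (Real.log ((lam B).toReal / (lam A).toReal)) := by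
  have hpr := testP_prob hA hB hA0
  have hpr2 : IsProbabilityMeasure ((testP A B).map (V μ)) :=
    Measure.isProbabilityMeasure_map (measurable_V μ).aemeasurable
  have hintg := int_testP μ hA hB hA0 hm
  have h1 := (h _ hpr2 hintg).trans (relEnt_map_le μ _)
  rw [testP_entropy hA hB hAB hA0] at h1
  have hVi := int_V μ hm
  set β := (lam B).toReal with hβ
  set α := (lam A).toReal with hα
  have hα0 : 0 < α := ENNReal.toReal_pos hA0 (measure_ne_top _ _)
  have hαβ : α ≤ β := ENNReal.toReal_mono (measure_ne_top _ _) (measure_mono hAB)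
  have hβ0 : 0 < β := by linarith
  have hr : lam B / lam A = ENNReal.ofReal (β / α) := by
    rw [ENNReal.ofReal_div_of_pos hα0, hβ, hα, ENNReal.ofReal_toReal (measure_ne_top _ _),
      ENNReal.ofReal_toReal (measure_ne_top _ _)]
  have hlog : 0 ≤ Real.log (β / α) := Real.log_nonneg (by rw [le_div_iff₀ hα0]; linarith)
  set D := α⁻¹ * (∫ s in A, σ * V μ s ∂lam) - β⁻¹ * (∫ s in B, σ * V μ s ∂lam) with hD
  have key : ENNReal.ofReal (β * cext θ (a * D)) ≤ weakCost (fun t => θ (a * t)) μ ((testP A B).map (V μ)) := by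
    rw [weakCost]
    refine le_iInf fun p => le_iInf fun hp => le_iInf fun hb => ?_
    rw [cost_pull H ha _ (measurable_V μ)]
    have hbi : Integrable (fun s => bary p (V μ s)) (testP A B) :=
      (integrable_map_measure (measurable_bary p).aestronglyMeasurable (measurable_V μ).aemeasurable).1
        (int_bary p hb hm)
    have hbA : IntegrableOn (fun s => bary p (V μ s)) A lam := by
      rw [testP, integrable_add_measure] at hbi
      have := hbi.2
      rwa [integrable_smul_measure] at this
      · rw [hr]; simp; positivity
      · exact ENNReal.div_ne_top (measure_ne_top _ _) hA0
    -- barycenter inequality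
    have hbar : β / α * (∫ s in A, σ * bary p (V μ s) ∂lam) ≤ ∫ s in B, σ * V μ s ∂lam := by
      rcases hu with ⟨u, hu1, hu2⟩ | hu
      · have h2 := pos_bary p hb hm σ u
        rw [lintegral_map (by have := measurable_bary p; fun_prop) (measurable_V μ)] at h2
        have h3 : ∫⁻ y, ENNReal.ofReal (σ * (y - u)) ∂μ = ENNReal.ofReal (∫ s in B, σ * (V μ s - u) ∂lam) := by
          conv_lhs => rw [← map_V μ]
          rw [lintegral_map (by fun_prop) (measurable_V μ),
            ofReal_integral_eq_lintegral_ofReal, ← lintegral_indicator hB]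
          · apply lintegral_congr_ae
            filter_upwards [ae_lam] with s hs
            by_cases hsB : s ∈ B
            · simp [hsB]
            · simp [hsB]; linarith [hu2 s hs hsB]
          · exact ((hVi.sub (integrable_const _)).const_mul _).restrict
          · rw [EventuallyLE, ae_restrict_iff' hB]
            filter_upwards [ae_lam] with s hs hsB
            simp; linarith [hu1 s hs hsB]
        have h4 : ENNReal.ofReal (β / α * ∫ s in A, σ * (bary p (V μ s) - u) ∂lam) ≤
            ∫⁻ s, ENNReal.ofReal (σ * (bary p (V μ s) - u)) ∂(testP A B) := by
          rw [testP, lintegral_add_measure, lintegral_smul_measure, hr]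
          refine le_trans ?_ le_add_self
          rw [ENNReal.ofReal_mul (by positivity), smul_eq_mul]
          gcongr
          have hI : Integrable (fun s => σ * (bary p (V μ s) - u)) (lam.restrict A) :=
            (hbA.sub (integrable_const _)).const_mul _
          calc ENNReal.ofReal (∫ s in A, σ * (bary p (V μ s) - u) ∂lam)
              ≤ ENNReal.ofReal (∫ s in A, max (σ * (bary p (V μ s) - u)) 0 ∂lam) := by
                apply ENNReal.ofReal_le_ofReal
                exact integral_mono hI hI.pos_part fun y => le_max_left _ _
            _ = ∫⁻ s in A, ENNReal.ofReal (max (σ * (bary p (V μ s) - u)) 0) ∂lam := by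
                rw [ofReal_integral_eq_lintegral_ofReal hI.pos_part (ae_of_all _ fun y => le_max_right _ _)]
            _ = _ := by
                congr 1; ext y
                rcases le_total (σ * (bary p (V μ y) - u)) 0 with h | h
                · simp [h, ENNReal.ofReal_of_nonpos h]
                · simp [h]
        have h5 := h4.trans (h2.trans h3.le)
        have h6 : 0 ≤ ∫ s in B, σ * (V μ s - u) ∂lam := by
          apply integral_nonneg_of_ae
          rw [EventuallyLE, ae_restrict_iff' hB]
          filter_upwards [ae_lam] with s hs hsB
          simp; linarith [hu1 s hs hsB]
        rw [ENNReal.ofReal_le_ofReal_iff h6] at h5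
        have e1 : ∫ s in A, σ * (bary p (V μ s) - u) ∂lam = (∫ s in A, σ * bary p (V μ s) ∂lam) - α * (σ * u) := by
          simp_rw [mul_sub]
          rw [integral_sub (hbA.const_mul _) (integrable_const _)]
          simp [hα, Measure.real]
        have e2 : ∫ s in B, σ * (V μ s - u) ∂lam = (∫ s in B, σ * V μ s ∂lam) - β * (σ * u) := by
          simp_rw [mul_sub]
          rw [integral_sub (hVi.restrict.const_mul _) (integrable_const _)]
          simp [hβ, Measure.real]
        rw [e1, e2, mul_sub] at h5
        have : β / α * (α * (σ * u)) = β * (σ * u) := by field_simp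
        linarith
      · have h2 := integral_bary p hb hm
        rw [integral_map (measurable_V μ).aemeasurable (measurable_bary p).aestronglyMeasurable] at h2
        have h3 : ∫ y, y ∂μ = ∫ s, V μ s ∂lam := by
          conv_lhs => rw [← map_V μ]
          rw [integral_map (measurable_V μ).aemeasurable measurable_id'.aestronglyMeasurable]
        rw [h3, testP, hr, hu, compl_univ, Measure.restrict_empty, zero_add, integral_smul_measure,
          ENNReal.toReal_ofReal (by positivity), smul_eq_mul] at h2
        rw [hu, Measure.restrict_univ, integral_const_mul, integral_const_mul, ← h2]
        apply le_of_eq; ring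
    -- cost
    have hJ := jensenSet H hA hA0 (g := fun s => a * (σ * (V μ s - bary p (V μ s))))
      (((hVi.restrict.sub hbA).const_mul _).const_mul _)
    calc ENNReal.ofReal (β * cext θ (a * D))
        ≤ ENNReal.ofReal (β / α * (α * cext θ (α⁻¹ * ∫ s in A, a * (σ * (V μ s - bary p (V μ s))) ∂lam))) := by
          apply ENNReal.ofReal_le_ofReal
          rw [← mul_assoc, div_mul_cancel₀ _ hα0.ne']
          apply mul_le_mul_of_nonneg_left _ hβ0.le
          apply H.ext_mono
          rw [integral_const_mul]
          simp_rw [mul_sub]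
          rw [integral_sub (hVi.restrict.const_mul _) (hbA.const_mul _)]
          rw [show α⁻¹ * (a * ((∫ s in A, σ * V μ s ∂lam) - ∫ s in A, σ * bary p (V μ s) ∂lam)) =
            a * (α⁻¹ * (∫ s in A, σ * V μ s ∂lam) - α⁻¹ * ∫ s in A, σ * bary p (V μ s) ∂lam) by ring, hD]
          apply mul_le_mul_of_nonneg_left _ ha.le
          have : α⁻¹ * ∫ s in A, σ * bary p (V μ s) ∂lam ≤ β⁻¹ * ∫ s in B, σ * V μ s ∂lam := by
            rw [← mul_le_mul_iff_of_pos_left hβ0, ← mul_assoc, ← mul_assoc, mul_inv_cancel₀ hβ0.ne', one_mul]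
            exact hbar
          linarith
      _ ≤ ENNReal.ofReal (β / α) * ∫⁻ s in A, ENNReal.ofReal (cext θ (a * (σ * (V μ s - bary p (V μ s))))) ∂lam := by
          rw [ENNReal.ofReal_mul (by positivity)]
          gcongr
      _ ≤ ENNReal.ofReal (β / α) * ∫⁻ s in A, ENNReal.ofReal (cext θ (a * |V μ s - bary p (V μ s)|)) ∂lam := by
          gcongr with s
          apply H.ext_mono
          apply mul_le_mul_of_nonneg_left _ ha.le
          refine (le_abs_self _).trans ?_
          rw [abs_mul, hσ, one_mul]
      _ ≤ _ := by
          rw [testP, lintegral_add_measure, lintegral_smul_measure, hr]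
          exact le_add_self
  have h2 := key.trans h1
  rw [ENNReal.ofReal_le_ofReal_iff (by positivity)] at h2
  have h3 := le_of_mul_le_mul_left h2 hβ0
  exact (le_max_left _ _).trans (H.c2 hlog h3 (le_max_right _ _))

include H ha hA hB hAB hA0 hm in
/-- `T⁺` consequence -/
lemma Tplus_core (σ : ℝ) (hσ : |σ| = 1) (h : Tplus (fun t => θ (a * t)) μ) (w : ℝ)
    (hw1 : ∀ s ∈ Ioo (0:ℝ) 1, s ∈ B \ A → σ * w ≤ σ * V μ s)
    (hw2 : ∀ s ∈ Ioo (0:ℝ) 1, s ∉ B \ A → σ * V μ s ≤ σ * w) :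
    a * ((lam B).toReal⁻¹ * ∫ s in B \ A, σ * (V μ s - w) ∂lam) ≤
      cinv θ (Real.log ((lam B).toReal / (lam A).toReal)) := by
  have hpr := testP_prob hA hB hA0
  have hpr2 : IsProbabilityMeasure ((testP A B).map (V μ)) :=
    Measure.isProbabilityMeasure_map (measurable_V μ).aemeasurable
  have hintg := int_testP μ hA hB hA0 hm
  have h1 := (h _ hpr2 hintg).trans (relEnt_map_le μ _)
  rw [testP_entropy hA hB hAB hA0] at h1
  have hVi := int_V μ hm
  set β := (lam B).toReal with hβ
  set α := (lam A).toReal with hα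
  have hα0 : 0 < α := ENNReal.toReal_pos hA0 (measure_ne_top _ _)
  have hαβ : α ≤ β := ENNReal.toReal_mono (measure_ne_top _ _) (measure_mono hAB)
  have hβ0 : 0 < β := by linarith
  have hB0 : lam B ≠ 0 := fun h0 => hA0 (measure_mono_null hAB h0)
  have hlog : 0 ≤ Real.log (β / α) := Real.log_nonneg (by rw [le_div_iff₀ hα0]; linarith)
  have hBA := hB.diff hA
  have key : ENNReal.ofReal (β * cext θ (a * (β⁻¹ * ∫ s in B \ A, σ * (V μ s - w) ∂lam))) ≤
      weakCost (fun t => θ (a * t)) ((testP A B).map (V μ)) μ := by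
    rw [weakCost]
    refine le_iInf fun p => le_iInf fun hp => le_iInf fun hb => ?_
    have hae : ∀ᵐ y ∂((testP A B).map (V μ)), σ * y ≤ σ * w := by
      rw [ae_map_iff (measurable_V μ).aemeasurable (measurableSet_le (by fun_prop) (by fun_prop)), testP, ae_add_measure_iff]
      constructor
      · rw [ae_restrict_iff' hB.compl]
        filter_upwards [ae_lam] with s hs hsB using hw2 s hs (fun h => hsB h.1)
      · apply Measure.ae_smul_measure
        rw [ae_restrict_iff' hA]
        filter_upwards [ae_lam] with s hs hsA using hw2 s hs (fun h => h.2 hsA)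
    have hbw : ∀ᵐ x ∂μ, σ * bary p x ≤ σ * w := by
      filter_upwards [ae_ae_bind p hb hae, ae_int_bind p hb hintg] with x hx hxi
      rw [bary, ← integral_const_mul]
      calc ∫ y, σ * y ∂(p x) ≤ ∫ y, σ * w ∂(p x) := integral_mono_ae (hxi.const_mul _) (integrable_const _) hx
        _ = σ * w := by simp
    have hbw' : ∀ᵐ s ∂lam, σ * bary p (V μ s) ≤ σ * w := by
      rw [← map_V μ] at hbw
      exact ae_of_ae_map (measurable_V μ).aemeasurable hbw
    have hcp := cost_pull H ha lam (measurable_V μ) p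
    rw [map_V] at hcp
    rw [hcp]
    have hgi : Integrable ((B \ A).indicator fun s => a * (σ * (V μ s - w))) lam :=
      (((hVi.sub (integrable_const _)).const_mul _).const_mul _).indicator hBA
    have hJ := jensenSet H hB hB0 hgi.restrict
    calc _ = ENNReal.ofReal (β * cext θ (β⁻¹ * ∫ s in B, (B \ A).indicator (fun s => a * (σ * (V μ s - w))) s ∂lam)) := by
          rw [setIntegral_indicator hBA, inter_eq_self_of_subset_right sdiff_subset, integral_const_mul a]
          congr 3; ring
      _ ≤ _ := hJ
      _ ≤ ∫⁻ s in B, ENNReal.ofReal (cext θ (a * |V μ s - bary p (V μ s)|)) ∂lam := by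
          apply lintegral_mono_ae
          apply ae_restrict_of_ae
          filter_upwards [hbw'] with s hs
          apply ENNReal.ofReal_le_ofReal
          apply H.ext_mono
          by_cases hsB : s ∈ B \ A
          · rw [indicator_of_mem hsB]
            apply mul_le_mul_of_nonneg_left _ ha.le
            have : σ * (V μ s - bary p (V μ s)) ≤ |V μ s - bary p (V μ s)| := by
              refine (le_abs_self _).trans ?_
              rw [abs_mul, hσ, one_mul]
            linarith
          · rw [indicator_of_notMem hsB]; positivity
      _ ≤ _ := setLIntegral_le_lintegral _ _
  have h2 := key.trans h1
  rw [ENNReal.ofReal_le_ofReal_iff (by positivity)] at h2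
  have h3 := le_of_mul_le_mul_left h2 hβ0
  exact (le_max_left _ _).trans (H.c2 hlog h3 (le_max_right _ _))

end
end WT

open MeasureTheory ProbabilityTheory Real Set Filter Topology
open scoped ENNReal NNReal
set_option linter.unusedVariables false
set_option linter.unusedSectionVars false

namespace WT
variable {θ : ℝ → ℝ} {t₀ : ℝ}

section
variable (H : GoodCost θ t₀) (μ : Measure ℝ) [IsProbabilityMeasure μ] {a : ℝ} (ha : 0 < a)
  (hm : Integrable (fun x => x) μ)

lemma setInt_ge {A : Set ℝ} (hA : MeasurableSet A) {g : ℝ → ℝ} (hg : Integrable g lam) {c : ℝ}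
    (h : ∀ s ∈ Ioo (0:ℝ) 1, s ∈ A → c ≤ g s) : (lam A).toReal * c ≤ ∫ s in A, g s ∂lam := by
  calc (lam A).toReal * c = ∫ s in A, c ∂lam := by simp [Measure.real]
    _ ≤ _ := by
      apply integral_mono_ae (integrable_const _) hg.restrict
      rw [EventuallyLE, ae_restrict_iff' hA]
      filter_upwards [ae_lam] with s hs hsA using h s hs hsA

include H ha hm in
lemma onesided (σ : ℝ) (hσ : |σ| = 1) (hT1 : Tminus (fun t => θ (a * t)) μ)
    (hT2 : Tplus (fun t => θ (a * t)) μ)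
    {A B1 B : Set ℝ} (hA : MeasurableSet A) (hB1 : MeasurableSet B1) (hB : MeasurableSet B)
    (hAB1 : A ⊆ B1) (hB1B : B1 ⊆ B) {ε h : ℝ} (hε : 0 < ε) (hh : 0 < h)
    (mA : (lam A).toReal = ε * Real.exp (-h)) (mB1 : (lam B1).toReal = ε) (mB : (lam B).toReal = 2 * ε)
    (u' u v : ℝ) (h1 : ∀ s ∈ Ioo (0:ℝ) 1, s ∈ B → σ * u' ≤ σ * V μ s)
    (h2 : ∀ s ∈ Ioo (0:ℝ) 1, s ∉ B → σ * V μ s ≤ σ * u')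
    (h3 : ∀ s ∈ Ioo (0:ℝ) 1, s ∉ B1 → σ * V μ s ≤ σ * u)
    (h4 : ∀ s ∈ Ioo (0:ℝ) 1, s ∈ A → σ * v ≤ σ * V μ s)
    (h5 : ∀ s ∈ Ioo (0:ℝ) 1, s ∉ A → σ * V μ s ≤ σ * v) :
    a * (σ * v - σ * u) ≤ 2 * cinv θ (h + Real.log 2) + 2 * cinv θ (Real.log 2) := by
  have hVi := int_V μ hm
  have hexp : 0 < Real.exp (-h) := Real.exp_pos _
  have hexp1 : Real.exp (-h) < 1 := by rw [Real.exp_lt_one_iff]; linarith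
  have hA0 : lam A ≠ 0 := by
    intro h0; rw [h0] at mA; simp at mA
    rcases mA with h | h <;> linarith
  have hAB := hAB1.trans hB1B
  have t1 := Tminus_core H μ ha hA hB hAB hA0 hm σ hσ hT1 (Or.inl ⟨u', h1, h2⟩)
  have mBA : (lam (B \ A)).toReal = 2 * ε - ε * Real.exp (-h) := by
    rw [measure_sdiff hAB hA.nullMeasurableSet (measure_ne_top _ _),
      ENNReal.toReal_sub_of_le (measure_mono hAB) (measure_ne_top _ _), mA, mB]
  have hBA0 : lam (B \ A) ≠ 0 := by
    intro h0; rw [h0] at mBA; simp at mBA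
    nlinarith
  have eBA : B \ (B \ A) = A := by rw [sdiff_sdiff_right_self]; exact inter_eq_self_of_subset_right hAB
  have t2 := Tplus_core H μ ha (hB.diff hA) hB sdiff_subset hBA0 hm σ hσ hT2 v
    (by rw [eBA]; exact h4) (by rw [eBA]; exact h5)
  rw [eBA] at t2
  rw [mA, mB] at t1
  rw [mB, mBA] at t2
  have l1 : Real.log (2 * ε / (ε * Real.exp (-h))) = h + Real.log 2 := by
    have : 2 * ε / (ε * Real.exp (-h)) = 2 * Real.exp h := by
      rw [Real.exp_neg]; field_simp
    rw [this, Real.log_mul (by norm_num) (Real.exp_pos _).ne', Real.log_exp]; ring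
  have hden : 0 < 2 * ε - ε * Real.exp (-h) := by nlinarith
  have l2 : Real.log (2 * ε / (2 * ε - ε * Real.exp (-h))) ≤ Real.log 2 := by
    apply Real.log_le_log (by positivity)
    rw [div_le_iff₀ hden]; nlinarith
  have l3 : 0 ≤ Real.log (2 * ε / (2 * ε - ε * Real.exp (-h))) := by
    apply Real.log_nonneg
    rw [le_div_iff₀ hden]; nlinarith
  have t2' := t2.trans (H.c3 l3 l2)
  rw [l1] at t1
  -- avg over A
  have a1 := setInt_ge hA (hVi.const_mul σ) h4
  rw [mA] at a1
  have a1' : σ * v ≤ (ε * Real.exp (-h))⁻¹ * ∫ s in A, σ * V μ s ∂lam := by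
    rw [← div_eq_inv_mul, le_div_iff₀ (by positivity)]; linarith
  -- avg over B
  have hgi : Integrable (fun s => A.indicator (fun s => σ * (V μ s - v)) s) lam :=
    ((hVi.sub (integrable_const v)).const_mul σ).indicator hA
  have hw1i : Integrable (fun s => (B1ᶜ).indicator (fun s => σ * u) s) lam :=
    (integrable_const (σ * u)).indicator hB1.compl
  have hw2i : Integrable (fun s => B1.indicator (fun s => σ * v) s) lam :=
    (integrable_const (σ * v)).indicator hB1
  have b1 : ∫ s in B, σ * V μ s ∂lam ≤ ε * (σ * u) + ε * (σ * v) + ∫ s in A, σ * (V μ s - v) ∂lam := by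
    calc ∫ s in B, σ * V μ s ∂lam ≤ ∫ s in B, ((B1ᶜ).indicator (fun s => σ * u) s + B1.indicator (fun s => σ * v) s
          + A.indicator (fun s => σ * (V μ s - v)) s) ∂lam := by
          apply integral_mono_ae (hVi.const_mul σ).restrict ((hw1i.add hw2i).add hgi).restrict
          apply ae_restrict_of_ae
          filter_upwards [ae_lam] with s hs
          by_cases hsB1 : s ∈ B1
          · by_cases hsA : s ∈ A
            · simp [hsA, hsB1]; linarith
            · simp [hsA, hsB1]; exact h5 s hs hsA
          · have hsA : s ∉ A := fun h => hsB1 (hAB1 h)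
            simp [hsA, hsB1]; exact h3 s hs hsB1
      _ = _ := by
          have hw12 : Integrable (fun s => (B1ᶜ).indicator (fun s => σ * u) s + B1.indicator (fun s => σ * v) s) lam :=
            hw1i.add hw2i
          rw [integral_add hw12.restrict hgi.restrict, integral_add hw1i.restrict hw2i.restrict,
            setIntegral_indicator hB1.compl, setIntegral_indicator hB1, setIntegral_indicator hA,
            inter_eq_self_of_subset_right hAB, inter_eq_self_of_subset_right hB1B, ← sdiff_eq]
          have : (lam (B \ B1)).toReal = ε := by
            rw [measure_sdiff hB1B hB1.nullMeasurableSet (measure_ne_top _ _),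
              ENNReal.toReal_sub_of_le (measure_mono hB1B) (measure_ne_top _ _), mB, mB1]; ring
          simp [Measure.real, this, mB1]
  set I := ∫ s in A, σ * (V μ s - v) ∂lam
  have b2 : (2 * ε)⁻¹ * ∫ s in B, σ * V μ s ∂lam ≤ σ * u / 2 + σ * v / 2 + (2 * ε)⁻¹ * I := by
    calc _ ≤ (2 * ε)⁻¹ * (ε * (σ * u) + ε * (σ * v) + I) := by gcongr
      _ = _ := by field_simp
  have c1 : a * (σ * v - (σ * u / 2 + σ * v / 2 + (2 * ε)⁻¹ * I)) ≤ cinv θ (h + Real.log 2) := by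
    refine le_trans (mul_le_mul_of_nonneg_left ?_ ha.le) t1
    linarith
  nlinarith

lemma lam_Ioi {ε : ℝ} (h0 : 0 ≤ ε) (h1 : ε ≤ 1) : (lam (Ioi (1 - ε))).toReal = ε := by
  rw [lam_apply measurableSet_Ioi]
  have : Ioi (1 - ε) ∩ Ioo 0 1 = Ioo (1 - ε) 1 := by
    ext s; simp only [mem_inter_iff, mem_Ioi, mem_Ioo]
    constructor
    · rintro ⟨a, b, c⟩; exact ⟨a, c⟩
    · rintro ⟨a, b⟩; exact ⟨a, by linarith, b⟩
  rw [this, Real.volume_Ioo, ENNReal.toReal_ofReal (by linarith)]; ring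

lemma lam_Iio {ε : ℝ} (h0 : 0 ≤ ε) (h1 : ε ≤ 1) : (lam (Iio ε)).toReal = ε := by
  rw [lam_apply measurableSet_Iio]
  have : Iio ε ∩ Ioo 0 1 = Ioo 0 ε := by
    ext s; simp only [mem_inter_iff, mem_Iio, mem_Ioo]
    constructor
    · rintro ⟨a, b, c⟩; exact ⟨b, a⟩
    · rintro ⟨a, b⟩; exact ⟨b, a, by linarith⟩
  rw [this, Real.volume_Ioo, ENNReal.toReal_ofReal (by linarith)]; ring

include H ha in
theorem delta_of_T (hT1 : Tminus (fun t => θ (a * t)) μ)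
    (hT2 : Tplus (fun t => θ (a * t)) μ) {h : ℝ} (hh : 0 < h) (x : ℝ) :
    Umap μ (x + h) - Umap μ x ≤
          (1 / ((t₀ / (8 * cinv θ (Real.log 3 + t₀ ^ 2))) * a)) * cinv θ (t₀ ^ 2 + h) := by
  have hp := H.pos
  have hm := moment_of_Tplus H μ ha hT2
  have hVi := int_V μ hm
  have hl2 : 0 < Real.log 2 := Real.log_pos (by norm_num)
  have hl23 : Real.log 2 ≤ Real.log 3 := Real.log_le_log (by norm_num) (by norm_num)
  set Z := cinv θ (Real.log 3 + t₀ ^ 2) with hZ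
  set Y := cinv θ (t₀ ^ 2 + h) with hY
  have hZt : t₀ ≤ Z := by rw [hZ, add_comm]; exact H.c8 (by linarith)
  have hYt : t₀ ≤ Y := H.c8 hh.le
  have hc2 : cinv θ (Real.log 2) ≤ Z := H.c3 hl2.le (by nlinarith [sq_nonneg t₀])
  have hch : cinv θ h ≤ Y := H.c3 hh.le (by nlinarith [sq_nonneg t₀])
  have hZY1 : Z ≤ Z * Y / t₀ := by rw [le_div_iff₀ hp]; exact mul_le_mul_of_nonneg_left hYt (by linarith)
  have hZY2 : Y ≤ Z * Y / t₀ := by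
    rw [le_div_iff₀ hp, mul_comm Z]; exact mul_le_mul_of_nonneg_left hZt (by linarith)
  suffices hs : a * (Umap μ (x + h) - Umap μ x) ≤ 4 * Y + 4 * Z by
    have hZ0 : 0 < Z := by linarith
    have : 1 / (t₀ / (8 * Z) * a) * Y = (8 * (Z * Y / t₀)) / a := by field_simp
    rw [this, le_div_iff₀ ha]
    linarith
  rw [Umap_eq, Umap_eq]
  have hone : 2 * cinv θ (h + Real.log 2) + 2 * cinv θ (Real.log 2) ≤ 4 * Y + 4 * Z := by
    have := H.c5 hh.le hl2.le
    linarith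
  have mem1 := expCDF_mem x
  have mem2 := expCDF_mem (x + h)
  rcases lt_or_ge 0 x with hx | hx
  · -- right side
    set ε := Real.exp (-x) / 2 with hε
    have hε0 : 0 < ε := by positivity
    have hε1 : ε < 1 / 2 := by
      have : Real.exp (-x) < 1 := by rw [Real.exp_lt_one_iff]; linarith
      linarith
    have e1 : expCDF x = 1 - ε := by rw [expCDF, if_neg (by linarith)]
    have e2 : expCDF (x + h) = 1 - ε * Real.exp (-h) := by
      rw [expCDF, if_neg (by linarith), neg_add, Real.exp_add]; ring
    have he1 : Real.exp (-h) < 1 := by rw [Real.exp_lt_one_iff]; linarith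
    have he0 := Real.exp_pos (-h)
    have heε : ε * Real.exp (-h) < ε := by nlinarith
    have heε0 : 0 < ε * Real.exp (-h) := by positivity
    have := onesided H μ ha hm 1 (by simp) hT1 hT2 (A := Ioi (1 - ε * Real.exp (-h))) (B1 := Ioi (1 - ε))
      (B := Ioi (1 - 2 * ε)) measurableSet_Ioi measurableSet_Ioi measurableSet_Ioi
      (Ioi_subset_Ioi (by linarith)) (Ioi_subset_Ioi (by linarith)) hε0 hh
      (lam_Ioi heε0.le (by linarith)) (lam_Ioi hε0.le (by linarith)) (lam_Ioi (by linarith) (by linarith))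
      (V μ (1 - 2 * ε)) (V μ (1 - ε)) (V μ (1 - ε * Real.exp (-h)))
      (fun s hs hsB => by simp only [one_mul]; exact V_mono μ (by linarith) (le_of_lt hsB) hs.2)
      (fun s hs hsB => by simp only [one_mul]; exact V_mono μ hs.1 (not_lt.1 hsB) (by linarith))
      (fun s hs hsB => by simp only [one_mul]; exact V_mono μ hs.1 (not_lt.1 hsB) (by linarith))
      (fun s hs hsB => by simp only [one_mul]; exact V_mono μ (by linarith) (le_of_lt hsB) hs.2)
      (fun s hs hsB => by simp only [one_mul]; exact V_mono μ hs.1 (not_lt.1 hsB) (by linarith))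
    rw [e1, e2]
    simp only [one_mul] at this
    linarith
  rcases lt_or_ge (x + h) 0 with hxh | hxh
  · set ε := Real.exp (x + h) / 2 with hε
    have hε0 : 0 < ε := by positivity
    have hε1 : ε < 1 / 2 := by
      have : Real.exp (x + h) < 1 := by rw [Real.exp_lt_one_iff]; linarith
      linarith
    have e1 : expCDF (x + h) = ε := by rw [expCDF, if_pos (by linarith)]
    have e2 : expCDF x = ε * Real.exp (-h) := by
      rw [expCDF, if_pos (by linarith), hε, div_mul_eq_mul_div, ← Real.exp_add]; ring_nf
    have he1 : Real.exp (-h) < 1 := by rw [Real.exp_lt_one_iff]; linarith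
    have he0 := Real.exp_pos (-h)
    have heε : ε * Real.exp (-h) < ε := by nlinarith
    have heε0 : 0 < ε * Real.exp (-h) := by positivity
    have := onesided H μ ha hm (-1) (by simp) hT1 hT2 (A := Iio (ε * Real.exp (-h))) (B1 := Iio ε)
      (B := Iio (2 * ε)) measurableSet_Iio measurableSet_Iio measurableSet_Iio
      (Iio_subset_Iio (by linarith)) (Iio_subset_Iio (by linarith)) hε0 hh
      (lam_Iio heε0.le (by linarith)) (lam_Iio hε0.le (by linarith)) (lam_Iio (by linarith) (by linarith))
      (V μ (2 * ε)) (V μ ε) (V μ (ε * Real.exp (-h)))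
      (fun s hs hsB => by linarith [V_mono μ hs.1 (le_of_lt hsB) (by linarith)])
      (fun s hs hsB => by linarith [V_mono μ (by linarith) (not_lt.1 hsB) hs.2])
      (fun s hs hsB => by linarith [V_mono μ (by linarith) (not_lt.1 hsB) hs.2])
      (fun s hs hsB => by linarith [V_mono μ hs.1 (le_of_lt hsB) (by linarith)])
      (fun s hs hsB => by linarith [V_mono μ (by linarith) (not_lt.1 hsB) hs.2])
    rw [e1, e2]
    nlinarith
  · -- crossing
    set η := Real.exp (-(x + h)) / 2 with hη
    set ζ := Real.exp x / 2 with hζ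
    have hη0 : 0 < η := by positivity
    have hζ0 : 0 < ζ := by positivity
    have hη1 : η ≤ 1 / 2 := by
      have : Real.exp (-(x + h)) ≤ 1 := by rw [Real.exp_le_one_iff]; linarith
      linarith
    have hζ1 : ζ ≤ 1 / 2 := by
      have : Real.exp x ≤ 1 := by rw [Real.exp_le_one_iff]; linarith
      linarith
    have e1 : expCDF (x + h) = 1 - η := by rw [expCDF, if_neg (by linarith)]
    have e2 : expCDF x = ζ := by
      rw [expCDF]
      split_ifs with h'
      · rfl
      · have : x = 0 := by linarith
        rw [hζ, this]; norm_num
    have mA := lam_Ioi hη0.le (by linarith)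
    have mA' := lam_Iio hζ0.le (by linarith)
    have hA0 : lam (Ioi (1 - η)) ≠ 0 := fun h0 => by rw [h0] at mA; simp at mA; linarith
    have hA0' : lam (Iio ζ) ≠ 0 := fun h0 => by rw [h0] at mA'; simp at mA'; linarith
    have t1 := Tminus_core H μ ha measurableSet_Ioi MeasurableSet.univ (subset_univ _) hA0 hm 1 (by simp)
      hT1 (Or.inr rfl)
    have t2 := Tminus_core H μ ha measurableSet_Iio MeasurableSet.univ (subset_univ _) hA0' hm (-1) (by simp)
      hT1 (Or.inr rfl)
    have a1 := setInt_ge (A := Ioi (1 - η)) measurableSet_Ioi (hVi.const_mul 1) (c := V μ (1 - η))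
      (fun s hs hsB => by simp only [one_mul]; exact V_mono μ (by linarith) (le_of_lt hsB) hs.2)
    have a2 := setInt_ge (A := Iio ζ) measurableSet_Iio (hVi.const_mul (-1)) (c := - V μ ζ)
      (fun s hs hsB => by linarith [V_mono μ hs.1 (le_of_lt hsB) (by linarith)])
    rw [mA] at a1 t1
    rw [mA'] at a2 t2
    have a1' : V μ (1 - η) ≤ η⁻¹ * ∫ s in Ioi (1 - η), 1 * V μ s ∂lam := by
      rw [← div_eq_inv_mul, le_div_iff₀ hη0]; linarith
    have a2' : - V μ ζ ≤ ζ⁻¹ * ∫ s in Iio ζ, (-1) * V μ s ∂lam := by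
      rw [← div_eq_inv_mul, le_div_iff₀ hζ0]; linarith
    have hu : (lam univ).toReal = 1 := by simp
    rw [hu, inv_one, one_mul, Measure.restrict_univ] at t1 t2
    have l1 : Real.log (1 / η) = (x + h) + Real.log 2 := by
      rw [hη, one_div, inv_div, Real.log_div (by norm_num) (Real.exp_pos _).ne', Real.log_exp]; ring
    have l2 : Real.log (1 / ζ) = -x + Real.log 2 := by
      rw [hζ, one_div, inv_div, Real.log_div (by norm_num) (Real.exp_pos _).ne', Real.log_exp]; ring
    rw [l1] at t1
    rw [l2] at t2
    rw [integral_const_mul] at t1 t2 a1' a2'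
    rw [integral_const_mul] at t1 t2
    have d1 := H.c5 hxh hl2.le
    have d2 := H.c5 (neg_nonneg.2 hx) hl2.le
    have d3 : cinv θ (x + h) ≤ Y := (H.c3 hxh (by linarith)).trans hch
    have d4 : cinv θ (-x) ≤ Y := (H.c3 (neg_nonneg.2 hx) (by linarith)).trans hch
    rw [e1, e2]
    have g1 := (mul_le_mul_of_nonneg_left (sub_le_sub_right a1' (1 * ∫ s, V μ s ∂lam)) ha.le).trans t1
    have g2 := (mul_le_mul_of_nonneg_left (sub_le_sub_right a2' (-1 * ∫ s, V μ s ∂lam)) ha.le).trans t2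
    nlinarith

end
end WT

open MeasureTheory ProbabilityTheory Real Set Filter Topology
open scoped ENNReal NNReal
set_option linter.unusedVariables false
set_option linter.unusedSectionVars false

namespace WT

/-- two-mass entropy -/
noncomputable def eta (x r : ℝ) : ℝ := x * Real.log (x / r) - x + r

lemma eta_fenchel {x r : ℝ} (hx : 0 ≤ x) (hr : 0 < r) (φ : ℝ) :
    x * φ - r * (Real.exp φ - 1) ≤ eta x r := by
  have he := Real.exp_pos φ
  rcases hx.eq_or_lt with h | h
  · rw [← h]; simp [eta]; nlinarith
  have h1 := Real.one_sub_inv_le_log_of_pos (x := x / (r * Real.exp φ)) (by positivity)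
  rw [Real.log_div h.ne' (by positivity), Real.log_mul hr.ne' he.ne', Real.log_exp, inv_div] at h1
  have h2 := mul_le_mul_of_nonneg_left h1 hx
  rw [mul_sub, mul_div_cancel₀ _ h.ne'] at h2
  rw [eta, Real.log_div h.ne' hr.ne']
  linarith

lemma eta_nonneg {x r : ℝ} (hx : 0 ≤ x) (hr : 0 < r) : 0 ≤ eta x r := by
  have := eta_fenchel hx hr 0
  simpa using this

lemma eta_eq {x r : ℝ} (hr : 0 < r) : eta x r = r * InformationTheory.klFun (x / r) := by
  rw [eta, InformationTheory.klFun]; field_simp; ring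

lemma exp_two {P : ℝ} (hP : |P| ≤ 1 / 10) : Real.exp (-P) + Real.exp (P - 1.2 * P ^ 2) ≤ 2 := by
  have key : ∀ t : ℝ, |t| ≤ 0.112 → Real.exp t ≤ 1 + t + 0.525 * t ^ 2 := by
    intro t ht
    have h := Real.exp_bound (x := t) (by linarith) (n := 3) (by norm_num)
    have h1 := (abs_le.1 h).2
    simp [Finset.sum_range_succ, Nat.factorial] at h1
    have h2 : |t| ^ 3 ≤ 0.112 * t ^ 2 := by
      rw [pow_succ, sq_abs]; nlinarith [sq_nonneg t]
    norm_num at h1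
    nlinarith [sq_nonneg t]
  have hb := abs_le.1 hP
  have h1 := key (-P) (by rw [abs_neg]; linarith)
  have h2 := key (P - 1.2 * P ^ 2) (by rw [abs_le]; constructor <;> nlinarith)
  have h3 : (P - 1.2 * P ^ 2) ^ 2 ≤ 1.2544 * P ^ 2 := by
    have : (P - 1.2 * P ^ 2) ^ 2 = P ^ 2 * (1 - 1.2 * P) ^ 2 := by ring
    rw [this]
    have : (1 - 1.2 * P) ^ 2 ≤ 1.2544 := by nlinarith
    nlinarith [sq_nonneg P]
  nlinarith [sq_nonneg P]

lemma two_point {x y r : ℝ} (hx : 0 ≤ x) (hy : 0 ≤ y) (hr : 0 < r) {P : ℝ} (hP : |P| ≤ 1 / 10) :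
    eta (x + y) (2 * r) + (-P * x + (P - 1.2 * P ^ 2) * y) ≤ eta x r + eta y r := by
  rcases (add_nonneg hx hy).eq_or_lt with h | h
  · have h1 : x = 0 := by linarith
    have h2 : y = 0 := by linarith
    subst h1; subst h2; simp [eta]; linarith
  set l := Real.log ((x + y) / (2 * r)) with hl
  have hel : Real.exp l = (x + y) / (2 * r) := Real.exp_log (by positivity)
  have f1 := eta_fenchel hx hr (-P + l)
  have f2 := eta_fenchel hy hr ((P - 1.2 * P ^ 2) + l)
  rw [Real.exp_add, hel] at f1 f2
  have h3 := exp_two hP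
  have e : r * (Real.exp (-P) * ((x + y) / (2 * r))) + r * (Real.exp (P - 1.2 * P ^ 2) * ((x + y) / (2 * r))) =
    (x + y) / 2 * (Real.exp (-P) + Real.exp (P - 1.2 * P ^ 2)) := by field_simp
  have h4 : (x + y) / 2 * (Real.exp (-P) + Real.exp (P - 1.2 * P ^ 2)) ≤ (x + y) / 2 * 2 := by gcongr
  have e2 : eta (x + y) (2 * r) = (x + y) * l - (x + y) + 2 * r := rfl
  rw [e2]
  linarith

/-- clipped slope -/
noncomputable def PP (E : ℝ) : ℝ := max (-(1/10)) (min ((E - 1) / 10) (1/10))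

/-- Huber function -/
noncomputable def AA (E : ℝ) : ℝ := if |E - 1| ≤ 1 then (E - 1) ^ 2 / 20 else (|E - 1| - 1 / 2) / 10

lemma PP_abs (E : ℝ) : |PP E| ≤ 1 / 10 := by
  rw [PP, abs_le]
  exact ⟨le_max_left _ _, max_le (by norm_num) (min_le_right _ _)⟩

lemma AA_convex {E E' : ℝ} (hE : 0 ≤ E) (hE' : 0 ≤ E') : AA E' - AA E ≤ PP E' * (E' - E) := by
  have hp : PP E' = if E' ≤ 2 then (E' - 1) / 10 else 1 / 10 := by
    split_ifs with h
    · rw [PP, min_eq_left (by linarith), max_eq_right (by linarith)]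
    · rw [PP, min_eq_right (by linarith), max_eq_right (by norm_num)]
  have ha : ∀ E : ℝ, 0 ≤ E → AA E = if E ≤ 2 then (E - 1) ^ 2 / 20 else (E - 3 / 2) / 10 := by
    intro E hE
    rw [AA]
    by_cases h : E ≤ 2
    · rw [if_pos h, if_pos (abs_le.2 ⟨by linarith, by linarith⟩)]
    · rw [if_neg h, if_neg, abs_of_nonneg (by linarith)]
      · ring
      · rw [abs_of_nonneg (by linarith)]; linarith
  rw [hp, ha E hE, ha E' hE']
  split_ifs <;> nlinarith [sq_nonneg (E - E'), sq_nonneg (E - 2)]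

noncomputable def GG (E : ℝ) : ℝ := AA E - 1.2 * PP E ^ 2 * E

noncomputable def gam (E : ℝ) : ℝ := min ((E - 1) ^ 2) |E - 1|
noncomputable def far (E : ℝ) : ℝ := max (E - 2) 0 + max (1 / 2 - E) 0

lemma gam_nonneg (E : ℝ) : 0 ≤ gam E := le_min (sq_nonneg _) (abs_nonneg _)
lemma far_nonneg (E : ℝ) : 0 ≤ far E := add_nonneg (le_max_right _ _) (le_max_right _ _)

lemma AA_nonneg (E : ℝ) : 0 ≤ AA E := by
  rw [AA]; split_ifs with h
  · positivity
  · have := not_le.1 h; linarith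

lemma AA_eq {E : ℝ} (h0 : 0 ≤ E) (h2 : E ≤ 2) : AA E = (E - 1) ^ 2 / 20 := by
  rw [AA, if_pos (abs_le.2 ⟨by linarith, by linarith⟩)]

lemma GG_bounds {E : ℝ} (hE : 0 ≤ E) : 0.026 * gam E ≤ GG E ∧ 0.08 * far E ≤ GG E := by
  by_cases h : E ≤ 2
  · have hp : PP E = (E - 1) / 10 := by
      rw [PP, min_eq_left (by linarith), max_eq_right (by linarith)]
    have hg : GG E = (E - 1) ^ 2 * (0.05 - 0.012 * E) := by
      rw [GG, AA_eq hE h, hp]; ring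
    rw [hg]
    constructor
    · have := min_le_left ((E - 1) ^ 2) |E - 1|
      rw [gam]
      nlinarith [sq_nonneg (E - 1)]
    · rw [far, max_eq_right (by linarith : E - 2 ≤ 0)]
      rcases le_total E (1 / 2) with h' | h'
      · rw [max_eq_left (by linarith)]
        nlinarith [sq_nonneg (E - 1/4), mul_nonneg hE (sq_nonneg (E - 1)), sq_nonneg (E - 0.2)]
      · rw [max_eq_right (by linarith)]
        have : 0 ≤ 0.05 - 0.012 * E := by linarith
        have := mul_nonneg (sq_nonneg (E - 1)) this
        linarith
  · have hp : PP E = 1 / 10 := by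
      rw [PP, min_eq_right (by linarith), max_eq_right (by norm_num)]
    have hA : AA E = (E - 3 / 2) / 10 := by
      rw [AA, if_neg, abs_of_nonneg (by linarith)]
      · ring
      · rw [abs_of_nonneg (by linarith)]; linarith
    rw [GG, hp, hA]
    constructor
    · have := min_le_right ((E - 1) ^ 2) |E - 1|
      rw [abs_of_nonneg (by linarith)] at this
      rw [gam, abs_of_nonneg (by linarith)]
      nlinarith
    · rw [far, max_eq_left (by linarith), max_eq_right (by linarith)]
      nlinarith

lemma GG_nonneg {E : ℝ} (hE : 0 ≤ E) : 0 ≤ GG E := by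
  have := (GG_bounds hE).1
  have := gam_nonneg E
  nlinarith

/-- one step of the dyadic chain -/
lemma chain_step {S S' r : ℝ} (h0 : 0 ≤ S') (h1 : S' ≤ S) (hr : 0 < r) :
    r * GG (S' / r) + r * AA (S' / r) - 2 * r * AA (S / (2 * r)) ≤ eta (S - S') r + eta S' r - eta S (2 * r) := by
  have h := two_point (sub_nonneg.2 h1) h0 hr (PP_abs (S' / r))
  rw [sub_add_cancel] at h
  have hc := AA_convex (E := S / (2 * r)) (E' := S' / r) (div_nonneg (by linarith) (by linarith)) (div_nonneg h0 hr.le)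
  set P := PP (S' / r)
  rw [GG]
  have e : P * (S' / r - S / (2 * r)) * (2 * r) = P * (2 * S' - S) := by field_simp
  have hc' := mul_le_mul_of_nonneg_right hc (by linarith : 0 ≤ 2 * r)
  rw [e] at hc'
  have e2 : r * (1.2 * P ^ 2 * (S' / r)) = 1.2 * P ^ 2 * S' := by field_simp
  change r * (AA (S' / r) - 1.2 * P ^ 2 * (S' / r)) + _ - _ ≤ _
  rw [mul_sub, e2]
  linarith

lemma chain_sum {S : ℕ → ℝ} (h0 : ∀ j, 0 ≤ S j) (h1 : ∀ j, S (j + 1) ≤ S j) (J : ℕ) :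
    ∑ i ∈ Finset.range J, ((1/2) ^ (i + 2) : ℝ) * GG (S (i + 1) / (1/2) ^ (i + 2)) +
      (1/2) ^ (J + 1) * AA (S J / (1/2) ^ (J + 1)) - 1 / 2 * AA (S 0 / (1 / 2)) ≤
    ∑ j ∈ Finset.range J, eta (S j - S (j + 1)) ((1/2) ^ (j + 2)) + eta (S J) ((1/2) ^ (J + 1)) := by
  induction J with
  | zero =>
    have := eta_nonneg (h0 0) (by norm_num : (0:ℝ) < (1/2) ^ (0 + 1))
    simpa using this
  | succ J ih =>
    rw [Finset.sum_range_succ, Finset.sum_range_succ]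
    have h := chain_step (h0 (J + 1)) (h1 J) (by positivity : (0:ℝ) < (1/2) ^ (J + 2))
    have e : (2:ℝ) * (1/2) ^ (J + 2) = (1/2) ^ (J + 1) := by rw [pow_succ (1/2 : ℝ) (J + 1)]; ring
    rw [e] at h
    linarith

end WT

open MeasureTheory ProbabilityTheory Real Set Filter Topology
open scoped ENNReal NNReal
set_option linter.unusedVariables false
set_option linter.unusedSectionVars false

namespace WT

lemma meas_cell {c : ℝ → ℤ} (hc : Measurable c) (k : ℤ) : MeasurableSet (c ⁻¹' {k}) :=
  hc (measurableSet_singleton k)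

lemma lintegral_cells {c : ℝ → ℤ} (hc : Measurable c) (ρ : Measure ℝ) (f : ℝ → ℝ≥0∞) :
    ∫⁻ x, f x ∂ρ = ∑' k : ℤ, ∫⁻ x in c ⁻¹' {k}, f x ∂ρ := by
  rw [← lintegral_iUnion (fun k => meas_cell hc k)]
  · have : (⋃ k : ℤ, c ⁻¹' {k}) = univ := by ext x; simp
    rw [this, setLIntegral_univ]
  · intro i j hij
    rw [Function.onFun, Set.disjoint_left]
    rintro x rfl h
    exact hij h

lemma measure_cells {c : ℝ → ℤ} (hc : Measurable c) (ρ : Measure ℝ) {s : Set ℝ} (hs : MeasurableSet s) :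
    ρ s = ∑' k : ℤ, ρ (c ⁻¹' {k} ∩ s) := by
  have := lintegral_cells hc ρ (s.indicator 1)
  rw [lintegral_indicator_one hs] at this
  rw [this]
  congr 1; ext k
  rw [lintegral_indicator_one hs, Measure.restrict_apply hs, inter_comm]

lemma ennreal_div_mul_cancel {x y : ℝ≥0∞} (h0 : y = 0 → x = 0) (ht : y ≠ ⊤) : x / y * y = x :=
  ENNReal.div_mul_cancel' h0 (fun h => absurd h ht)

section KER
variable {a' b' : ℝ → ℝ≥0∞} (ha : Measurable a') (hb : Measurable b') (hat : ∀ x, a' x ≠ ⊤)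
  (hbt : ∀ x, b' x ≠ ⊤)
  {P Q : Measure ℝ} (hP : P = lam.withDensity a') (hQ : Q = lam.withDensity b')
  {c : ℝ → ℤ} (hc : Measurable c) {q : ℤ → ℤ → ℝ≥0∞}
  [IsProbabilityMeasure P] [IsProbabilityMeasure Q]
  (hrow : ∀ k, ∑' l, q k l = P (c ⁻¹' {k})) (hcol : ∀ l, ∑' k, q k l = Q (c ⁻¹' {l}))

include ha hb hat hbt hP hQ hc hrow hcol

theorem KER : ∃ K : Kernel ℝ ℝ, IsMarkovKernel K ∧ P.bind K = Q ∧
    ∀ᵐ x ∂P, (K x (c ⁻¹' {c x} \ {x}) ≤ (q (c x) (c x) / P (c ⁻¹' {c x}) * a' x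
        - min (q (c x) (c x) / P (c ⁻¹' {c x}) * a' x) (q (c x) (c x) / Q (c ⁻¹' {c x}) * b' x)) / a' x)
      ∧ ∀ l, l ≠ c x → K x (c ⁻¹' {l}) ≤ q (c x) l / P (c ⁻¹' {c x}) := by
  set m : ℤ → ℝ≥0∞ := fun k => P (c ⁻¹' {k}) with hm
  set n : ℤ → ℝ≥0∞ := fun k => Q (c ⁻¹' {k}) with hn
  have hmt : ∀ k, m k ≠ ⊤ := fun k => measure_ne_top _ _
  have hnt : ∀ k, n k ≠ ⊤ := fun k => measure_ne_top _ _
  have hqm : ∀ k l, q k l ≤ m k := fun k l => (ENNReal.le_tsum l).trans_eq (hrow k)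
  have hqn : ∀ k l, q k l ≤ n l := fun k l => (ENNReal.le_tsum (f := fun k => q k l) k).trans_eq (hcol l)
  have hqt : ∀ k l, q k l ≠ ⊤ := fun k l => ne_top_of_le_ne_top (hmt k) (hqm k l)
  have hqm0 : ∀ k l, m k = 0 → q k l = 0 := fun k l h => le_antisymm ((hqm k l).trans_eq h) bot_le
  have hqn0 : ∀ k l, n l = 0 → q k l = 0 := fun k l h => le_antisymm ((hqn k l).trans_eq h) bot_le
  have hA : ∀ k l, q k l / m k ≠ ⊤ := fun k l =>
    ne_top_of_le_ne_top ENNReal.one_ne_top (ENNReal.div_le_of_le_mul (by rw [one_mul]; exact hqm k l))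
  have hB : ∀ k l, q k l / n l ≠ ⊤ := fun k l =>
    ne_top_of_le_ne_top ENNReal.one_ne_top (ENNReal.div_le_of_le_mul (by rw [one_mul]; exact hqn k l))
  set A : ℝ → ℝ≥0∞ := fun x => q (c x) (c x) / m (c x) * a' x with hAdef
  set B : ℝ → ℝ≥0∞ := fun x => q (c x) (c x) / n (c x) * b' x with hBdef
  have hAm : Measurable A := ((measurable_from_top (f := fun k : ℤ => q k k / m k)).comp hc).mul ha
  have hBm : Measurable B := ((measurable_from_top (f := fun k : ℤ => q k k / n k)).comp hc).mul hb
  have hAt : ∀ x, A x ≠ ⊤ := fun x => ENNReal.mul_ne_top (hA _ _) (hat x)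
  have hBt : ∀ x, B x ≠ ⊤ := fun x => ENNReal.mul_ne_top (hB _ _) (hbt x)
  set g : ℝ → ℝ≥0∞ := fun x => min (A x) (B x) with hg
  have hgm : Measurable g := hAm.min hBm
  set rs : ℝ → ℝ≥0∞ := fun x => A x - g x with hrs
  set rt : ℝ → ℝ≥0∞ := fun x => B x - g x with hrt
  have hrsm : Measurable rs := hAm.sub hgm
  have hrtm : Measurable rt := hBm.sub hgm
  have hgrs : ∀ x, g x + rs x = A x := fun x => add_tsub_cancel_of_le (min_le_left _ _)
  have hgrt : ∀ x, g x + rt x = B x := fun x => add_tsub_cancel_of_le (min_le_right _ _)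
  have iA : ∀ k, ∀ s, MeasurableSet s → ∫⁻ x in c ⁻¹' {k} ∩ s, A x ∂lam = q k k / m k * P (c ⁻¹' {k} ∩ s) := by
    intro k s hs
    rw [hP, withDensity_apply _ ((meas_cell hc k).inter hs), ← lintegral_const_mul _ ha]
    apply setLIntegral_congr_fun ((meas_cell hc k).inter hs)
    rintro x ⟨hx, -⟩
    have : c x = k := hx
    simp only [hAdef, this]
  have iB : ∀ k, ∀ s, MeasurableSet s → ∫⁻ x in c ⁻¹' {k} ∩ s, B x ∂lam = q k k / n k * Q (c ⁻¹' {k} ∩ s) := by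
    intro k s hs
    rw [hQ, withDensity_apply _ ((meas_cell hc k).inter hs), ← lintegral_const_mul _ hb]
    apply setLIntegral_congr_fun ((meas_cell hc k).inter hs)
    rintro x ⟨hx, -⟩
    have : c x = k := hx
    simp only [hBdef, this]
  set e : ℤ → ℝ≥0∞ := fun k => ∫⁻ x in c ⁻¹' {k}, rs x ∂lam with he
  have iA' : ∀ k, ∫⁻ x in c ⁻¹' {k}, A x ∂lam = q k k := by
    intro k
    have := iA k univ MeasurableSet.univ
    rw [inter_univ] at this
    rw [this]; exact ennreal_div_mul_cancel (hqm0 k k) (hmt k)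
  have iB' : ∀ k, ∫⁻ x in c ⁻¹' {k}, B x ∂lam = q k k := by
    intro k
    have := iB k univ MeasurableSet.univ
    rw [inter_univ] at this
    rw [this]; exact ennreal_div_mul_cancel (hqn0 k k) (hnt k)
  have he1 : ∀ k, e k ≠ ⊤ := fun k => ne_top_of_le_ne_top (hqt k k)
    ((lintegral_mono (fun x => tsub_le_self)).trans_eq (iA' k))
  have he2 : ∀ k, e k = ∫⁻ x in c ⁻¹' {k}, rt x ∂lam := by
    intro k
    have h1 : ∫⁻ x in c ⁻¹' {k}, g x ∂lam + e k = ∫⁻ x in c ⁻¹' {k}, g x ∂lam + ∫⁻ x in c ⁻¹' {k}, rt x ∂lam := by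
      rw [he, ← lintegral_add_left hgm, ← lintegral_add_left hgm]
      simp only [hgrs, hgrt]
      rw [iA', iB']
    refine (ENNReal.add_right_inj ?_).1 h1
    exact ne_top_of_le_ne_top (hqt k k) ((lintegral_mono (fun x => min_le_left _ _)).trans_eq (iA' k))
  set S : ℤ → Measure ℝ := fun k => (e k)⁻¹ • (lam.withDensity rt).restrict (c ⁻¹' {k}) with hS
  set Qc : ℤ → Measure ℝ := fun l => (n l)⁻¹ • Q.restrict (c ⁻¹' {l}) with hQc
  have S_app : ∀ k s, MeasurableSet s → S k s = (e k)⁻¹ * ∫⁻ x in c ⁻¹' {k} ∩ s, rt x ∂lam := by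
    intro k s hs
    simp only [hS, Measure.smul_apply, smul_eq_mul]
    rw [Measure.restrict_apply hs, withDensity_apply _ (hs.inter (meas_cell hc k)), inter_comm]
  have Q_app : ∀ k s, MeasurableSet s → Qc k s = (n k)⁻¹ * Q (c ⁻¹' {k} ∩ s) := by
    intro k s hs
    simp only [hQc, Measure.smul_apply, smul_eq_mul]
    rw [Measure.restrict_apply hs, inter_comm]
  have eS : ∀ k s, MeasurableSet s → e k * S k s = ∫⁻ x in c ⁻¹' {k} ∩ s, rt x ∂lam := by
    intro k s hs
    rw [S_app k s hs]
    by_cases h0 : e k = 0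
    · rw [h0, zero_mul]
      symm
      refine le_antisymm ?_ bot_le
      exact (lintegral_mono_set inter_subset_left).trans (by rw [← he2, h0])
    · rw [← mul_assoc, ENNReal.mul_inv_cancel h0 (he1 k), one_mul]
  have qQ : ∀ k l s, MeasurableSet s → q k l * Qc l s = q k l / n l * Q (c ⁻¹' {l} ∩ s) := by
    intro k l s hs
    rw [Q_app l s hs, ENNReal.div_eq_inv_mul]; ring
  set w : ℤ → ℤ → ℝ≥0∞ := fun k l => if l = k then 0 else q k l / m k with hw
  set K0 : ℝ → Measure ℝ := fun x => (g x / a' x) • Measure.dirac x + (rs x / a' x) • S (c x) +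
      Measure.sum (fun l => w (c x) l • Qc l) with hK0
  have K0_app : ∀ x s, MeasurableSet s → K0 x s = (g x / a' x) * s.indicator 1 x + (rs x / a' x) * S (c x) s +
      ∑' l, w (c x) l * Qc l s := by
    intro x s hs
    simp only [hK0, Measure.add_apply, Measure.smul_apply, smul_eq_mul, Measure.dirac_apply' _ hs,
      Measure.sum_apply _ hs]
  have K0_meas : Measurable K0 := by
    apply Measure.measurable_of_measurable_coe
    intro s hs
    simp only [K0_app _ s hs]
    refine Measurable.add (Measurable.add ?_ ?_) ?_
    · exact (hgm.div ha).mul (measurable_one.indicator hs)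
    · exact (hrsm.div ha).mul ((measurable_from_top (f := fun k : ℤ => S k s)).comp hc)
    · exact (measurable_from_top (f := fun k : ℤ => ∑' l, w k l * Qc l s)).comp hc
  have hPm : ∀ᵐ x ∂P, m (c x) ≠ 0 := by
    have : ∀ᵐ x ∂P, ∀ k, m k = 0 → c x ≠ k := by
      rw [ae_all_iff]
      intro k
      by_cases h : m k = 0
      · have : P (c ⁻¹' {k}) = 0 := h
        filter_upwards [measure_eq_zero_iff_ae_notMem.1 this] with x hx _ using hx
      · exact Eventually.of_forall fun x h' => absurd h' h
    filter_upwards [this] with x hx h using hx _ h rfl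
  have hPa : ∀ᵐ x ∂P, a' x ≠ 0 := by
    rw [hP, ae_withDensity_iff ha]
    exact Eventually.of_forall fun x h => h
  have hPe : ∀ᵐ x ∂P, e (c x) = 0 → rs x = 0 := by
    have : ∀ᵐ x ∂lam, ∀ k, e k = 0 → c x = k → rs x = 0 := by
      rw [ae_all_iff]
      intro k
      by_cases h : e k = 0
      · have h2 := (lintegral_eq_zero_iff hrsm).1 (show ∫⁻ x, rs x ∂(lam.restrict (c ⁻¹' {k})) = 0 from h)
        have := (ae_restrict_iff' (meas_cell hc k)).1 h2
        filter_upwards [this] with x hx _ h3 using hx h3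
      · exact Eventually.of_forall fun x h' => absurd h' h
    have h2 : ∀ᵐ x ∂P, ∀ k, e k = 0 → c x = k → rs x = 0 := by
      rw [hP]; exact (withDensity_absolutelyContinuous _ _).ae_le this
    filter_upwards [h2] with x hx h using hx _ h rfl
  have wQ : ∀ k l, w k l * Qc l univ = w k l := by
    intro k l
    simp only [hw]
    split_ifs with h
    · simp
    · by_cases h0 : n l = 0
      · rw [hqn0 k l h0]; simp
      · rw [Q_app l univ MeasurableSet.univ, inter_univ]
        rw [ENNReal.inv_mul_cancel h0 (hnt l), mul_one]
  have hK1 : ∀ᵐ x ∂P, K0 x univ = 1 := by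
    filter_upwards [hPm, hPa, hPe] with x h1 h2 h3
    rw [K0_app x univ MeasurableSet.univ]
    simp only [wQ]
    have hs : rs x / a' x * S (c x) univ = rs x / a' x := by
      by_cases h0 : e (c x) = 0
      · rw [h3 h0]; simp
      · rw [S_app _ _ MeasurableSet.univ, inter_univ, ← he2, ENNReal.inv_mul_cancel h0 (he1 _), mul_one]
    rw [hs]
    simp only [indicator_univ, Pi.one_apply, mul_one]
    rw [← ENNReal.add_div, hgrs]
    simp only [hAdef]
    rw [ENNReal.mul_div_cancel_right h2 (hat x)]
    have : ∑' l, q (c x) l / m (c x) = 1 := by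
      simp_rw [div_eq_mul_inv]
      rw [ENNReal.tsum_mul_right, hrow]
      exact ENNReal.mul_inv_cancel h1 (hmt _)
    convert (ENNReal.tsum_eq_add_tsum_ite (f := fun l => q (c x) l / m (c x)) (c x)).symm.trans this
  set N : Set ℝ := {x | K0 x univ = 1} with hN
  have hNm : MeasurableSet N := (Measure.measurable_coe MeasurableSet.univ |>.comp K0_meas) (measurableSet_singleton 1)
  classical
  let K : Kernel ℝ ℝ := ⟨fun x => if x ∈ N then K0 x else Measure.dirac x,
    Measurable.ite hNm K0_meas Measure.measurable_dirac⟩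
  have hKx : ∀ x ∈ N, K x = K0 x := fun x hx => by
    show (if x ∈ N then K0 x else Measure.dirac x) = K0 x
    rw [if_pos hx]
  have hKm : IsMarkovKernel K := ⟨fun x => by
    by_cases hx : x ∈ N
    · rw [hKx x hx]; exact ⟨hx⟩
    · have : K x = Measure.dirac x := if_neg hx
      rw [this]; infer_instance⟩
  refine ⟨K, hKm, ?_, ?_⟩
  · ext s hs
    rw [Measure.bind_apply hs K.measurable.aemeasurable]
    have e1 : ∫⁻ x, K x s ∂P = ∫⁻ x, K0 x s ∂P := by
      apply lintegral_congr_ae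
      filter_upwards [hK1] with x hx
      rw [hKx x hx]
    have hK0s : Measurable (fun x => K0 x s) := (Measure.measurable_coe hs).comp K0_meas
    rw [e1, hP, lintegral_withDensity_eq_lintegral_mul _ ha hK0s, lintegral_cells hc]
    have cellk : ∀ k, ∫⁻ x in c ⁻¹' {k}, (a' * fun x => K0 x s) x ∂lam = ∑' l, q k l * Qc l s := by
      intro k
      have h1 : ∫⁻ x in c ⁻¹' {k}, (a' * fun x => K0 x s) x ∂lam =
          ∫⁻ x in c ⁻¹' {k}, (s.indicator g x + rs x * S k s + a' x * ∑' l, w k l * Qc l s) ∂lam := by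
        apply setLIntegral_congr_fun (meas_cell hc k)
        intro x hx
        have hx' : c x = k := hx
        simp only [Pi.mul_apply]
        rw [K0_app x s hs, hx', mul_add, mul_add]
        have hA0 : a' x = 0 → A x = 0 := fun h => by simp [hAdef, h]
        have g1 : g x / a' x * a' x = g x :=
          ennreal_div_mul_cancel (fun h => le_antisymm ((min_le_left _ _).trans_eq (hA0 h)) bot_le) (hat x)
        have g2 : rs x / a' x * a' x = rs x :=
          ennreal_div_mul_cancel (fun h => le_antisymm ((tsub_le_self).trans_eq (hA0 h)) bot_le) (hat x)
        congr 1
        congr 1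
        · rw [← mul_assoc, mul_comm (a' x), g1]
          by_cases hxs : x ∈ s <;> simp [hxs]
        · rw [← mul_assoc, mul_comm (a' x), g2]
      rw [h1, lintegral_add_left (f := fun x => s.indicator g x + rs x * S k s) ((hgm.indicator hs).add (hrsm.mul_const _)),
        lintegral_add_left (hgm.indicator hs), lintegral_mul_const _ hrsm, lintegral_mul_const _ ha,
        setLIntegral_indicator hs, inter_comm s]
      have h2 : ∫⁻ x in c ⁻¹' {k}, a' x ∂lam = m k := by
        simp only [hm]; rw [hP, withDensity_apply _ (meas_cell hc k)]
      rw [h2, show (∫⁻ x in c ⁻¹' {k}, rs x ∂lam) * S k s = e k * S k s from rfl, eS k s hs,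
        ← lintegral_add_left hgm]
      simp only [hgrt]
      rw [iB k s hs, ← qQ k k s hs, ← ENNReal.tsum_mul_left, ENNReal.tsum_eq_add_tsum_ite (f := fun l => q k l * Qc l s) k]
      congr 1
      congr 1; ext l
      simp only [hw]
      split_ifs with h
      · simp
      · rw [← mul_assoc, mul_comm (m k), ennreal_div_mul_cancel (hqm0 k l) (hmt k)]
    simp only [cellk]
    rw [ENNReal.tsum_comm, measure_cells hc Q hs]
    congr 1; ext l
    rw [ENNReal.tsum_mul_right, hcol, Q_app l s hs, ← mul_assoc]
    by_cases h0 : n l = 0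
    · have : Q (c ⁻¹' {l} ∩ s) = 0 := measure_mono_null inter_subset_left h0
      rw [this]; simp
    · rw [ENNReal.mul_inv_cancel h0 (hnt l), one_mul]
  · filter_upwards [hK1] with x hx
    rw [hKx x hx]
    have Q0 : ∀ l s, MeasurableSet s → Disjoint (c ⁻¹' {l}) s → Qc l s = 0 := by
      intro l s hs h
      rw [Q_app l s hs, h.inter_eq]; simp
    have S1 : ∀ k s, S k s ≤ 1 := by
      intro k s
      refine (measure_mono (subset_univ s)).trans ?_
      rw [S_app _ _ MeasurableSet.univ, inter_univ, ← he2]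
      exact ENNReal.inv_mul_le_one _
    have Q1 : ∀ k s, Qc k s ≤ 1 := by
      intro k s
      refine (measure_mono (subset_univ s)).trans ?_
      rw [Q_app _ _ MeasurableSet.univ, inter_univ]
      exact ENNReal.inv_mul_le_one _
    constructor
    · have hms : MeasurableSet (c ⁻¹' {c x} \ {x}) := (meas_cell hc _).diff (measurableSet_singleton x)
      rw [K0_app x _ hms]
      have t1 : ∑' l, w (c x) l * Qc l (c ⁻¹' {c x} \ {x}) = 0 := by
        rw [ENNReal.tsum_eq_zero]
        intro l
        by_cases h : l = c x
        · simp [hw, h]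
        · rw [Q0 l _ hms, mul_zero]
          rw [Set.disjoint_left]
          rintro y hy ⟨hy2, -⟩
          exact h (hy.symm.trans hy2)
      rw [t1]
      have t2 : (c ⁻¹' {c x} \ {x}).indicator (1 : ℝ → ℝ≥0∞) x = 0 := by
        rw [indicator_of_notMem]; simp
      rw [t2, mul_zero, zero_add, add_zero]
      calc _ ≤ rs x / a' x * 1 := by gcongr; exact S1 _ _
        _ = _ := by rw [mul_one]
    · intro l hl
      have hms := meas_cell hc l
      rw [K0_app x _ hms]
      have t0 : S (c x) (c ⁻¹' {l}) = 0 := by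
        rw [S_app _ _ hms]
        have : c ⁻¹' {c x} ∩ c ⁻¹' {l} = ∅ := by
          ext y; simp; intro h; rw [h]; exact Ne.symm hl
        rw [this]; simp
      have t2 : (c ⁻¹' {l}).indicator (1 : ℝ → ℝ≥0∞) x = 0 := by
        rw [indicator_of_notMem]; simpa using Ne.symm hl
      rw [t0, t2, mul_zero, mul_zero, zero_add, zero_add, tsum_eq_single l]
      · simp only [hw, if_neg hl]
        calc _ ≤ q (c x) l / m (c x) * 1 := by gcongr; exact Q1 _ _
          _ = _ := by rw [mul_one]
      · intro l' hl'
        rw [Q0 l' _ hms, mul_zero]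
        rw [Set.disjoint_left]
        rintro y hy hy2
        exact hl' (hy.symm.trans hy2)
end KER

end WT

open MeasureTheory ProbabilityTheory Real Set Filter Topology
open scoped ENNReal NNReal
set_option linter.unusedVariables false
set_option linter.unusedSectionVars false

namespace WT
variable {θ : ℝ → ℝ} {t₀ : ℝ}

theorem weakCost_le (H : GoodCost θ t₀) {a : ℝ} (ha : 0 < a) (P Q : Measure ℝ) [IsProbabilityMeasure P]
    [IsProbabilityMeasure Q] (K : Kernel ℝ ℝ) [IsMarkovKernel K] (hb : P.bind K = Q) {T : ℝ → ℝ}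
    (hT : Measurable T) (hTP : Integrable T P) (hTQ : Integrable T Q) :
    weakCost (fun t => θ (a * t)) (Q.map T) (P.map T) ≤
      ∫⁻ s, ENNReal.ofReal (cext θ (a * ∫ y, |T y - T s| ∂(K s))) ∂P := by
  set C : Kernel ℝ ℝ := condDistrib id T P with hC
  have hC1 : (P.map T) ⊗ₘ C = P.map (fun s => (T s, s)) := compProd_map_condDistrib aemeasurable_id
  have hmp : Measurable (fun s => (T s, s)) := hT.prodMk measurable_id
  have : IsProbabilityMeasure (P.map T) := Measure.isProbabilityMeasure_map hT.aemeasurable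
  have hC2 : (P.map T).bind C = P := by
    have := Measure.snd_compProd (P.map T) C
    rw [← this, hC1, Measure.snd, Measure.map_map measurable_snd hmp]
    exact Measure.map_id
  have hC3 : ∀ᵐ z ∂(P.map T), ∀ᵐ s ∂(C z), T s = z := by
    have : ∀ᵐ x ∂((P.map T) ⊗ₘ C), T x.2 = x.1 := by
      rw [hC1, ae_map_iff hmp.aemeasurable]
      · exact Eventually.of_forall fun x => rfl
      · exact measurableSet_eq_fun (hT.comp measurable_snd) measurable_fst
    exact Measure.ae_ae_of_ae_compProd this
  have : IsMarkovKernel (K.map T) := Kernel.IsMarkovKernel.map K hT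
  set p : Kernel ℝ ℝ := (K.map T) ∘ₖ C with hp
  have hpb : (P.map T).bind (fun x => p x) = Q.map T := by
    show (P.map T).bind p = _
    rw [hp, ← Measure.comp_assoc, hC2, ← Measure.map_comp _ _ hT, hb]
  set D : ℝ → ℝ := fun s => ∫ y, |T y - T s| ∂(K s) with hD
  have hDm : Measurable D := by
    have : StronglyMeasurable (fun x : ℝ × ℝ => |T x.2 - T x.1|) := by
      apply Measurable.stronglyMeasurable; fun_prop
    exact (this.integral_kernel_prod_right' (κ := K)).measurable
  have hKi : ∀ᵐ s ∂P, Integrable T (K s) := by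
    rw [← hb] at hTQ; exact Measure.ae_integrable_of_integrable_comp hTQ
  have hDi : Integrable D P := by
    rw [← hb] at hTQ
    have h1 := Measure.integrable_integral_norm_of_integrable_comp hTQ
    refine (h1.add hTP.norm).mono hDm.aestronglyMeasurable ?_
    filter_upwards [hKi] with s hs
    rw [Real.norm_of_nonneg (integral_nonneg fun _ => abs_nonneg _)]
    refine le_trans ?_ (le_abs_self _)
    calc D s ≤ ∫ y, (‖T y‖ + ‖T s‖) ∂(K s) := by
          apply integral_mono (hs.sub (integrable_const _)).abs (hs.norm.add (integrable_const _))
          intro y; exact norm_sub_le (T y) (T s)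
      _ = _ := by rw [integral_add hs.norm (integrable_const _)]; simp
  have hDC : ∀ᵐ z ∂(P.map T), Integrable D (C z) := by
    rw [← hC2] at hDi; exact Measure.ae_integrable_of_integrable_comp hDi
  have hKC : ∀ᵐ z ∂(P.map T), ∀ᵐ s ∂(C z), Integrable T (K s) := by
    rw [← hC2] at hKi; exact Measure.ae_ae_of_ae_comp hKi
  have hpI : ∀ᵐ z ∂(P.map T), Integrable (fun y => y) (p z) := by
    have : Integrable (fun y => y) (Q.map T) := by
      rw [integrable_map_measure (by fun_prop) hT.aemeasurable]; exact hTQ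
    rw [← hpb] at this; exact Measure.ae_integrable_of_integrable_comp this
  have hce := H.ext_cont.measurable
  calc weakCost (fun t => θ (a * t)) (Q.map T) (P.map T)
      ≤ ∫⁻ z, ENNReal.ofReal (θ (a * |z - ∫ y, y ∂(p z)|)) ∂(P.map T) :=
        iInf_le_of_le p (iInf_le_of_le inferInstance (iInf_le _ hpb))
    _ ≤ ∫⁻ z, ∫⁻ s, ENNReal.ofReal (cext θ (a * D s)) ∂(C z) ∂(P.map T) := by
        apply lintegral_mono_ae
        filter_upwards [hC3, hDC, hKC, hpI] with z h1 h2 h3 h4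
        refine le_trans ?_ (H.jensen (C z) (h2.const_mul a))
        apply ENNReal.ofReal_le_ofReal
        rw [← cext_of_nonneg (θ := θ) (by positivity)]
        apply H.ext_mono
        rw [integral_const_mul]
        apply mul_le_mul_of_nonneg_left _ ha.le
        have hI := Integrable.integral_comp h4
        have e1 : ∫ y, y ∂(p z) = ∫ s, (∫ y, y ∂(K.map T s)) ∂(C z) := Kernel.integral_comp h4
        have e2 : z - ∫ y, y ∂(p z) = ∫ s, (z - ∫ y, y ∂(K.map T s)) ∂(C z) := by
          rw [integral_sub (integrable_const _) hI, e1]; simp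
        rw [e2]
        refine (abs_integral_le_integral_abs).trans ?_
        refine integral_mono_ae ((integrable_const _).sub hI).abs h2 ?_
        filter_upwards [h1, h3] with s hs1 hs2
        rw [Kernel.map_apply _ hT, integral_map hT.aemeasurable (by fun_prop), ← hs1]
        have : T s - ∫ y, T y ∂(K s) = ∫ y, (T s - T y) ∂(K s) := by
          rw [integral_sub (integrable_const _) hs2]; simp
        rw [this]
        refine (abs_integral_le_integral_abs).trans_eq ?_
        simp only [hD, abs_sub_comm]
    _ = _ := by
        conv_rhs => rw [← hC2]
        exact (Measure.lintegral_bind C.aemeasurable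
          (hce.comp (hDm.const_mul a)).ennreal_ofReal.aemeasurable).symm

end WT

open MeasureTheory ProbabilityTheory Real Set Filter Topology
open scoped ENNReal NNReal
set_option linter.unusedVariables false
set_option linter.unusedSectionVars false

namespace WT

lemma expCDF_strictMono : StrictMono expCDF := by
  intro x y h
  unfold expCDF
  split_ifs with h1 h2 h2
  · have := Real.exp_lt_exp.2 h; linarith
  · have a1 : Real.exp x < 1 := by rw [Real.exp_lt_one_iff]; exact h1
    have a2 : Real.exp (-y) ≤ 1 := by rw [Real.exp_le_one_iff]; linarith
    linarith
  · exact absurd (h.trans h2) h1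
  · have := Real.exp_lt_exp.2 (neg_lt_neg h); linarith

/-- inverse of `expCDF` -/
noncomputable def xi (s : ℝ) : ℝ := if s < 1 / 2 then Real.log (2 * s) else - Real.log (2 * (1 - s))

lemma expCDF_xi {s : ℝ} (hs : s ∈ Ioo (0:ℝ) 1) : expCDF (xi s) = s := by
  obtain ⟨h0, h1⟩ := hs
  unfold xi
  split_ifs with h
  · have : Real.log (2 * s) < 0 := Real.log_neg (by linarith) (by linarith)
    rw [expCDF, if_pos this, Real.exp_log (by linarith)]; ring
  · have : ¬ (- Real.log (2 * (1 - s)) < 0) := by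
      have := Real.log_nonpos (x := 2 * (1 - s)) (by linarith) (by linarith)
      linarith
    rw [expCDF, if_neg this, neg_neg, Real.exp_log (by linarith)]; ring

lemma measurable_xi : Measurable xi := by
  unfold xi
  exact Measurable.ite measurableSet_Iio (by fun_prop) (by fun_prop)

/-- cell index -/
noncomputable def cc (s : ℝ) : ℤ := ⌊xi s / Real.log 2⌋

lemma measurable_cc : Measurable cc := Int.measurable_floor.comp (measurable_xi.div_const _)

noncomputable def tt (k : ℤ) : ℝ := expCDF (k * Real.log 2)

noncomputable def ww (k : ℤ) : ℝ := (1 / 2 : ℝ) ^ (k.natAbs + 1)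

lemma ww_pos (k : ℤ) : 0 < ww k := by unfold ww; positivity

lemma log2_pos : 0 < Real.log 2 := Real.log_pos (by norm_num)

lemma tt_mem (k : ℤ) : tt k ∈ Ioo (0:ℝ) 1 := expCDF_mem _

lemma tt_strictMono : StrictMono tt := by
  intro i j h
  apply expCDF_strictMono
  have := log2_pos
  have : (i:ℝ) < j := by exact_mod_cast h
  nlinarith

lemma tt_le_iff {s : ℝ} (hs : s ∈ Ioo (0:ℝ) 1) (k : ℤ) : tt k ≤ s ↔ k ≤ cc s := by
  conv_lhs => rw [← expCDF_xi hs]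
  rw [tt, expCDF_strictMono.le_iff_le, cc, Int.le_floor, le_div_iff₀ log2_pos]

lemma tt_nat (j : ℕ) : tt (j : ℤ) = 1 - (1 / 2 : ℝ) ^ (j + 1) := by
  have h : ¬ ((((j:ℤ):ℝ)) * Real.log 2 < 0) := by
    have := log2_pos
    push_cast; have : (0:ℝ) ≤ j := by positivity
    nlinarith
  rw [tt, expCDF, if_neg h]
  have : -((((j:ℤ):ℝ)) * Real.log 2) = (j:ℝ) * (- Real.log 2) := by push_cast; ring
  rw [this, Real.exp_nat_mul, Real.exp_neg, Real.exp_log (by norm_num)]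
  rw [pow_succ]; norm_num; ring

lemma tt_neg (j : ℕ) : tt (-(j : ℤ)) = (1 / 2 : ℝ) ^ (j + 1) := by
  rcases Nat.eq_zero_or_pos j with rfl | hj
  · have := tt_nat 0; norm_num at this ⊢; exact this
  have h : (((-(j:ℤ) : ℤ):ℝ)) * Real.log 2 < 0 := by
    have := log2_pos
    push_cast; have : (0:ℝ) < j := by positivity
    nlinarith
  rw [tt, expCDF, if_pos h]
  have : (((-(j:ℤ) : ℤ):ℝ)) * Real.log 2 = (j:ℝ) * (- Real.log 2) := by push_cast; ring
  rw [this, Real.exp_nat_mul, Real.exp_neg, Real.exp_log (by norm_num)]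
  rw [pow_succ]; norm_num; ring

lemma ww_nat (j : ℕ) : ww (j : ℤ) = (1 / 2 : ℝ) ^ (j + 1) := by simp [ww]
lemma ww_neg (j : ℕ) : ww (-(j : ℤ)) = (1 / 2 : ℝ) ^ (j + 1) := by simp [ww]

/-- cell mass -/
noncomputable def mm (k : ℤ) : ℝ := tt (k + 1) - tt k

lemma mm_pos (k : ℤ) : 0 < mm k := sub_pos.2 (tt_strictMono (by omega))

lemma mm_bounds (k : ℤ) : mm k ≤ ww k ∧ ww k ≤ 2 * mm k ∧ mm k ≤ ww (k + 1) ∧ ww (k + 1) ≤ 2 * mm k := by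
  rcases le_or_gt 0 k with h | h
  · obtain ⟨j, rfl⟩ := Int.eq_ofNat_of_zero_le h
    have e : ((j:ℤ) + 1) = ((j + 1 : ℕ) : ℤ) := by push_cast; rfl
    have hm : mm (j:ℤ) = (1 / 2 : ℝ) ^ (j + 2) := by
      rw [mm, e, tt_nat, tt_nat]; ring
    rw [hm, e, ww_nat, ww_nat]
    have : (0:ℝ) < (1 / 2 : ℝ) ^ (j + 1) := by positivity
    have e2 : (1 / 2 : ℝ) ^ (j + 2) = (1 / 2 : ℝ) ^ (j + 1) / 2 := by ring
    have e3 : (1 / 2 : ℝ) ^ (j + 1 + 1) = (1 / 2 : ℝ) ^ (j + 1) / 2 := by ring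
    rw [e2]; refine ⟨?_, ?_, ?_, ?_⟩ <;> linarith
  · obtain ⟨j, hj⟩ := Int.eq_ofNat_of_zero_le (show 0 ≤ -k - 1 by omega)
    have e : k = -((j + 1 : ℕ) : ℤ) := by push_cast; omega
    have e' : k + 1 = -((j : ℕ) : ℤ) := by omega
    rw [mm, e', e, tt_neg, tt_neg, ww_neg, ww_neg]
    have : (0:ℝ) < (1 / 2 : ℝ) ^ (j + 1) := by positivity
    have e2 : (1 / 2 : ℝ) ^ (j + 1 + 1) = (1 / 2 : ℝ) ^ (j + 1) / 2 := by ring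
    rw [e2]; refine ⟨?_, ?_, ?_, ?_⟩ <;> linarith

lemma lam_Ico_le (a b : ℝ) : lam (Ico a b) ≤ ENNReal.ofReal (b - a) := by
  rw [lam_apply measurableSet_Ico, ← Real.volume_Ico]
  exact measure_mono inter_subset_left

lemma lam_Ico {a b : ℝ} (ha : 0 ≤ a) (hb : b ≤ 1) : lam (Ico a b) = ENNReal.ofReal (b - a) := by
  refine le_antisymm (lam_Ico_le a b) ?_
  rw [lam_apply measurableSet_Ico, ← Real.volume_Ioo]
  apply measure_mono
  rintro x ⟨h1, h2⟩
  exact ⟨⟨h1.le, h2⟩, by linarith, by linarith⟩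

lemma mem_cell {s : ℝ} (hs : s ∈ Ioo (0:ℝ) 1) (k : ℤ) : cc s = k ↔ s ∈ Ico (tt k) (tt (k + 1)) := by
  rw [mem_Ico, tt_le_iff hs, ← not_le, tt_le_iff hs]; omega

lemma lam_cell (k : ℤ) : lam (cc ⁻¹' {k}) = ENNReal.ofReal (mm k) := by
  rw [mm, ← lam_Ico (tt_mem k).1.le (tt_mem (k+1)).2.le]
  apply measure_congr
  filter_upwards [ae_lam] with s hs
  exact propext (mem_cell hs k)

lemma tt_tendsto_top : Tendsto tt atTop (𝓝 1) := by
  have h : Tendsto (fun j : ℕ => 1 - (1 / 2 : ℝ) ^ (j + 1)) atTop (𝓝 (1 - 0)) :=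
    tendsto_const_nhds.sub ((tendsto_pow_atTop_nhds_zero_of_lt_one (by norm_num) (by norm_num)).comp (tendsto_add_atTop_nat 1))
  rw [sub_zero] at h
  refine tendsto_of_tendsto_of_tendsto_of_le_of_le' (g := fun k : ℤ => 1 - (1 / 2 : ℝ) ^ (k.toNat + 1))
    (h := fun _ => 1) ?_ tendsto_const_nhds ?_ (Eventually.of_forall fun k => (tt_mem k).2.le)
  · refine h.comp ?_
    rw [tendsto_atTop]
    intro n
    filter_upwards [eventually_ge_atTop (n:ℤ)] with k hk
    omega
  · filter_upwards [eventually_ge_atTop 0] with k hk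
    rw [← tt_nat, Int.toNat_of_nonneg hk]

lemma tt_tendsto_bot : Tendsto tt atBot (𝓝 0) := by
  have h : Tendsto (fun j : ℕ => (1 / 2 : ℝ) ^ (j + 1)) atTop (𝓝 0) :=
    (tendsto_pow_atTop_nhds_zero_of_lt_one (by norm_num) (by norm_num)).comp (tendsto_add_atTop_nat 1)
  refine tendsto_of_tendsto_of_tendsto_of_le_of_le' (g := fun _ => 0)
    (h := fun k : ℤ => (1 / 2 : ℝ) ^ ((-k).toNat + 1)) tendsto_const_nhds ?_ (Eventually.of_forall fun k => (tt_mem k).1.le) ?_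
  · refine h.comp ?_
    rw [tendsto_atTop]
    intro n
    filter_upwards [eventually_le_atBot (-(n:ℤ))] with k hk
    omega
  · filter_upwards [eventually_le_atBot 0] with k hk
    rw [← tt_neg, Int.toNat_of_nonneg (by omega), neg_neg]

/-- partition by a monotone sequence -/
lemma partition_sum {S : ℤ → ℝ} (hS : Monotone S) (h0 : Tendsto S atBot (𝓝 0)) (h1 : Tendsto S atTop (𝓝 1))
    {A : Set ℝ} (hA : MeasurableSet A) : ∑' l, lam (A ∩ Ico (S l) (S (l + 1))) = lam A := by
  rw [← measure_iUnion]
  · apply measure_congr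
    filter_upwards [ae_lam] with s hs
    apply propext
    constructor
    · intro h
      obtain ⟨l, hl⟩ := mem_iUnion.1 h
      exact hl.1
    · intro h
      obtain ⟨l, hl⟩ := (h0.eventually_lt_const hs.1).exists
      obtain ⟨u, hu⟩ := (h1.eventually_const_lt hs.2).exists
      have : ∃ lb : ℤ, S lb ≤ s ∧ ∀ z, S z ≤ s → z ≤ lb := by
        apply Int.exists_greatest_of_bdd
        · exact ⟨u, fun z hz => by
            by_contra hc
            exact absurd (hS (not_le.1 hc).le) (by linarith)⟩
        · exact ⟨l, hl.le⟩
      obtain ⟨b, hb1, hb2⟩ := this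
      refine mem_iUnion.2 ⟨b, h, hb1, ?_⟩
      by_contra hc
      have := hb2 (b + 1) (not_lt.1 hc)
      omega
  · intro i j hij
    rw [Function.onFun, Set.disjoint_left]
    rintro x ⟨-, h1, h2⟩ ⟨-, h3, h4⟩
    rcases lt_or_gt_of_ne hij with h | h
    · have := hS (show i + 1 ≤ j by omega); linarith
    · have := hS (show j + 1 ≤ i by omega); linarith
  · intro l; exact hA.inter measurableSet_Ico

end WT

open MeasureTheory ProbabilityTheory Real Set Filter Topology
open scoped ENNReal NNReal
set_option linter.unusedVariables false
set_option linter.unusedSectionVars false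

namespace WT

/-- quantile coupling of cells -/
noncomputable def qq (N : ℤ → ℝ) (k l : ℤ) : ℝ≥0∞ :=
  lam (Ico (tt k) (tt (k + 1)) ∩ Ico (N l) (N (l + 1)))

/-- near functional -/
noncomputable def ga (N : ℤ → ℝ) (i : ℤ) : ℝ := min ((N i - tt i) ^ 2 / ww i) |N i - tt i|

noncomputable def GA (N : ℤ → ℝ) : ℝ≥0∞ := ∑' i, ENNReal.ofReal (ga N i)

noncomputable def FF (N : ℤ → ℝ) : ℝ≥0∞ :=
  ∑' i, (ENNReal.ofReal (tt (i - 1) - N i) + ENNReal.ofReal (N i - tt (i + 1)))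

lemma ga_nonneg (N : ℤ → ℝ) (i : ℤ) : 0 ≤ ga N i := by
  have := ww_pos i
  unfold ga; positivity

section
variable {N : ℤ → ℝ} (hN : Monotone N) (h0 : Tendsto N atBot (𝓝 0)) (h1 : Tendsto N atTop (𝓝 1))

include hN h0 h1

lemma N_nonneg (i : ℤ) : 0 ≤ N i := hN.le_of_tendsto h0 i
lemma N_le_one (i : ℤ) : N i ≤ 1 := hN.ge_of_tendsto h1 i

lemma qq_row (k : ℤ) : ∑' l, qq N k l = ENNReal.ofReal (mm k) := by
  unfold qq
  rw [partition_sum hN h0 h1 measurableSet_Ico, lam_Ico (tt_mem k).1.le (tt_mem (k+1)).2.le]; rfl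

lemma qq_col (l : ℤ) : ∑' k, qq N k l = ENNReal.ofReal (N (l + 1) - N l) := by
  unfold qq
  simp_rw [fun k => inter_comm (Ico (tt k) (tt (k+1))) (Ico (N l) (N (l + 1)))]
  rw [partition_sum tt_strictMono.monotone tt_tendsto_bot tt_tendsto_top measurableSet_Ico,
    lam_Ico (N_nonneg hN h0 h1 l) (N_le_one hN h0 h1 _)]

lemma two_partition {B : Set ℝ} (hB : MeasurableSet B) :
    ∑' k, ∑' l, lam (B ∩ Ico (tt k) (tt (k + 1)) ∩ Ico (N l) (N (l + 1))) = lam B := by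
  simp_rw [fun k => partition_sum hN h0 h1 (hB.inter (measurableSet_Ico (a := tt k) (b := tt (k+1))))]
  exact partition_sum tt_strictMono.monotone tt_tendsto_bot tt_tendsto_top hB

lemma far_bound : ∑' k, ∑' l, qq N k l * (((k - l).natAbs - 1 : ℕ) : ℝ≥0∞) ≤ FF N := by
  have key : ∀ k l, qq N k l * (((k - l).natAbs - 1 : ℕ) : ℝ≥0∞) ≤
      ∑' i, (lam (Ico (N i) (tt (i - 1)) ∩ Ico (tt k) (tt (k + 1)) ∩ Ico (N l) (N (l + 1))) +
        lam (Ico (tt (i + 1)) (N i) ∩ Ico (tt k) (tt (k + 1)) ∩ Ico (N l) (N (l + 1)))) := by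
    intro k l
    rcases le_total k l with hkl | hkl
    · have hc : (((k - l).natAbs - 1 : ℕ)) = (Finset.Icc (k + 2) l).card := by
        rw [Int.card_Icc]; omega
      rw [hc, mul_comm, ← nsmul_eq_mul, ← Finset.sum_const]
      refine le_trans ?_ (ENNReal.sum_le_tsum (Finset.Icc (k + 2) l))
      apply Finset.sum_le_sum
      intro i hi
      rw [Finset.mem_Icc] at hi
      refine le_trans ?_ le_self_add
      apply measure_mono
      rintro s ⟨hs1, hs2⟩
      refine ⟨⟨⟨?_, ?_⟩, hs1⟩, hs2⟩
      · exact (hN hi.2).trans hs2.1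
      · exact hs1.2.trans_le (tt_strictMono.monotone (by omega))
    · have hc : (((k - l).natAbs - 1 : ℕ)) = (Finset.Icc (l + 1) (k - 1)).card := by
        rw [Int.card_Icc]; omega
      rw [hc, mul_comm, ← nsmul_eq_mul, ← Finset.sum_const]
      refine le_trans ?_ (ENNReal.sum_le_tsum (Finset.Icc (l + 1) (k - 1)))
      apply Finset.sum_le_sum
      intro i hi
      rw [Finset.mem_Icc] at hi
      refine le_trans ?_ le_add_self
      apply measure_mono
      rintro s ⟨hs1, hs2⟩
      refine ⟨⟨⟨?_, ?_⟩, hs1⟩, hs2⟩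
      · exact (tt_strictMono.monotone (by omega)).trans hs1.1
      · exact hs2.2.trans_le (hN hi.1)
  refine (ENNReal.tsum_le_tsum fun k => ENNReal.tsum_le_tsum fun l => key k l).trans ?_
  simp_rw [fun k => ENNReal.tsum_comm (f := fun l i => lam (Ico (N i) (tt (i - 1)) ∩ Ico (tt k) (tt (k + 1)) ∩ Ico (N l) (N (l + 1))) +
        lam (Ico (tt (i + 1)) (N i) ∩ Ico (tt k) (tt (k + 1)) ∩ Ico (N l) (N (l + 1))))]
  rw [ENNReal.tsum_comm]
  refine ENNReal.tsum_le_tsum fun i => ?_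
  simp_rw [ENNReal.tsum_add]
  rw [two_partition hN h0 h1 measurableSet_Ico, two_partition hN h0 h1 measurableSet_Ico]
  exact add_le_add (lam_Ico_le _ _) (lam_Ico_le _ _)

lemma qq_le_row (k l : ℤ) : qq N k l ≤ ENNReal.ofReal (mm k) :=
  (ENNReal.le_tsum l).trans_eq (qq_row hN h0 h1 k)
lemma qq_le_col (k l : ℤ) : qq N k l ≤ ENNReal.ofReal (N (l + 1) - N l) :=
  (ENNReal.le_tsum (f := fun k => qq N k l) k).trans_eq (qq_col hN h0 h1 l)

omit hN h0 h1 in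
lemma qq_up (k : ℤ) : qq N k (k + 1) ≤ ENNReal.ofReal (tt (k + 1) - N (k + 1)) :=
  (measure_mono (t := Ico (N (k + 1)) (tt (k + 1))) fun s hs => ⟨hs.2.1, hs.1.2⟩).trans (lam_Ico_le _ _)

omit hN h0 h1 in
lemma qq_down (k : ℤ) : qq N (k + 1) k ≤ ENNReal.ofReal (N (k + 1) - tt (k + 1)) :=
  (measure_mono (t := Ico (tt (k + 1)) (N (k + 1))) fun s hs => ⟨hs.1.1, hs.2.2⟩).trans (lam_Ico_le _ _)

omit hN h0 h1 in
lemma sq_div_le {x : ℝ≥0∞} {d n B : ℝ} (hx : x ≤ ENNReal.ofReal d) (hn : x ≤ ENNReal.ofReal n)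
    (hB : ∀ y : ℝ, 0 ≤ y → y ≤ |d| → y ≤ n → 0 < n → y ^ 2 / n ≤ B) : x ^ 2 / ENNReal.ofReal n ≤ ENNReal.ofReal B := by
  rcases le_or_gt n 0 with h | h
  · rw [ENNReal.ofReal_of_nonpos h] at hn
    have : x = 0 := le_antisymm hn bot_le
    simp [this]
  · have hx0 : x ≠ ⊤ := ne_top_of_le_ne_top ENNReal.ofReal_ne_top hn
    have e : x = ENNReal.ofReal x.toReal := (ENNReal.ofReal_toReal hx0).symm
    rw [e, ← ENNReal.ofReal_pow ENNReal.toReal_nonneg, ← ENNReal.ofReal_div_of_pos h]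
    apply ENNReal.ofReal_le_ofReal
    apply hB _ ENNReal.toReal_nonneg _ _ h
    · rw [e] at hx
      have := (ENNReal.ofReal_le_ofReal_iff (abs_nonneg d)).1 (hx.trans (ENNReal.ofReal_le_ofReal (le_abs_self d)))
      exact this
    · rw [e] at hn
      exact (ENNReal.ofReal_le_ofReal_iff h.le).1 hn

omit hN h0 h1 in
lemma fwd_real {d m w y : ℝ} (hw : w ≤ 2 * m) (hw0 : 0 < w) (hy : 0 ≤ y) (h1 : y ≤ |d|) (h2 : y ≤ m) (hm : 0 < m) :
    y ^ 2 / m ≤ 2 * min (d ^ 2 / w) |d| := by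
  have hd : y ^ 2 ≤ d ^ 2 := by rw [← sq_abs d]; gcongr
  rw [mul_min_of_nonneg _ _ (by norm_num)]
  apply le_min
  · rw [div_le_iff₀ hm]
    have : 2 * (d ^ 2 / w) * m = d ^ 2 * ((2 * m) / w) := by field_simp
    rw [this]
    have : 1 ≤ 2 * m / w := by rw [le_div_iff₀ hw0]; linarith
    nlinarith [sq_nonneg d]
  · rw [div_le_iff₀ hm]; nlinarith

/-- forward near bound -/
lemma near_fwd : ∑' k, (qq N k (k + 1) ^ 2 / ENNReal.ofReal (mm k) + qq N k (k - 1) ^ 2 / ENNReal.ofReal (mm k))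
    ≤ 32 * GA N := by
  have b1 : ∀ k, qq N k (k + 1) ^ 2 / ENNReal.ofReal (mm k) ≤ ENNReal.ofReal (2 * ga N (k + 1)) := by
    intro k
    apply sq_div_le (qq_up k) (qq_le_row hN h0 h1 _ _)
    intro y hy y1 y2 hm
    rw [abs_sub_comm] at y1
    exact fwd_real (mm_bounds k).2.2.2 (ww_pos _) hy y1 y2 hm
  have b2 : ∀ k, qq N k (k - 1) ^ 2 / ENNReal.ofReal (mm k) ≤ ENNReal.ofReal (2 * ga N k) := by
    intro k
    have := qq_down (N := N) (k - 1)
    rw [sub_add_cancel] at this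
    apply sq_div_le this (qq_le_row hN h0 h1 _ _)
    intro y hy y1 y2 hm
    exact fwd_real (mm_bounds k).2.1 (ww_pos _) hy y1 y2 hm
  refine (ENNReal.tsum_le_tsum fun k => add_le_add (b1 k) (b2 k)).trans ?_
  rw [ENNReal.tsum_add]
  simp_rw [ENNReal.ofReal_mul (show (0:ℝ) ≤ 2 by norm_num), ENNReal.tsum_mul_left]
  have : ∑' i : ℤ, ENNReal.ofReal (ga N (i + 1)) = GA N :=
    (Equiv.addRight (1:ℤ)).tsum_eq (fun i => ENNReal.ofReal (ga N i))
  rw [this]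
  show _ + _ * GA N ≤ _
  rw [← add_mul]
  gcongr
  rw [← ENNReal.ofReal_add (by norm_num) (by norm_num)]
  norm_num

omit hN h0 h1 in
lemma rev_real {d d' m w w' n y : ℝ} (hw : w ≤ 2 * m) (hw' : w' ≤ 2 * m) (hw0 : 0 < w) (hw0' : 0 < w') (hm : 0 < m)
    (hy : 0 ≤ y) (h1 : y ≤ |d|) (h2 : y ≤ n) (hn : 0 < n) (hd : m ≤ n + |d| + |d'|) :
    y ^ 2 / n ≤ 8 * (min (d ^ 2 / w) |d| + min (d' ^ 2 / w') |d'|) := by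
  have g0 : 0 ≤ min (d ^ 2 / w) |d| := by positivity
  have g0' : 0 ≤ min (d' ^ 2 / w') |d'| := by positivity
  have hdd : y ^ 2 ≤ d ^ 2 := by rw [← sq_abs d]; gcongr
  rcases le_or_gt (m / 4) n with h | h
  · refine le_trans ?_ (show 8 * min (d ^ 2 / w) |d| ≤ _ by linarith)
    rw [mul_min_of_nonneg _ _ (by norm_num)]
    apply le_min
    · rw [div_le_iff₀ hn]
      have : 8 * (d ^ 2 / w) * n = d ^ 2 * ((8 * n) / w) := by field_simp
      rw [this]
      have : 1 ≤ 8 * n / w := by rw [le_div_iff₀ hw0]; linarith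
      nlinarith [sq_nonneg d]
    · rw [div_le_iff₀ hn]; nlinarith
  · have hyn : y ^ 2 / n ≤ m / 4 := by
      rw [div_le_iff₀ hn]; nlinarith
    have key : ∀ e v : ℝ, 3 / 8 * m ≤ |e| → 0 < v → v ≤ 2 * m → m / 32 ≤ min (e ^ 2 / v) |e| := by
      intro e v he hv hv2
      apply le_min
      · rw [le_div_iff₀ hv, ← sq_abs e]; nlinarith
      · linarith
    rcases le_or_gt (3 / 8 * m) |d| with h3 | h3
    · have := key d w h3 hw0 hw; linarith
    · have := key d' w' (by linarith) hw0' hw'; linarith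

lemma near_rev : ∑' l, (qq N (l + 1) l ^ 2 / ENNReal.ofReal (N (l + 1) - N l) + qq N (l - 1) l ^ 2 / ENNReal.ofReal (N (l + 1) - N l))
    ≤ 32 * GA N := by
  have hd : ∀ l, mm l ≤ (N (l + 1) - N l) + |N (l + 1) - tt (l + 1)| + |N l - tt l| := by
    intro l
    unfold mm
    have := neg_le_abs (N (l + 1) - tt (l + 1))
    have := le_abs_self (N l - tt l)
    linarith
  have b1 : ∀ k, qq N (k + 1) k ^ 2 / ENNReal.ofReal (N (k + 1) - N k) ≤ ENNReal.ofReal (8 * (ga N (k + 1) + ga N k)) := by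
    intro k
    apply sq_div_le (qq_down k) (qq_le_col hN h0 h1 _ _)
    intro y hy y1 y2 hm
    exact rev_real (mm_bounds k).2.2.2 (mm_bounds k).2.1 (ww_pos _) (ww_pos _) (mm_pos k) hy y1 y2 hm (hd k)
  have b2 : ∀ k, qq N (k - 1) k ^ 2 / ENNReal.ofReal (N (k + 1) - N k) ≤ ENNReal.ofReal (8 * (ga N (k + 1) + ga N k)) := by
    intro k
    have := qq_up (N := N) (k - 1)
    rw [sub_add_cancel] at this
    apply sq_div_le this (qq_le_col hN h0 h1 _ _)
    intro y hy y1 y2 hm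
    rw [abs_sub_comm] at y1
    have := rev_real (mm_bounds k).2.1 (mm_bounds k).2.2.2 (ww_pos _) (ww_pos _) (mm_pos k) hy y1 y2 hm
      (d' := N (k + 1) - tt (k + 1)) (by linarith [hd k])
    unfold ga; linarith
  refine (ENNReal.tsum_le_tsum fun k => add_le_add (b1 k) (b2 k)).trans ?_
  have e : ∀ k, ENNReal.ofReal (8 * (ga N (k + 1) + ga N k)) + ENNReal.ofReal (8 * (ga N (k + 1) + ga N k)) =
      16 * (ENNReal.ofReal (ga N (k + 1)) + ENNReal.ofReal (ga N k)) := by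
    intro k
    rw [← ENNReal.ofReal_add (ga_nonneg _ _) (ga_nonneg _ _), ← two_mul, ENNReal.ofReal_mul (by norm_num), ← mul_assoc]
    congr 1
    norm_num
  simp_rw [e]
  rw [ENNReal.tsum_mul_left, ENNReal.tsum_add]
  have : ∑' i : ℤ, ENNReal.ofReal (ga N (i + 1)) = GA N :=
    (Equiv.addRight (1:ℤ)).tsum_eq (fun i => ENNReal.ofReal (ga N i))
  rw [this]
  show 16 * (GA N + GA N) ≤ _
  rw [← two_mul, ← mul_assoc]
  gcongr
  norm_num

end
end WT

open MeasureTheory ProbabilityTheory Real Set Filter Topology InformationTheory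
open scoped ENNReal NNReal
set_option linter.unusedVariables false
set_option linter.unusedSectionVars false

namespace WT

lemma kl_low {g : ℝ} (h0 : 0 ≤ g) (h1 : g ≤ 1) : (1 - g) ^ 2 ≤ 2 * klFun g := by
  rcases h0.eq_or_lt with h | h
  · rw [← h]; norm_num [klFun]
  have : - Real.log g ≤ Real.sinh (- Real.log g) := Real.self_le_sinh_iff.2 (by
    have := Real.log_nonpos h.le h1; linarith)
  rw [Real.sinh_eq, neg_neg, Real.exp_neg, Real.exp_log h] at this
  have h2 := mul_le_mul_of_nonneg_left this h.le
  have e : g * ((g⁻¹ - g) / 2) = (1 - g ^ 2) / 2 := by field_simp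
  rw [e] at h2
  rw [klFun]; nlinarith

lemma kl_high {g : ℝ} (h1 : 1 ≤ g) : g * (1 - 1 / g) ^ 2 ≤ 2 * klFun g := by
  have hg : 0 < g := by linarith
  set y := 1 - 1 / g with hy
  have hy0 : 0 ≤ y := by rw [hy]; have : 1 / g ≤ 1 := by rw [div_le_one hg]; exact h1
                         linarith
  have hy1 : y < 1 := by rw [hy]; have : 0 < 1 / g := by positivity
                         linarith
  have h := Real.hasSum_pow_div_log_of_abs_lt_one (x := y) (by rw [abs_of_nonneg hy0]; exact hy1)
  have h2 := sum_le_hasSum (Finset.range 2) (fun i _ => by positivity) h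
  have e1 : 1 - y = g⁻¹ := by rw [hy]; field_simp; ring
  rw [e1, Real.log_inv, neg_neg] at h2
  simp [Finset.sum_range_succ] at h2
  norm_num at h2
  have h3 := mul_le_mul_of_nonneg_left h2 hg.le
  have e2 : g * y = g - 1 := by rw [hy]; field_simp
  have e3 : g * y ^ 2 = (g * y) * y := by ring
  rw [klFun]
  have : g * (y + y ^ 2 / 2) = g * y + g * y ^ 2 / 2 := by ring
  rw [this, e2] at h3
  have e4 : g * y ^ 2 = g - 1 - y := by rw [e3, e2, hy]; field_simp
  nlinarith

section
variable {f : ℝ → ℝ} (hf : Measurable f) (hf0 : ∀ x, 0 ≤ f x)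
  {Q : Measure ℝ} (hQ : Q = lam.withDensity (fun x => ENNReal.ofReal (f x))) [IsProbabilityMeasure Q]

include hf hf0 hQ

lemma f_int : Integrable f lam := by
  refine ⟨hf.aestronglyMeasurable, ?_⟩
  rw [hasFiniteIntegral_iff_ofReal (ae_of_all _ hf0)]
  have : Q univ = ∫⁻ x, ENNReal.ofReal (f x) ∂lam := by
    rw [hQ, withDensity_apply _ MeasurableSet.univ, setLIntegral_univ]
  rw [← this, measure_univ]; exact ENNReal.one_lt_top

lemma Q_eq {A : Set ℝ} (hA : MeasurableSet A) : (Q A).toReal = ∫ x in A, f x ∂lam := by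
  rw [integral_eq_lintegral_of_nonneg_ae (ae_of_all _ hf0) hf.aestronglyMeasurable, hQ, withDensity_apply _ hA]

variable (hk : Integrable (fun x => klFun (f x)) lam)
include hk

lemma set_jensen {A : Set ℝ} (hA : MeasurableSet A) (h0 : 0 < (lam A).toReal) :
    eta (Q A).toReal (lam A).toReal ≤ ∫ x in A, klFun (f x) ∂lam := by
  have h0' : lam A ≠ 0 := fun h => by simp [h] at h0
  have := convexOn_klFun.map_set_average_le (μ := lam) (t := A) (f := f) continuous_klFun.continuousOn isClosed_Ici h0'
    (measure_ne_top _ _) (ae_of_all _ hf0) (f_int hf hf0 hQ).integrableOn hk.integrableOn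
  rw [setAverage_eq, setAverage_eq, ← Q_eq hf hf0 hQ hA] at this
  simp only [Measure.real, smul_eq_mul] at this
  rw [eta_eq h0, div_eq_inv_mul]
  calc _ ≤ (lam A).toReal * ((lam A).toReal⁻¹ * ∫ x in A, klFun (f x) ∂lam) := by gcongr
    _ = _ := by rw [← mul_assoc, mul_inv_cancel₀ h0.ne', one_mul]

lemma chain_sets {A : ℕ → Set ℝ} (hA : ∀ j, MeasurableSet (A j)) (hanti : ∀ j, A (j + 1) ⊆ A j)
    (hl : ∀ j, (lam (A j)).toReal = (1 / 2 : ℝ) ^ (j + 1)) (J : ℕ) :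
    ∑ i ∈ Finset.range J, (1 / 2 : ℝ) ^ (i + 2) * GG ((Q (A (i + 1))).toReal / (1 / 2) ^ (i + 2)) ≤
      ∫ x in A 0, klFun (f x) ∂lam + 1 / 2 * AA ((Q (A 0)).toReal / (1 / 2)) := by
  set S : ℕ → ℝ := fun j => (Q (A j)).toReal with hS
  have h0 : ∀ j, 0 ≤ S j := fun j => ENNReal.toReal_nonneg
  have h1 : ∀ j, S (j + 1) ≤ S j := fun j => ENNReal.toReal_mono (measure_ne_top _ _) (measure_mono (hanti j))
  have hc := chain_sum h0 h1 J
  have hind : ∀ J, ∑ j ∈ Finset.range J, eta (S j - S (j + 1)) ((1 / 2) ^ (j + 2)) + ∫ x in A J, klFun (f x) ∂lam ≤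
      ∫ x in A 0, klFun (f x) ∂lam := by
    intro J
    induction J with
    | zero => simp
    | succ J ih =>
      rw [Finset.sum_range_succ]
      have hd : MeasurableSet (A J \ A (J + 1)) := (hA J).diff (hA _)
      have e1 : (lam (A J \ A (J + 1))).toReal = (1 / 2) ^ (J + 2) := by
        rw [measure_sdiff (hanti J) (hA _).nullMeasurableSet (measure_ne_top _ _),
          ENNReal.toReal_sub_of_le (measure_mono (hanti J)) (measure_ne_top _ _), hl, hl]; ring
      have e2 : (Q (A J \ A (J + 1))).toReal = S J - S (J + 1) := by
        rw [measure_sdiff (hanti J) (hA _).nullMeasurableSet (measure_ne_top _ _),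
          ENNReal.toReal_sub_of_le (measure_mono (hanti J)) (measure_ne_top _ _)]
      have := set_jensen hf hf0 hQ hk hd (by rw [e1]; positivity)
      rw [e1, e2] at this
      have e3 : ∫ x in A J, klFun (f x) ∂lam = ∫ x in A J \ A (J + 1), klFun (f x) ∂lam + ∫ x in A (J + 1), klFun (f x) ∂lam := by
        rw [← setIntegral_union disjoint_sdiff_left (hA _) hk.integrableOn hk.integrableOn, sdiff_union_of_subset (hanti J)]
      linarith
  have hJ := hind J
  have hJ2 := set_jensen hf hf0 hQ hk (hA J) (by rw [hl]; positivity)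
  rw [hl] at hJ2
  have := AA_nonneg (S J / (1 / 2) ^ (J + 1))
  have : 0 ≤ (1 / 2 : ℝ) ^ (J + 1) * AA (S J / (1 / 2) ^ (J + 1)) := by positivity
  linarith

end
end WT

open MeasureTheory ProbabilityTheory Real Set Filter Topology InformationTheory
open scoped ENNReal NNReal
set_option linter.unusedVariables false
set_option linter.unusedSectionVars false

namespace WT

/-- distribution function at the grid points -/
noncomputable def NN (Q : Measure ℝ) (k : ℤ) : ℝ := (Q (Iio (tt k))).toReal

section
variable {Q : Measure ℝ} [IsProbabilityMeasure Q] (hac : Q ≪ lam)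

lemma NN_mono : Monotone (NN Q) := fun i j h =>
  ENNReal.toReal_mono (measure_ne_top _ _) (measure_mono (Iio_subset_Iio (tt_strictMono.monotone h)))

include hac

lemma ae_Q : ∀ᵐ s ∂Q, s ∈ Ioo (0:ℝ) 1 := hac.ae_le ae_lam

lemma NN_top : Tendsto (NN Q) atTop (𝓝 1) := by
  have h := tendsto_measure_iUnion_atTop (μ := Q) (s := fun k : ℤ => Iio (tt k))
    (fun i j h => Iio_subset_Iio (tt_strictMono.monotone h))
  have e : Q (⋃ k : ℤ, Iio (tt k)) = 1 := by
    rw [← measure_univ (μ := Q)]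
    apply measure_congr
    filter_upwards [ae_Q hac] with s hs
    have : ∃ k, s < tt k := (tt_tendsto_top.eventually_const_lt hs.2).exists
    have h1 : s ∈ ⋃ k : ℤ, Iio (tt k) := by simpa using this
    exact propext ⟨fun _ => trivial, fun _ => h1⟩
  rw [e] at h
  have := (ENNReal.tendsto_toReal ENNReal.one_ne_top).comp h
  rw [ENNReal.toReal_one] at this; exact this

lemma NN_bot : Tendsto (NN Q) atBot (𝓝 0) := by
  have h := tendsto_measure_iInter_atBot (μ := Q) (s := fun k : ℤ => Iio (tt k)) (fun i => measurableSet_Iio.nullMeasurableSet)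
    (fun i j h => Iio_subset_Iio (tt_strictMono.monotone h)) ⟨0, measure_ne_top _ _⟩
  have e : Q (⋂ k : ℤ, Iio (tt k)) = 0 := by
    rw [← measure_empty (μ := Q)]
    apply measure_congr
    filter_upwards [ae_Q hac] with s hs
    have : ∃ k, tt k < s := (tt_tendsto_bot.eventually_lt_const hs.1).exists
    have h1 : ¬ s ∈ ⋂ k : ℤ, Iio (tt k) := by
      obtain ⟨k, hk⟩ := this
      intro h; have := mem_iInter.1 h k; exact absurd hk (not_lt.2 (le_of_lt this))
    exact propext ⟨fun h => h1 h, fun h => h.elim⟩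
  rw [e] at h
  have := (ENNReal.tendsto_toReal ENNReal.zero_ne_top).comp h
  rw [ENNReal.toReal_zero] at this; exact this

lemma Q_cell (k : ℤ) : Q (cc ⁻¹' {k}) = ENNReal.ofReal (NN Q (k + 1) - NN Q k) := by
  have e : Q (cc ⁻¹' {k}) = Q (Iio (tt (k + 1)) \ Iio (tt k)) := by
    apply measure_congr
    filter_upwards [ae_Q hac] with s hs
    apply propext
    change cc s = k ↔ s < tt (k + 1) ∧ ¬ s < tt k
    rw [mem_cell hs]
    constructor
    · rintro ⟨h1, h2⟩; exact ⟨h2, not_lt.2 h1⟩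
    · rintro ⟨h1, h2⟩; exact ⟨not_lt.1 h2, h1⟩
  have hs : Iio (tt k) ⊆ Iio (tt (k + 1)) := Iio_subset_Iio (tt_strictMono.monotone (by omega))
  rw [e, measure_sdiff hs measurableSet_Iio.nullMeasurableSet (measure_ne_top _ _), NN, NN,
    ← ENNReal.toReal_sub_of_le (measure_mono hs) (measure_ne_top _ _), ENNReal.ofReal_toReal]
  exact ENNReal.sub_ne_top (measure_ne_top _ _)

end

lemma scale_terms {S R : ℝ} (hR : 0 < R) : R * gam (S / R) = min ((S - R) ^ 2 / R) |S - R| ∧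
    R * far (S / R) = max (S - 2 * R) 0 + max (R / 2 - S) 0 := by
  constructor
  · rw [gam, mul_min_of_nonneg _ _ hR.le]
    congr 1
    · field_simp
    · rw [← abs_of_pos hR, ← abs_mul, abs_of_pos hR]; congr 1; field_simp
  · rw [far, mul_add, mul_max_of_nonneg _ _ hR.le, mul_max_of_nonneg _ _ hR.le]
    congr 2
    · field_simp
    · simp
    · field_simp
    · simp

noncomputable def fr (N : ℤ → ℝ) (i : ℤ) : ℝ := max (tt (i - 1) - N i) 0 + max (N i - tt (i + 1)) 0

lemma fr_nonneg (N : ℤ → ℝ) (i : ℤ) : 0 ≤ fr N i := add_nonneg (le_max_right _ _) (le_max_right _ _)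

lemma FF_eq (N : ℤ → ℝ) : FF N = ∑' i, ENNReal.ofReal (fr N i) := by
  unfold FF fr
  congr 1; ext i
  rw [ENNReal.ofReal_add (le_max_right _ _) (le_max_right _ _)]
  congr 1 <;> simp [ENNReal.ofReal_max]

section
variable {f : ℝ → ℝ} (hf : Measurable f) (hf0 : ∀ x, 0 ≤ f x)
  {Q : Measure ℝ} (hQ : Q = lam.withDensity (fun x => ENNReal.ofReal (f x))) [IsProbabilityMeasure Q]
  (hk : Integrable (fun x => klFun (f x)) lam)

lemma right_term (N : ℤ → ℝ) (i : ℕ) : (1 / 2 : ℝ) ^ (i + 2) * gam ((1 - N (i + 1)) / (1 / 2) ^ (i + 2)) = ga N (i + 1) ∧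
    (1 / 2 : ℝ) ^ (i + 2) * far ((1 - N (i + 1)) / (1 / 2) ^ (i + 2)) = fr N (i + 1) := by
  obtain ⟨h1, h2⟩ := scale_terms (S := 1 - N (i + 1)) (R := (1/2 : ℝ) ^ (i + 2)) (by positivity)
  rw [h1, h2, ga, fr]
  have a1 := tt_nat i
  have a2 := tt_nat (i + 1)
  have a3 := tt_nat (i + 2)
  have a4 := ww_nat (i + 1)
  push_cast at a1 a2 a3 a4
  have e : ((i : ℤ) + 1 - 1) = i := by ring
  have e' : ((i : ℤ) + 1 + 1) = i + 2 := by ring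
  rw [e, e', a1, a2, a3, a4]
  constructor
  · congr 1
    · congr 1; ring
    · rw [abs_sub_comm]; congr 1; ring
  · congr 2 <;> ring

lemma left_term (N : ℤ → ℝ) (i : ℕ) : (1 / 2 : ℝ) ^ (i + 2) * gam ((N (-(i + 1))) / (1 / 2) ^ (i + 2)) = ga N (-(i + 1)) ∧
    (1 / 2 : ℝ) ^ (i + 2) * far ((N (-(i + 1))) / (1 / 2) ^ (i + 2)) = fr N (-(i + 1)) := by
  obtain ⟨h1, h2⟩ := scale_terms (S := N (-(i + 1))) (R := (1/2 : ℝ) ^ (i + 2)) (by positivity)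
  rw [h1, h2, ga, fr]
  have a1 := tt_neg i
  have a2 := tt_neg (i + 1)
  have a3 := tt_neg (i + 2)
  have a4 := ww_neg (i + 1)
  push_cast at a1 a2 a3 a4
  have e : (-((i : ℤ) + 1) - 1) = -(i + 2) := by ring
  have e' : (-((i : ℤ) + 1) + 1) = -i := by ring
  rw [e, e', a1, a2, a3, a4]
  constructor
  · rfl
  · rw [add_comm]; congr 2 <;> ring

include hf hf0 hQ hk

lemma GA_FF : GA (NN Q) ≤ ENNReal.ofReal (50 * ∫ x, klFun (f x) ∂lam) ∧
    FF (NN Q) ≤ ENNReal.ofReal (16 * ∫ x, klFun (f x) ∂lam) := by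
  set N := NN Q with hNdef
  set Hr := ∫ x, klFun (f x) ∂lam
  have hQI : ∀ k, (Q (Ici (tt k))).toReal = 1 - N k := by
    intro k
    have h := prob_compl_eq_one_sub (μ := Q) (measurableSet_Iio (a := tt k))
    rw [compl_Iio] at h
    rw [h, ENNReal.toReal_sub_of_le prob_le_one ENNReal.one_ne_top]; rfl
  have hlL : ∀ k, (lam (Iio (tt k))).toReal = tt k := fun k => lam_Iio (tt_mem k).1.le (tt_mem k).2.le
  have hlI : ∀ k, (lam (Ici (tt k))).toReal = 1 - tt k := by
    intro k
    have h := prob_compl_eq_one_sub (μ := lam) (measurableSet_Iio (a := tt k))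
    rw [compl_Iio] at h
    rw [h, ENNReal.toReal_sub_of_le prob_le_one ENNReal.one_ne_top, hlL]; rfl
  have hR := chain_sets hf hf0 hQ hk (A := fun j => Ici (tt j)) (fun j => measurableSet_Ici)
    (fun j => Ici_subset_Ici.2 (tt_strictMono.monotone (by push_cast; omega)))
    (fun j => by rw [hlI, tt_nat]; ring)
  have hL := chain_sets hf hf0 hQ hk (A := fun j => Iio (tt (-(j:ℤ)))) (fun j => measurableSet_Iio)
    (fun j => Iio_subset_Iio (tt_strictMono.monotone (by push_cast; omega)))
    (fun j => by rw [hlL, tt_neg])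
  simp only [hQI] at hR
  have hL' : ∀ k, (Q (Iio (tt k))).toReal = N k := fun k => rfl
  simp only [hL'] at hL
  set IR := ∫ x in Ici (tt ((0:ℕ):ℤ)), klFun (f x) ∂lam
  have z0 : -((0:ℕ):ℤ) = 0 := by simp
  have z1 : ((0:ℕ):ℤ) = 0 := by simp
  set IL := ∫ x in Iio (tt (-((0:ℕ):ℤ))), klFun (f x) ∂lam
  have t0 : tt 0 = 1 / 2 := by have := tt_nat 0; norm_num at this ⊢; exact this
  have hN0 : 0 ≤ N 0 := ENNReal.toReal_nonneg
  have hN1 : N 0 ≤ 1 := by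
    have := hQI 0
    have h : 0 ≤ (Q (Ici (tt 0))).toReal := ENNReal.toReal_nonneg
    linarith
  have hsum : IL + IR = Hr := by
    have := integral_add_compl (μ := lam) (measurableSet_Iio (a := tt 0)) hk
    rw [compl_Iio] at this
    exact this
  have jR : eta (1 - N 0) (1/2) ≤ IR := by
    have := set_jensen hf hf0 hQ hk (A := Ici (tt ((0:ℕ):ℤ))) measurableSet_Ici (by rw [hlI, z1, t0]; norm_num)
    rwa [show (Q (Ici (tt ((0:ℕ):ℤ)))).toReal = 1 - N 0 from hQI 0,
      show (lam (Ici (tt ((0:ℕ):ℤ)))).toReal = 1 / 2 by rw [hlI, z1, t0]; norm_num] at this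
  have jL : eta (N 0) (1/2) ≤ IL := by
    have := set_jensen hf hf0 hQ hk (A := Iio (tt (-((0:ℕ):ℤ)))) measurableSet_Iio (by rw [hlL, z0, t0]; norm_num)
    rwa [show (Q (Iio (tt (-((0:ℕ):ℤ))))).toReal = N 0 from hL' 0,
      show (lam (Iio (tt (-((0:ℕ):ℤ))))).toReal = 1 / 2 by rw [hlL, z0, t0]] at this
  have hx : (2 * N 0 - 1) ^ 2 ≤ 4 * Hr := by
    rw [eta_eq (by norm_num)] at jR jL
    have p1 := klFun_nonneg (x := (1 - N 0) / (1/2)) (by linarith)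
    have p2 := klFun_nonneg (x := (N 0) / (1/2)) (by linarith)
    rcases le_total (N 0) (1/2) with h | h
    · have := kl_low (g := N 0 / (1/2)) (by linarith) (by linarith)
      have e : (1 - N 0 / (1/2)) ^ 2 = (2 * N 0 - 1) ^ 2 := by ring
      rw [e] at this
      linarith
    · have := kl_low (g := (1 - N 0) / (1/2)) (by linarith) (by linarith)
      have e : (1 - (1 - N 0) / (1/2)) ^ 2 = (2 * N 0 - 1) ^ 2 := by ring
      rw [e] at this
      linarith
  rw [z1, AA_eq (by linarith) (by linarith)] at hR
  rw [z0, AA_eq (by linarith) (by linarith)] at hL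
  set BR := IR + 1 / 2 * (((1 - N 0) / (1 / 2) - 1) ^ 2 / 20) with hBR
  set BL := IL + 1 / 2 * ((N 0 / (1 / 2) - 1) ^ 2 / 20) with hBL
  have hB : BR + BL ≤ 1.2 * Hr := by
    rw [hBR, hBL]; nlinarith
  have nR : ∀ i : ℕ, 0 ≤ 1 - N (i + 1) := fun i => by rw [← hQI]; exact ENNReal.toReal_nonneg
  have nL : ∀ i : ℤ, 0 ≤ N i := fun i => ENNReal.toReal_nonneg
  push_cast at hR hL
  have key : ∀ (h : ℤ → ℝ) (c h0 : ℝ), 0 < c → (∀ i, 0 ≤ h i) → h 0 ≤ h0 →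
      (∀ i : ℕ, c * h (i + 1) ≤ (1 / 2 : ℝ) ^ (i + 2) * GG ((1 - N (i + 1)) / (1 / 2) ^ (i + 2))) →
      (∀ i : ℕ, c * h (-(i + 1)) ≤ (1 / 2 : ℝ) ^ (i + 2) * GG ((N (-(i + 1))) / (1 / 2) ^ (i + 2))) →
      ∑' i, ENNReal.ofReal (h i) ≤ ENNReal.ofReal (1.2 * Hr / c + h0) := by
    intro h c h0 hc hh hh0 hr hl
    have side : ∀ (g G : ℕ → ℝ) (B : ℝ), (∀ i, 0 ≤ g i) → (∀ i, c * g i ≤ G i) → (∀ J, ∑ i ∈ Finset.range J, G i ≤ B) →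
        ∑' i, ENNReal.ofReal (g i) ≤ ENNReal.ofReal (B / c) := by
      intro g G B hg hG hB
      refine ENNReal.tsum_le_of_sum_range_le fun J => ?_
      rw [← ENNReal.ofReal_sum_of_nonneg (fun i _ => hg i)]
      apply ENNReal.ofReal_le_ofReal
      rw [le_div_iff₀ hc, Finset.sum_mul]
      refine le_trans (Finset.sum_le_sum fun i _ => ?_) (hB J)
      rw [mul_comm]; exact hG i
    have s1 := side _ _ BR (fun i => hh _) hr hR
    have s2 := side _ _ BL (fun i => hh _) hl hL
    have BR0 : 0 ≤ BR := by simpa using hR 0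
    have BL0 : 0 ≤ BL := by simpa using hL 0
    rw [tsum_of_add_one_of_neg_add_one ENNReal.summable ENNReal.summable]
    calc _ ≤ ENNReal.ofReal (BR / c) + ENNReal.ofReal h0 + ENNReal.ofReal (BL / c) := by
          gcongr
      _ = ENNReal.ofReal (BR / c + h0 + BL / c) := by
          have : 0 ≤ h0 := le_trans (hh _) hh0
          rw [ENNReal.ofReal_add (by positivity) (by positivity), ENNReal.ofReal_add (by positivity) (by positivity)]
      _ ≤ _ := by
          apply ENNReal.ofReal_le_ofReal
          have : BR / c + BL / c ≤ 1.2 * Hr / c := by rw [← add_div]; gcongr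
          linarith
  have hGGb : ∀ (R S : ℝ), 0 < R → 0 ≤ S → 0.026 * (R * gam (S / R)) ≤ R * GG (S / R) ∧ 0.08 * (R * far (S / R)) ≤ R * GG (S / R) := by
    intro R S hR hS
    obtain ⟨h1, h2⟩ := GG_bounds (E := S / R) (by positivity)
    have := mul_le_mul_of_nonneg_left h1 hR.le
    have := mul_le_mul_of_nonneg_left h2 hR.le
    constructor <;> linarith
  have Hr0 : 0 ≤ Hr := by nlinarith
  constructor
  · refine (key (ga N) 0.026 (2 * Hr) (by norm_num) (ga_nonneg N) ?_ ?_ ?_).trans ?_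
    · refine (min_le_left _ _).trans ?_
      have : ww 0 = 1 / 2 := by simp [ww]
      rw [this, t0, div_le_iff₀ (by norm_num)]; nlinarith
    · intro i; rw [← (right_term N i).1]; exact (hGGb _ _ (by positivity) (nR i)).1
    · intro i; rw [← (left_term N i).1]; exact (hGGb _ _ (by positivity) (nL _)).1
    · apply ENNReal.ofReal_le_ofReal
      have : 1.2 * Hr / 0.026 ≤ 48 * Hr := by rw [div_le_iff₀ (by norm_num)]; nlinarith
      linarith
  · rw [FF_eq]
    refine (key (fr N) 0.08 Hr (by norm_num) (fr_nonneg N) ?_ ?_ ?_).trans ?_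
    · have a1 : tt 1 = 3 / 4 := by have := tt_nat 1; norm_num at this; exact this
      have a2 : tt (-1) = 1 / 4 := by have := tt_neg 1; norm_num at this; exact this
      rw [fr]; norm_num [a1, a2]
      rcases le_total (1/4 - N 0) 0 with h | h <;> rcases le_total (N 0 - 3/4) 0 with h' | h' <;>
        simp only [max_eq_left, max_eq_right, h, h'] <;> nlinarith [sq_nonneg (N 0)]
    · intro i; rw [← (right_term N i).2]; exact (hGGb _ _ (by positivity) (nR i)).2
    · intro i; rw [← (left_term N i).2]; exact (hGGb _ _ (by positivity) (nL _)).2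
    · apply ENNReal.ofReal_le_ofReal
      have : 1.2 * Hr / 0.08 ≤ 15 * Hr := by rw [div_le_iff₀ (by norm_num)]; nlinarith
      linarith

end
end WT

open MeasureTheory ProbabilityTheory Real Set Filter Topology InformationTheory
open scoped ENNReal NNReal
set_option linter.unusedVariables false
set_option linter.unusedSectionVars false

namespace WT

lemma pf_fwd {m n f : ℝ} {q : ℝ≥0∞} (hm : 0 < m) (hn : 0 < n) (hf : 0 ≤ f) (h1 : q ≤ ENNReal.ofReal m)
    (h2 : q ≤ ENNReal.ofReal n) :
    ((q / ENNReal.ofReal m * 1 - min (q / ENNReal.ofReal m * 1) (q / ENNReal.ofReal n * ENNReal.ofReal f)) / 1) ^ 2 ≤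
      ENNReal.ofReal (2 * ((n / m) * klFun (f / (n / m)))) := by
  have hq : q ≠ ⊤ := ne_top_of_le_ne_top ENNReal.ofReal_ne_top h1
  obtain ⟨r, hr, rfl⟩ : ∃ r, 0 ≤ r ∧ q = ENNReal.ofReal r := ⟨q.toReal, ENNReal.toReal_nonneg, (ENNReal.ofReal_toReal hq).symm⟩
  rw [ENNReal.ofReal_le_ofReal_iff hm.le] at h1
  rw [ENNReal.ofReal_le_ofReal_iff hn.le] at h2
  rw [div_one, mul_one, ← ENNReal.ofReal_div_of_pos hm, ← ENNReal.ofReal_div_of_pos hn, ← ENNReal.ofReal_mul (by positivity),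
    ← ENNReal.ofReal_min, ← ENNReal.ofReal_sub _ (by positivity), ← ENNReal.ofReal_pow (sub_nonneg.2 (min_le_left _ _))]
  apply ENNReal.ofReal_le_ofReal
  set g := f / (n / m) with hg
  have hg0 : 0 ≤ g := by positivity
  have e : r / n * f = r / m * g := by rw [hg]; field_simp
  have hk := klFun_nonneg hg0
  rw [e]
  rcases le_total 1 g with h | h
  · rw [min_eq_left (by have : 0 ≤ r / m := by positivity
                        nlinarith)]
    simp; positivity
  · rw [min_eq_right (by have : 0 ≤ r / m := by positivity
                         nlinarith)]
    have h3 := kl_low hg0 h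
    have h4 : (r / m) ^ 2 ≤ n / m := by
      have a : r / m ≤ 1 := (div_le_one hm).2 h1
      have b : r / m ≤ n / m := by gcongr
      have c : 0 ≤ r / m := by positivity
      nlinarith
    calc (r / m - r / m * g) ^ 2 = (r / m) ^ 2 * (1 - g) ^ 2 := by ring
      _ ≤ (n / m) * (2 * klFun g) := by gcongr
      _ = _ := by ring

lemma pf_rev {m n f : ℝ} {q : ℝ≥0∞} (hm : 0 < m) (hn : 0 < n) (hf : 0 ≤ f) (h1 : q ≤ ENNReal.ofReal m)
    (h2 : q ≤ ENNReal.ofReal n) :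
    ENNReal.ofReal f * ((q / ENNReal.ofReal n * ENNReal.ofReal f - min (q / ENNReal.ofReal n * ENNReal.ofReal f) (q / ENNReal.ofReal m * 1))
      / ENNReal.ofReal f) ^ 2 ≤
      ENNReal.ofReal (2 * ((n / m) * klFun (f / (n / m)))) := by
  rcases hf.eq_or_lt with h | hf'
  · rw [← h]; simp
  have hq : q ≠ ⊤ := ne_top_of_le_ne_top ENNReal.ofReal_ne_top h1
  obtain ⟨r, hr, rfl⟩ : ∃ r, 0 ≤ r ∧ q = ENNReal.ofReal r := ⟨q.toReal, ENNReal.toReal_nonneg, (ENNReal.ofReal_toReal hq).symm⟩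
  rw [ENNReal.ofReal_le_ofReal_iff hm.le] at h1
  rw [ENNReal.ofReal_le_ofReal_iff hn.le] at h2
  rw [mul_one, ← ENNReal.ofReal_div_of_pos hm, ← ENNReal.ofReal_div_of_pos hn, ← ENNReal.ofReal_mul (by positivity),
    ← ENNReal.ofReal_min, ← ENNReal.ofReal_sub _ (by positivity), ← ENNReal.ofReal_div_of_pos hf',
    ← ENNReal.ofReal_pow (div_nonneg (sub_nonneg.2 (min_le_left _ _)) hf), ← ENNReal.ofReal_mul hf]
  apply ENNReal.ofReal_le_ofReal
  set g := f / (n / m) with hg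
  have hg0 : 0 < g := by positivity
  have hfe : f = (n / m) * g := by rw [hg]; field_simp
  have e : r / m = r / n * f * (1 / g) := by rw [hg]; field_simp
  have hk := klFun_nonneg hg0.le
  have hp : 0 ≤ r / n * f := by positivity
  rw [e]
  rcases le_total g 1 with h | h
  · have : 1 ≤ 1 / g := by rw [le_div_iff₀ hg0]; linarith
    rw [min_eq_left (by nlinarith)]
    simp; positivity
  · have : 1 / g ≤ 1 := by rw [div_le_iff₀ hg0]; linarith
    rw [min_eq_right (by nlinarith)]
    have h3 := kl_high h
    have h4 : (r / n) ^ 2 ≤ 1 := by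
      have a : r / n ≤ 1 := (div_le_one hn).2 h2
      have c : 0 ≤ r / n := by positivity
      nlinarith
    calc f * ((r / n * f - r / n * f * (1 / g)) / f) ^ 2 = (r / n) ^ 2 * (f * (1 - 1 / g) ^ 2) := by field_simp
      _ ≤ 1 * (f * (1 - 1 / g) ^ 2) := by gcongr
      _ = (n / m) * (g * (1 - 1 / g) ^ 2) := by rw [hfe]; ring
      _ ≤ (n / m) * (2 * klFun g) := by gcongr
      _ = _ := by ring

section
variable {f : ℝ → ℝ} (hf : Measurable f) (hf0 : ∀ x, 0 ≤ f x)
  {Q : Measure ℝ} (hQ : Q = lam.withDensity (fun x => ENNReal.ofReal (f x))) [IsProbabilityMeasure Q]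
  (hk : Integrable (fun x => klFun (f x)) lam)

include hf hf0 hQ hk

lemma cell_ent {A : Set ℝ} (hA : MeasurableSet A) {m n : ℝ} (hm : 0 < m) (hn : 0 < n) (hlA : lam A = ENNReal.ofReal m)
    (hQA : Q A = ENNReal.ofReal n) :
    ∫⁻ x in A, ENNReal.ofReal (2 * ((n / m) * klFun (f x / (n / m)))) ∂lam ≤ 2 * ∫⁻ x in A, ENNReal.ofReal (klFun (f x)) ∂lam := by
  have hfb : 0 < n / m := by positivity
  have pt : ∀ x, (n / m) * klFun (f x / (n / m)) = klFun (f x) - (f x * Real.log (n / m) + (1 - n / m)) := by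
    intro x
    rcases (hf0 x).eq_or_lt with h | h
    · rw [← h]; simp [klFun]
    · rw [klFun, klFun, Real.log_div h.ne' hfb.ne']; field_simp; ring
  have i1 : Integrable (fun x => f x * Real.log (n / m) + (1 - n / m)) lam :=
    ((f_int hf hf0 hQ).mul_const _).add (integrable_const _)
  have i2 : IntegrableOn (fun x => (n / m) * klFun (f x / (n / m))) A lam := by
    simp_rw [pt]; exact (hk.sub i1).integrableOn
  have nn : ∀ x, 0 ≤ (n / m) * klFun (f x / (n / m)) := fun x =>
    mul_nonneg hfb.le (klFun_nonneg (div_nonneg (hf0 x) hfb.le))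
  simp_rw [ENNReal.ofReal_mul (zero_le_two)]
  rw [lintegral_const_mul' _ _ (by simp), ENNReal.ofReal_ofNat]
  gcongr 2 * ?_
  rw [← ofReal_integral_eq_lintegral_ofReal i2 (ae_of_all _ nn),
    ← ofReal_integral_eq_lintegral_ofReal hk.integrableOn (ae_of_all _ fun x => klFun_nonneg (hf0 x))]
  apply ENNReal.ofReal_le_ofReal
  simp_rw [pt]
  rw [integral_sub hk.integrableOn i1.integrableOn, integral_add ((f_int hf hf0 hQ).mul_const _).integrableOn (integrable_const _),
    integral_mul_const, ← Q_eq hf hf0 hQ hA, hQA, integral_const, measureReal_restrict_apply MeasurableSet.univ, univ_inter,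
    Measure.real, hlA, ENNReal.toReal_ofReal hm.le, ENNReal.toReal_ofReal hn.le, smul_eq_mul]
  have : 0 ≤ m * klFun (n / m) := mul_nonneg hm.le (klFun_nonneg hfb.le)
  have e : m * klFun (n / m) = n * Real.log (n / m) + m * (1 - n / m) := by rw [klFun]; field_simp; ring
  linarith

lemma pin_fwd (q : ℤ → ℝ≥0∞) (h1 : ∀ k, q k ≤ lam (cc ⁻¹' {k})) (h2 : ∀ k, q k ≤ Q (cc ⁻¹' {k})) :
    ∫⁻ x, ((q (cc x) / lam (cc ⁻¹' {cc x}) * 1 - min (q (cc x) / lam (cc ⁻¹' {cc x}) * 1)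
      (q (cc x) / Q (cc ⁻¹' {cc x}) * ENNReal.ofReal (f x))) / 1) ^ 2 ∂lam ≤ 2 * ∫⁻ x, ENNReal.ofReal (klFun (f x)) ∂lam := by
  rw [lintegral_cells measurable_cc, lintegral_cells measurable_cc, ← ENNReal.tsum_mul_left]
  refine ENNReal.tsum_le_tsum fun k => ?_
  by_cases hn : Q (cc ⁻¹' {k}) = 0
  · have hq : q k = 0 := le_zero_iff.1 (hn ▸ h2 k)
    refine le_trans (le_of_eq ?_) (zero_le')
    rw [← lintegral_zero (μ := lam.restrict (cc ⁻¹' {k}))]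
    refine setLIntegral_congr_fun (meas_cell measurable_cc k) fun x hx => ?_
    have : cc x = k := hx
    simp [this, hq]
  have hn' : 0 < (Q (cc ⁻¹' {k})).toReal := ENNReal.toReal_pos hn (measure_ne_top _ _)
  have eQ : Q (cc ⁻¹' {k}) = ENNReal.ofReal (Q (cc ⁻¹' {k})).toReal := (ENNReal.ofReal_toReal (measure_ne_top _ _)).symm
  refine le_trans ?_ (cell_ent hf hf0 hQ hk (meas_cell measurable_cc k) (mm_pos k) hn' (lam_cell k) eQ)
  refine setLIntegral_mono' (meas_cell measurable_cc k) fun x hx => ?_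
  have : cc x = k := hx
  rw [this, lam_cell k]
  have := pf_fwd (q := q k) (mm_pos k) hn' (hf0 x) (lam_cell k ▸ h1 k) (eQ ▸ h2 k)
  rwa [← eQ] at this

lemma pin_rev (q : ℤ → ℝ≥0∞) (h1 : ∀ k, q k ≤ lam (cc ⁻¹' {k})) (h2 : ∀ k, q k ≤ Q (cc ⁻¹' {k})) :
    ∫⁻ x, ((q (cc x) / Q (cc ⁻¹' {cc x}) * ENNReal.ofReal (f x) - min (q (cc x) / Q (cc ⁻¹' {cc x}) * ENNReal.ofReal (f x))
      (q (cc x) / lam (cc ⁻¹' {cc x}) * 1)) / ENNReal.ofReal (f x)) ^ 2 ∂Q ≤ 2 * ∫⁻ x, ENNReal.ofReal (klFun (f x)) ∂lam := by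
  have hle : ∀ g : ℝ → ℝ≥0∞, ∫⁻ x, g x ∂Q ≤ ∫⁻ x, ENNReal.ofReal (f x) * g x ∂lam := by
    intro g; rw [hQ]; exact lintegral_withDensity_le_lintegral_mul _ hf.ennreal_ofReal g
  refine (hle _).trans ?_
  rw [lintegral_cells measurable_cc, lintegral_cells measurable_cc, ← ENNReal.tsum_mul_left]
  refine ENNReal.tsum_le_tsum fun k => ?_
  by_cases hn : Q (cc ⁻¹' {k}) = 0
  · have hq : q k = 0 := le_zero_iff.1 (hn ▸ h2 k)
    refine le_trans (le_of_eq ?_) (zero_le')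
    rw [← lintegral_zero (μ := lam.restrict (cc ⁻¹' {k}))]
    refine setLIntegral_congr_fun (meas_cell measurable_cc k) fun x hx => ?_
    have : cc x = k := hx
    simp [this, hq]
  have hn' : 0 < (Q (cc ⁻¹' {k})).toReal := ENNReal.toReal_pos hn (measure_ne_top _ _)
  have eQ : Q (cc ⁻¹' {k}) = ENNReal.ofReal (Q (cc ⁻¹' {k})).toReal := (ENNReal.ofReal_toReal (measure_ne_top _ _)).symm
  refine le_trans ?_ (cell_ent hf hf0 hQ hk (meas_cell measurable_cc k) (mm_pos k) hn' (lam_cell k) eQ)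
  refine setLIntegral_mono' (meas_cell measurable_cc k) fun x hx => ?_
  have : cc x = k := hx
  rw [this, lam_cell k]
  have := pf_rev (q := q k) (mm_pos k) hn' (hf0 x) (lam_cell k ▸ h1 k) (eQ ▸ h2 k)
  rwa [← eQ] at this

end
end WT

open MeasureTheory ProbabilityTheory Real Set Filter Topology InformationTheory
open scoped ENNReal NNReal
set_option linter.unusedVariables false
set_option linter.unusedSectionVars false

namespace WT

lemma point_cost {θ : ℝ → ℝ} {t₀ : ℝ} (H : GoodCost θ t₀) {a : ℝ} (ha : 0 < a) {T : ℝ → ℝ} (hTm : Measurable T)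
    {R : ℕ → ℝ} (hR : ∀ x ∈ Ioo (0:ℝ) 1, ∀ y ∈ Ioo (0:ℝ) 1, |T y - T x| ≤ R (cc x - cc y).natAbs)
    (hR1 : ∀ j ≤ 1, 2 * a * R j ≤ min 1 t₀ / 105)
    (hR2 : ∀ j : ℕ, 2 ≤ j → cext θ (2 * a * R j) ≤ 4 / 105 * (j - 1))
    {ρ : Measure ℝ} [IsProbabilityMeasure ρ] (hρ : ∀ᵐ y ∂ρ, y ∈ Ioo (0:ℝ) 1) {x : ℝ} (hx : x ∈ Ioo (0:ℝ) 1)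
    (hT : Integrable T ρ) :
    ENNReal.ofReal (cext θ (a * ∫ y, |T y - T x| ∂ρ)) ≤
      ENNReal.ofReal (1 / 7350) * (ρ (cc ⁻¹' {cc x} \ {x}) ^ 2 + (ρ (cc ⁻¹' {cc x + 1}) ^ 2 + ρ (cc ⁻¹' {cc x - 1}) ^ 2)) +
      ENNReal.ofReal (2 / 105) * ∑' l, ρ (cc ⁻¹' {l}) * (((cc x - l).natAbs - 1 : ℕ) : ℝ≥0∞) := by
  set k := cc x with hk
  set g : ℝ → ℝ := fun y => |T y - T x| with hg
  have hgm : Measurable g := (hTm.sub_const _).abs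
  have hgi : Integrable g ρ := (hT.sub (integrable_const _)).abs
  set B : Set ℝ := cc ⁻¹' {l | (k - l).natAbs ≤ 1} \ {x} with hB
  set F : Set ℝ := cc ⁻¹' {l | 2 ≤ (k - l).natAbs} with hF
  have hBm : MeasurableSet B := (measurable_cc (MeasurableSet.of_discrete)).diff (measurableSet_singleton x)
  have hFm : MeasurableSet F := measurable_cc (MeasurableSet.of_discrete)
  have hsplit : g = fun y => B.indicator g y + F.indicator g y := by
    ext y
    by_cases hy : y = x
    · have h1 : y ∉ B := fun h => h.2 hy
      have h0 : g y = 0 := by simp [hg, hy]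
      have h2 : y ∉ F := fun h => by
        have : 2 ≤ (k - cc y).natAbs := h
        rw [hy, ← hk] at this; simp at this
      rw [indicator_of_notMem h1, indicator_of_notMem h2, h0]; simp
    · by_cases h : 2 ≤ (k - cc y).natAbs
      · have h1 : y ∉ B := fun h' => by
          have : (k - cc y).natAbs ≤ 1 := h'.1
          omega
        have h2 : y ∈ F := h
        rw [indicator_of_notMem h1, indicator_of_mem h2, zero_add]
      · have h1 : y ∈ B := ⟨by change (k - cc y).natAbs ≤ 1; omega, hy⟩
        have h2 : y ∉ F := h
        rw [indicator_of_notMem h2, indicator_of_mem h1, add_zero]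
  have iB : Integrable (B.indicator g) ρ := hgi.indicator hBm
  have iF : Integrable (F.indicator g) ρ := hgi.indicator hFm
  have e1 : ∫ y, g y ∂ρ = ∫ y, B.indicator g y ∂ρ + ∫ y, F.indicator g y ∂ρ := by
    rw [← integral_add iB iF]; exact congrArg (fun h => ∫ y, h y ∂ρ) hsplit
  set I1 := ∫ y, B.indicator g y ∂ρ
  set I2 := ∫ y, F.indicator g y ∂ρ
  have hconv : cext θ (a * (I1 + I2)) ≤ 1 / 2 * cext θ (2 * a * I1) + 1 / 2 * cext θ (2 * a * I2) := by
    have := H.ext_convex.2 (mem_univ (2 * a * I1)) (mem_univ (2 * a * I2)) (show (0:ℝ) ≤ 1/2 by norm_num) (show (0:ℝ) ≤ 1/2 by norm_num) (by norm_num)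
    simp only [smul_eq_mul] at this
    have e : 1 / 2 * (2 * a * I1) + 1 / 2 * (2 * a * I2) = a * (I1 + I2) := by ring
    rwa [e] at this
  set δ := min 1 t₀ / 105 with hδ
  have ht0 := H.pos
  have hδ0 : 0 ≤ δ := by have : 0 < min 1 t₀ := lt_min one_pos ht0
                         positivity
  have hδ1 : δ ≤ 1 / 105 := by rw [hδ]; have := min_le_left 1 t₀; linarith
  have hδ2 : δ ≤ t₀ := by rw [hδ]; have := min_le_right 1 t₀; linarith
  have hI1 : 2 * a * I1 ≤ δ * (ρ B).toReal := by
    rw [← integral_const_mul]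
    have e : δ * (ρ B).toReal = ∫ y, B.indicator (fun _ => δ) y ∂ρ := by
      rw [integral_indicator_const _ hBm, smul_eq_mul, mul_comm]; rfl
    rw [e]
    refine integral_mono_ae (iB.const_mul _) ((integrable_const δ).indicator hBm) ?_
    filter_upwards [hρ] with y hy
    by_cases h : y ∈ B
    · simp only [indicator_of_mem h]
      have h1 : (cc x - cc y).natAbs ≤ 1 := h.1
      have := hR x hx y hy
      calc 2 * a * g y ≤ 2 * a * R (cc x - cc y).natAbs := by gcongr
        _ ≤ _ := hR1 _ h1
    · simp [indicator_of_notMem h]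
  have hp1 : (ρ B).toReal ≤ 1 := by
    have := ENNReal.toReal_mono ENNReal.one_ne_top (prob_le_one (μ := ρ) (s := B)); simpa using this
  have hp0 : 0 ≤ (ρ B).toReal := ENNReal.toReal_nonneg
  set u := (ρ (cc ⁻¹' {k} \ {x})).toReal with hu
  set v := (ρ (cc ⁻¹' {k + 1})).toReal with hv
  set w := (ρ (cc ⁻¹' {k - 1})).toReal with hw
  have hBle : (ρ B).toReal ≤ u + (v + w) := by
    have : B ⊆ (cc ⁻¹' {k} \ {x}) ∪ (cc ⁻¹' {k + 1} ∪ cc ⁻¹' {k - 1}) := by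
      intro y hy
      have h1 : (k - cc y).natAbs ≤ 1 := hy.1
      have h2 : cc y = k ∨ cc y = k + 1 ∨ cc y = k - 1 := by omega
      rcases h2 with h | h | h
      · exact Or.inl ⟨h, hy.2⟩
      · exact Or.inr (Or.inl h)
      · exact Or.inr (Or.inr h)
    have h2 := (measure_mono (μ := ρ) this).trans ((measure_union_le _ _).trans (add_le_add le_rfl (measure_union_le _ _)))
    have h3 := ENNReal.toReal_mono (by simp [measure_ne_top]) h2
    rwa [ENNReal.toReal_add (measure_ne_top _ _) (by simp [measure_ne_top]), ENNReal.toReal_add (measure_ne_top _ _) (measure_ne_top _ _)] at h3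
  have hu0 : 0 ≤ u := ENNReal.toReal_nonneg
  have hv0 : 0 ≤ v := ENNReal.toReal_nonneg
  have hw0 : 0 ≤ w := ENNReal.toReal_nonneg
  have hnear : 1 / 2 * cext θ (2 * a * I1) ≤ 1 / 7350 * (u ^ 2 + (v ^ 2 + w ^ 2)) := by
    have h1 : cext θ (2 * a * I1) ≤ (δ * (ρ B).toReal) ^ 2 := by
      refine (H.ext_mono hI1).trans (le_of_eq ?_)
      rw [cext_of_nonneg (by positivity)]
      exact H.quad _ ⟨by positivity, by nlinarith⟩
    have h2 : (δ * (ρ B).toReal) ^ 2 ≤ (1 / 105 * (u + (v + w))) ^ 2 := by gcongr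
    nlinarith [sq_nonneg (u - v), sq_nonneg (u - w), sq_nonneg (v - w)]
  have hfar : ENNReal.ofReal (1 / 2 * cext θ (2 * a * I2)) ≤
      ENNReal.ofReal (2 / 105) * ∑' l, ρ (cc ⁻¹' {l}) * (((k - l).natAbs - 1 : ℕ) : ℝ≥0∞) := by
    have h1 := H.jensen ρ (iF.const_mul (2 * a))
    rw [integral_const_mul] at h1
    have h2 : ∫⁻ y, ENNReal.ofReal (cext θ (2 * a * F.indicator g y)) ∂ρ ≤
        ∫⁻ y, ENNReal.ofReal (4 / 105) * (((k - cc y).natAbs - 1 : ℕ) : ℝ≥0∞) ∂ρ := by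
      refine lintegral_mono_ae ?_
      filter_upwards [hρ] with y hy
      by_cases h : y ∈ F
      · have h' : 2 ≤ (k - cc y).natAbs := h
        rw [indicator_of_mem h, ← ENNReal.ofReal_natCast, ← ENNReal.ofReal_mul (by norm_num)]
        apply ENNReal.ofReal_le_ofReal
        have := hR x hx y hy
        rw [Nat.cast_sub (by omega), Nat.cast_one]
        exact (H.ext_mono (by gcongr)).trans (hR2 _ h')
      · rw [indicator_of_notMem h, mul_zero, cext_of_nonneg le_rfl, H.zero]; simp
    have h3 : ∫⁻ y, ENNReal.ofReal (4 / 105) * (((k - cc y).natAbs - 1 : ℕ) : ℝ≥0∞) ∂ρ =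
        ENNReal.ofReal (4 / 105) * ∑' l, ρ (cc ⁻¹' {l}) * (((k - l).natAbs - 1 : ℕ) : ℝ≥0∞) := by
      rw [lintegral_const_mul' _ _ ENNReal.ofReal_ne_top, lintegral_cells measurable_cc]
      congr 2; ext l
      rw [setLIntegral_congr_fun (g := fun _ => (((k - l).natAbs - 1 : ℕ) : ℝ≥0∞)) (meas_cell measurable_cc l)]
      · rw [setLIntegral_const, mul_comm]
      · intro y hy
        have : cc y = l := hy
        simp [this]
    rw [h3] at h2
    rw [ENNReal.ofReal_mul (by norm_num)]
    calc _ ≤ ENNReal.ofReal (1 / 2) * (ENNReal.ofReal (4 / 105) * ∑' l, ρ (cc ⁻¹' {l}) * (((k - l).natAbs - 1 : ℕ) : ℝ≥0∞)) := by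
          gcongr; exact h1.trans h2
      _ = _ := by rw [← mul_assoc, ← ENNReal.ofReal_mul (by norm_num)]; norm_num
  rw [e1]
  refine (ENNReal.ofReal_le_ofReal hconv).trans (ENNReal.ofReal_add_le.trans (add_le_add ?_ hfar))
  refine (ENNReal.ofReal_le_ofReal hnear).trans (le_of_eq ?_)
  rw [ENNReal.ofReal_mul (by norm_num), ENNReal.ofReal_add (by positivity) (by positivity), ENNReal.ofReal_add (by positivity) (by positivity),
    ENNReal.ofReal_pow hu0, ENNReal.ofReal_pow hv0, ENNReal.ofReal_pow hw0, hu, hv, hw,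
    ENNReal.ofReal_toReal (measure_ne_top _ _), ENNReal.ofReal_toReal (measure_ne_top _ _), ENNReal.ofReal_toReal (measure_ne_top _ _)]

lemma cost_bound {θ : ℝ → ℝ} {t₀ : ℝ} (H : GoodCost θ t₀) {a : ℝ} (ha : 0 < a) {T : ℝ → ℝ} (hTm : Measurable T)
    {R : ℕ → ℝ} (hR : ∀ x ∈ Ioo (0:ℝ) 1, ∀ y ∈ Ioo (0:ℝ) 1, |T y - T x| ≤ R (cc x - cc y).natAbs)
    (hR1 : ∀ j ≤ 1, 2 * a * R j ≤ min 1 t₀ / 105)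
    (hR2 : ∀ j : ℕ, 2 ≤ j → cext θ (2 * a * R j) ≤ 4 / 105 * (j - 1))
    {P : Measure ℝ} [IsProbabilityMeasure P] (hP : ∀ᵐ y ∂P, y ∈ Ioo (0:ℝ) 1) {K : Kernel ℝ ℝ} [IsMarkovKernel K]
    (hK1 : ∀ᵐ x ∂P, ∀ᵐ y ∂(K x), y ∈ Ioo (0:ℝ) 1) (hK2 : ∀ᵐ x ∂P, Integrable T (K x))
    {q : ℤ → ℤ → ℝ≥0∞} {pin : ℝ → ℝ≥0∞}
    (hK3 : ∀ᵐ x ∂P, (K x (cc ⁻¹' {cc x} \ {x}) ≤ pin x) ∧ ∀ l, l ≠ cc x → K x (cc ⁻¹' {l}) ≤ q (cc x) l / P (cc ⁻¹' {cc x}))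
    {h : ℝ≥0∞} (hpin : ∫⁻ x, pin x ^ 2 ∂P ≤ 2 * h)
    (hnear : ∑' k, (q k (k + 1) ^ 2 / P (cc ⁻¹' {k}) + q k (k - 1) ^ 2 / P (cc ⁻¹' {k})) ≤ 32 * (50 * h))
    (hfar : ∑' k, ∑' l, q k l * (((k - l).natAbs - 1 : ℕ) : ℝ≥0∞) ≤ 16 * h) :
    ∫⁻ x, ENNReal.ofReal (cext θ (a * ∫ y, |T y - T x| ∂(K x))) ∂P ≤ h := by
  set Ψ : ℤ → ℝ≥0∞ := fun k => ENNReal.ofReal (1 / 7350) * ((q k (k + 1) / P (cc ⁻¹' {k})) ^ 2 + (q k (k - 1) / P (cc ⁻¹' {k})) ^ 2) +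
    ENNReal.ofReal (2 / 105) * ∑' l, q k l / P (cc ⁻¹' {k}) * (((k - l).natAbs - 1 : ℕ) : ℝ≥0∞) with hΨ
  have h1 : ∫⁻ x, ENNReal.ofReal (cext θ (a * ∫ y, |T y - T x| ∂(K x))) ∂P ≤
      ∫⁻ x, (ENNReal.ofReal (1 / 7350) * pin x ^ 2 + Ψ (cc x)) ∂P := by
    refine lintegral_mono_ae ?_
    filter_upwards [hP, hK1, hK2, hK3] with x hx h1 h2 h3
    refine (point_cost H ha hTm hR hR1 hR2 h1 hx h2).trans ?_
    simp only [hΨ]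
    rw [mul_add, add_assoc]
    have f1 := h3.2 (cc x + 1) (by omega)
    have f2 := h3.2 (cc x - 1) (by omega)
    have f3 := h3.1
    refine add_le_add (by gcongr) (add_le_add (by gcongr) ?_)
    refine mul_le_mul_right (ENNReal.tsum_le_tsum fun l => ?_) _
    by_cases hl : l = cc x
    · simp [hl]
    · exact mul_le_mul_left (h3.2 l hl) _
  refine h1.trans ?_
  have hm : Measurable (fun x => Ψ (cc x)) := (measurable_of_countable Ψ).comp measurable_cc
  rw [lintegral_add_right _ hm, lintegral_const_mul' _ _ ENNReal.ofReal_ne_top, lintegral_cells measurable_cc P (fun x => Ψ (cc x))]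
  have e : ∀ k, ∫⁻ x in cc ⁻¹' {k}, Ψ (cc x) ∂P = Ψ k * P (cc ⁻¹' {k}) := by
    intro k
    rw [setLIntegral_congr_fun (g := fun _ => Ψ k) (meas_cell measurable_cc k)]
    · rw [setLIntegral_const]
    · intro y hy
      have : cc y = k := hy
      simp [this]
  have dm : ∀ x y : ℝ≥0∞, x / y * y ≤ x := fun x y => by rw [mul_comm]; exact ENNReal.mul_div_le
  have h2 : ∀ k, Ψ k * P (cc ⁻¹' {k}) ≤
      ENNReal.ofReal (1 / 7350) * (q k (k + 1) ^ 2 / P (cc ⁻¹' {k}) + q k (k - 1) ^ 2 / P (cc ⁻¹' {k})) +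
      ENNReal.ofReal (2 / 105) * ∑' l, q k l * (((k - l).natAbs - 1 : ℕ) : ℝ≥0∞) := by
    intro k
    have sqd : ∀ z : ℝ≥0∞, (z / P (cc ⁻¹' {k})) ^ 2 * P (cc ⁻¹' {k}) ≤ z ^ 2 / P (cc ⁻¹' {k}) := by
      intro z
      have e : (z / P (cc ⁻¹' {k})) ^ 2 * P (cc ⁻¹' {k}) = z / P (cc ⁻¹' {k}) * (z / P (cc ⁻¹' {k}) * P (cc ⁻¹' {k})) := by ring
      rw [e]
      calc _ ≤ z / P (cc ⁻¹' {k}) * z := by gcongr; exact dm _ _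
        _ = _ := by rw [div_eq_mul_inv, div_eq_mul_inv]; ring
    rw [hΨ]
    simp only
    rw [add_mul, mul_assoc, mul_assoc, add_mul, ← ENNReal.tsum_mul_right]
    refine add_le_add (mul_le_mul_right (add_le_add ?_ ?_) _) (mul_le_mul_right (ENNReal.tsum_le_tsum fun l => ?_) _)
    · exact sqd _
    · exact sqd _
    · calc _ = q k l / P (cc ⁻¹' {k}) * P (cc ⁻¹' {k}) * (((k - l).natAbs - 1 : ℕ) : ℝ≥0∞) := by ring
        _ ≤ _ := by gcongr; exact dm _ _
  calc _ ≤ ENNReal.ofReal (1 / 7350) * (2 * h) + (ENNReal.ofReal (1 / 7350) * (32 * (50 * h)) + ENNReal.ofReal (2 / 105) * (16 * h)) := by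
        refine add_le_add (by gcongr) ?_
        simp_rw [e]
        refine (ENNReal.tsum_le_tsum h2).trans ?_
        rw [ENNReal.tsum_add, ENNReal.tsum_mul_left, ENNReal.tsum_mul_left]
        gcongr
    _ = (ENNReal.ofReal (1 / 7350) * 2 + (ENNReal.ofReal (1 / 7350) * (32 * 50) + ENNReal.ofReal (2 / 105) * 16)) * h := by ring
    _ ≤ 1 * h := by
        gcongr
        have l2 : (2 : ℝ≥0∞) = ENNReal.ofReal 2 := by simp
        have l32 : (32 * 50 : ℝ≥0∞) = ENNReal.ofReal 1600 := by norm_num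
        have l16 : (16 : ℝ≥0∞) = ENNReal.ofReal 16 := by simp
        rw [l32, l16, ← ENNReal.ofReal_mul (by norm_num), ← ENNReal.ofReal_mul (by norm_num)]
        rw [l2, ← ENNReal.ofReal_mul (by norm_num), ← ENNReal.ofReal_add (by norm_num) (by norm_num), ← ENNReal.ofReal_add (by norm_num) (by norm_num),
          ← ENNReal.ofReal_one]
        apply ENNReal.ofReal_le_ofReal; norm_num
    _ = h := one_mul h

end WT

open MeasureTheory ProbabilityTheory Real Set Filter Topology InformationTheory
open scoped ENNReal NNReal
set_option linter.unusedVariables false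
set_option linter.unusedSectionVars false

namespace WT

section
variable {θ : ℝ → ℝ} {t₀ : ℝ} (H : GoodCost θ t₀) {μ : Measure ℝ} [IsProbabilityMeasure μ] {b : ℝ} (hb : 0 < b)
  (hδ : ∀ h > (0:ℝ), ∀ x : ℝ, Umap μ (x + h) - Umap μ x ≤ (1 / b) * cinv θ (t₀ ^ 2 + h))

include H hb hδ

lemma V_diff {x y : ℝ} (hx : x ∈ Ioo (0:ℝ) 1) (hy : y ∈ Ioo (0:ℝ) 1) :
    |V μ y - V μ x| ≤ (1 / b) * cinv θ (t₀ ^ 2 + |xi x - xi y|) := by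
  wlog hxy : x ≤ y generalizing x y
  · rw [abs_sub_comm, abs_sub_comm (xi x)]; exact this hy hx (le_of_not_ge hxy)
  rw [abs_of_nonneg (sub_nonneg.2 (V_mono μ hx.1 hxy hy.2))]
  rcases hxy.eq_or_lt with h | h
  · rw [h, sub_self]
    have := H.c0 (u := t₀ ^ 2 + |xi y - xi y|) (by positivity)
    positivity
  · have hlt : xi x < xi y := by
      rw [← expCDF_strictMono.lt_iff_lt, expCDF_xi hx, expCDF_xi hy]; exact h
    have := hδ (xi y - xi x) (by linarith) (xi x)
    rw [add_sub_cancel, Umap_eq, Umap_eq, expCDF_xi hx, expCDF_xi hy] at this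
    rwa [abs_sub_comm, abs_of_pos (by linarith)]

lemma V_cells {x y : ℝ} (hx : x ∈ Ioo (0:ℝ) 1) (hy : y ∈ Ioo (0:ℝ) 1) :
    |V μ y - V μ x| ≤ (1 / b) * cinv θ (t₀ ^ 2 + (((cc x - cc y).natAbs : ℝ) + 1)) := by
  refine (V_diff H hb hδ hx hy).trans ?_
  gcongr
  apply H.c3 (by positivity)
  gcongr
  have l2 := log2_pos
  have l2' : Real.log 2 ≤ 1 := by have := Real.log_two_lt_d9; linarith
  have f1 := Int.floor_le (xi x / Real.log 2)
  have f2 := Int.lt_floor_add_one (xi x / Real.log 2)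
  have f3 := Int.floor_le (xi y / Real.log 2)
  have f4 := Int.lt_floor_add_one (xi y / Real.log 2)
  change ((cc x : ℤ):ℝ) ≤ _ at f1
  change _ < ((cc x : ℤ):ℝ) + 1 at f2
  change ((cc y : ℤ):ℝ) ≤ _ at f3
  change _ < ((cc y : ℤ):ℝ) + 1 at f4
  have e : ((cc x - cc y).natAbs : ℝ) = |(cc x : ℝ) - cc y| := by
    rw [Nat.cast_natAbs]; push_cast; rfl
  rw [e]
  have h1 : |xi x / Real.log 2 - xi y / Real.log 2| ≤ |(cc x : ℝ) - cc y| + 1 := by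
    rw [abs_le]
    have := neg_abs_le ((cc x : ℝ) - cc y)
    have := le_abs_self ((cc x : ℝ) - cc y)
    constructor <;> linarith
  rw [← sub_div, abs_div, abs_of_pos l2, div_le_iff₀ l2] at h1
  have : 0 ≤ |(cc x : ℝ) - cc y| := abs_nonneg _
  nlinarith

lemma V_integrable : Integrable (V μ) lam := by
  have i1 : Integrable Real.log lam := by
    have := (intervalIntegral.intervalIntegrable_log' (a := 0) (b := 1))
    rw [intervalIntegrable_iff_integrableOn_Ioo_of_le zero_le_one] at this
    exact this
  have i2 : Integrable (fun s => Real.log (1 - s)) lam := by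
    have := (intervalIntegral.intervalIntegrable_log' (a := 0) (b := 1)).comp_sub_left 1
    simp only [sub_zero, sub_self] at this
    have := this.symm
    rw [intervalIntegrable_iff_integrableOn_Ioo_of_le zero_le_one] at this
    exact this
  have i3 : Integrable (fun s => |V μ (1/2)| + (1 / b) * (t₀ + ((Real.log 2 + |Real.log s|) + (Real.log 2 + |Real.log (1 - s)|)) / (2 * t₀))) lam :=
    (integrable_const _).add ((((integrable_const _).add ((((integrable_const _).add i1.abs).add ((integrable_const _).add i2.abs)).div_const _))).const_mul _)
  refine i3.mono' (measurable_V μ).aestronglyMeasurable ?_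
  filter_upwards [ae_lam] with s hs
  have h1 := V_diff H hb hδ (x := 1/2) (y := s) (by constructor <;> norm_num) hs
  have ht := H.pos
  have l2 := log2_pos
  have hxi : |xi (1/2) - xi s| ≤ (Real.log 2 + |Real.log s|) + (Real.log 2 + |Real.log (1 - s)|) := by
    have e : xi (1/2) = 0 := by norm_num [xi]
    rw [e, zero_sub, abs_neg, xi]
    have a1 := abs_nonneg (Real.log s)
    have a2 := abs_nonneg (Real.log (1 - s))
    have s1 : 0 < 1 - s := by linarith [hs.2]
    split_ifs
    · rw [Real.log_mul (by norm_num) hs.1.ne']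
      have := abs_add_le (Real.log 2) (Real.log s)
      rw [abs_of_pos l2] at this; linarith
    · rw [abs_neg, Real.log_mul (by norm_num) s1.ne']
      have := abs_add_le (Real.log 2) (Real.log (1 - s))
      rw [abs_of_pos l2] at this; linarith
  have h2 := H.c7 (abs_nonneg (xi (1/2) - xi s))
  have h3 : |V μ s| ≤ |V μ (1/2)| + |V μ s - V μ (1/2)| := by
    have := abs_add_le (V μ (1/2)) (V μ s - V μ (1/2)); rwa [add_sub_cancel] at this
  rw [Real.norm_eq_abs]
  refine h3.trans (add_le_add le_rfl (h1.trans ?_))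
  gcongr
  refine h2.trans ?_
  gcongr

end

section
variable {θ : ℝ → ℝ} {t₀ : ℝ} (H : GoodCost θ t₀)
include H

lemma Cpos : 0 < cinv θ (2 + t₀ ^ 2) := by
  have := H.c8 (s := 2) (by norm_num); rw [add_comm]; linarith [H.pos]

lemma R_near {b : ℝ} (hb : 0 < b) {j : ℕ} (hj : j ≤ 1) :
    2 * (min 1 t₀ / (210 * cinv θ (2 + t₀ ^ 2)) * b) * ((1 / b) * cinv θ (t₀ ^ 2 + ((j : ℝ) + 1))) ≤ min 1 t₀ / 105 := by
  have hC := Cpos H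
  have hm : 0 < min 1 t₀ := lt_min one_pos H.pos
  have hj' : (j : ℝ) ≤ 1 := by exact_mod_cast hj
  have : cinv θ (t₀ ^ 2 + ((j : ℝ) + 1)) ≤ cinv θ (2 + t₀ ^ 2) := H.c3 (by positivity) (by linarith)
  calc _ = min 1 t₀ / 105 * (cinv θ (t₀ ^ 2 + ((j : ℝ) + 1)) / cinv θ (2 + t₀ ^ 2)) := by field_simp; ring
    _ ≤ min 1 t₀ / 105 * 1 := by gcongr; rw [div_le_one hC]; exact this
    _ = _ := mul_one _

lemma R_far {b : ℝ} (hb : 0 < b) {j : ℕ} (hj : 2 ≤ j) :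
    cext θ (2 * (min 1 t₀ / (210 * cinv θ (2 + t₀ ^ 2)) * b) * ((1 / b) * cinv θ (t₀ ^ 2 + ((j : ℝ) + 1)))) ≤ 4 / 105 * ((j:ℝ) - 1) := by
  have hC := Cpos H
  have ht := H.pos
  have hm : 0 < min 1 t₀ := lt_min one_pos H.pos
  have hj' : (2 : ℝ) ≤ j := by exact_mod_cast hj
  have hCt : t₀ ≤ cinv θ (2 + t₀ ^ 2) := by rw [add_comm]; exact H.c8 (by norm_num)
  set C := cinv θ (2 + t₀ ^ 2)
  set D := cinv θ (t₀ ^ 2 + ((j : ℝ) + 1)) with hD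
  have hD0 : 0 ≤ D := H.c0 (by positivity)
  have hθD : θ D = t₀ ^ 2 + ((j : ℝ) + 1) := H.c1 (by positivity)
  have hD7 : D ≤ t₀ + ((j:ℝ) + 1) / (2 * t₀) := H.c7 (by positivity)
  have e : 2 * (min 1 t₀ / (210 * C) * b) * ((1 / b) * D) = min 1 t₀ / (105 * C) * D := by field_simp; ring
  rw [e, cext_of_nonneg (by positivity)]
  have hc1 : min 1 t₀ / (105 * C) ≤ 1 / 105 := by
    rw [div_le_div_iff₀ (by positivity) (by norm_num)]
    have := min_le_right 1 t₀; linarith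
  have hs : θ (min 1 t₀ / (105 * C) * D) ≤ min 1 t₀ / (105 * C) * θ D := H.smul (by positivity) (by linarith) hD0
  rcases le_total t₀ 1 with h | h
  · refine hs.trans ?_
    calc _ ≤ 1 / 105 * θ D := by rw [hθD]; gcongr
      _ ≤ _ := by rw [hθD]; nlinarith
  · rw [min_eq_left h] at hs ⊢ hc1
    set x := 1 / (105 * C) * D with hx
    have hx0 : 0 ≤ x := by positivity
    have hxle : x ≤ 1 / 105 + ((j:ℝ) + 1) / (210 * t₀ ^ 2) := by
      calc x ≤ 1 / (105 * t₀) * (t₀ + ((j:ℝ) + 1) / (2 * t₀)) := by rw [hx]; gcongr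
        _ = _ := by field_simp; ring
    have key : 2 / 105 ≤ x → 105 * x * t₀ ^ 2 ≤ j + 1 := by
      intro h2
      have : x / 2 ≤ ((j:ℝ) + 1) / (210 * t₀ ^ 2) := by linarith
      rw [le_div_iff₀ (by positivity)] at this
      linarith
    have ht2 : 1 ≤ t₀ ^ 2 := by nlinarith
    rcases le_total x t₀ with hxt | hxt
    · rw [H.quad x ⟨hx0, hxt⟩]
      rcases le_total x (2 / 105) with h2 | h2
      · nlinarith
      · have := key h2
        have : x * x ≤ x * t₀ ^ 2 := by gcongr; nlinarith
        nlinarith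
    · have := key (by linarith)
      have h3 : t₀ ^ 2 ≤ x * t₀ ^ 2 := by nlinarith
      have hC1 : 1 ≤ C := by linarith
      refine hs.trans ?_
      calc _ ≤ 1 / 105 * θ D := by rw [hθD]; gcongr
        _ ≤ _ := by rw [hθD]; nlinarith

end
end WT

open MeasureTheory ProbabilityTheory Real Set Filter Topology InformationTheory
open scoped ENNReal NNReal
set_option linter.unusedVariables false
set_option linter.unusedSectionVars false

namespace WT

lemma ae_int_T {P₁ P₂ : Measure ℝ} [SFinite P₁] (p : Kernel ℝ ℝ) [IsMarkovKernel p] (hb : P₁.bind p = P₂) {T : ℝ → ℝ}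
    (h : Integrable T P₂) : ∀ᵐ x ∂P₁, Integrable T (p x) := by
  subst hb
  exact Measure.ae_integrable_of_integrable_comp h

theorem T_of_delta {θ : ℝ → ℝ} {t₀ : ℝ} (H : GoodCost θ t₀) {μ : Measure ℝ} [IsProbabilityMeasure μ] {b : ℝ} (hb : 0 < b)
    (hδ : ∀ h > (0:ℝ), ∀ x : ℝ, Umap μ (x + h) - Umap μ x ≤ (1 / b) * cinv θ (t₀ ^ 2 + h))
    (ν : Measure ℝ) [IsProbabilityMeasure ν] (hν : Integrable (fun x => x) ν) :
    weakCost (fun t => θ (((min 1 t₀ / (210 * cinv θ (2 + t₀ ^ 2))) * b) * t)) μ ν ≤ relEnt ν μ ∧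
    weakCost (fun t => θ (((min 1 t₀ / (210 * cinv θ (2 + t₀ ^ 2))) * b) * t)) ν μ ≤ relEnt ν μ := by
  by_cases htop : relEnt ν μ = ⊤
  · rw [htop]; exact ⟨le_top, le_top⟩
  have hac : ν ≪ μ := by
    by_contra h
    apply htop
    rw [relEnt, if_neg (fun h' => h h'.1)]
  obtain ⟨f, hf, hf0, hprob, hmap, hent⟩ := exists_density μ ν hac
  set Q := lam.withDensity (fun x => ENNReal.ofReal (f x)) with hQ
  have hQac : Q ≪ lam := withDensity_absolutelyContinuous _ _
  clear_value Q
  have hk : Integrable (fun x => klFun (f x)) lam := by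
    refine ⟨(measurable_klFun.comp hf).aestronglyMeasurable, ?_⟩
    rw [hasFiniteIntegral_iff_ofReal (ae_of_all _ fun x => klFun_nonneg (hf0 x)), ← hent]
    exact lt_top_iff_ne_top.2 htop
  have hh : relEnt ν μ = ENNReal.ofReal (∫ x, klFun (f x) ∂lam) := by
    rw [hent, ofReal_integral_eq_lintegral_ofReal hk (ae_of_all _ fun x => klFun_nonneg (hf0 x))]
  obtain ⟨hGA, hFF⟩ := GA_FF hf hf0 hQ hk
  rw [ENNReal.ofReal_mul (by norm_num), ← hh] at hGA hFF
  rw [ENNReal.ofReal_ofNat] at hGA hFF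
  have hN := NN_mono (Q := Q)
  have h0 := NN_bot hQac
  have h1 := NN_top hQac
  have hVm := measurable_V μ
  have hVP : Integrable (V μ) lam := V_integrable H hb hδ
  have hVQ : Integrable (V μ) Q := by
    rw [← hmap] at hν
    exact (integrable_map_measure aestronglyMeasurable_id hVm.aemeasurable).1 hν
  have hC := Cpos H
  have ha : 0 < (min 1 t₀ / (210 * cinv θ (2 + t₀ ^ 2))) * b := by
    have hm : 0 < min 1 t₀ := lt_min one_pos H.pos
    positivity
  have hlam1 : lam = lam.withDensity (fun _ => (1:ℝ≥0∞)) := by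
    have := withDensity_one (μ := lam); exact this.symm
  have row : ∀ k, ∑' l, qq (NN Q) k l = lam (cc ⁻¹' {k}) := fun k => by rw [qq_row hN h0 h1, lam_cell]
  have col : ∀ l, ∑' k, qq (NN Q) k l = Q (cc ⁻¹' {l}) := fun l => by rw [qq_col hN h0 h1, Q_cell hQac]
  have hq1 : ∀ k, qq (NN Q) k k ≤ lam (cc ⁻¹' {k}) := fun k => by rw [← row]; exact ENNReal.le_tsum k
  have hq2 : ∀ k, qq (NN Q) k k ≤ Q (cc ⁻¹' {k}) := fun k => by rw [← col]; exact ENNReal.le_tsum (f := fun j => qq (NN Q) j k) k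
  have hR := fun (x : ℝ) (hx : x ∈ Ioo (0:ℝ) 1) (y : ℝ) (hy : y ∈ Ioo (0:ℝ) 1) => V_cells H hb hδ hx hy
  have hfarb := far_bound hN h0 h1
  constructor
  · obtain ⟨K, hK, hbind, hK3⟩ := KER (a' := fun x => ENNReal.ofReal (f x)) (b' := fun _ => 1) (q := fun k l => qq (NN Q) l k)
      hf.ennreal_ofReal measurable_const (fun x => ENNReal.ofReal_ne_top)
      (fun x => ENNReal.one_ne_top) hQ hlam1 measurable_cc col row
    have hw := weakCost_le H ha Q lam K hbind hVm hVQ hVP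
    rw [hmap, map_V] at hw
    refine hw.trans ?_
    refine cost_bound H ha hVm (q := fun k l => qq (NN Q) l k)
      (pin := fun x => (qq (NN Q) (cc x) (cc x) / Q (cc ⁻¹' {cc x}) * ENNReal.ofReal (f x) - min (qq (NN Q) (cc x) (cc x) / Q (cc ⁻¹' {cc x}) * ENNReal.ofReal (f x)) (qq (NN Q) (cc x) (cc x) / lam (cc ⁻¹' {cc x}) * 1)) / ENNReal.ofReal (f x)) (R := fun j : ℕ => (1 / b) * cinv θ (t₀ ^ 2 + ((j : ℝ) + 1))) hR (fun j hj => R_near H hb hj)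
      (fun j hj => R_far H hb hj) (ae_Q hQac) (ae_ae_bind K hbind ae_lam)
      (ae_int_T K hbind hVP) hK3 ?_ ?_ ?_
    · rw [hent]; exact pin_rev hf hf0 hQ hk (fun k => qq (NN Q) k k) hq1 hq2
    · refine le_trans (le_of_eq ?_) ((near_rev hN h0 h1).trans (mul_le_mul_right hGA _))
      simp_rw [Q_cell hQac]
    · rw [ENNReal.tsum_comm]
      refine le_trans (le_of_eq ?_) (hfarb.trans hFF)
      congr 1; ext k; congr 1; ext l
      rw [← Int.natAbs_neg (k - l), neg_sub]
  · obtain ⟨K, hK, hbind, hK3⟩ := KER (a' := fun _ => 1) (b' := fun x => ENNReal.ofReal (f x)) (q := qq (NN Q))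
      measurable_const hf.ennreal_ofReal (fun x => ENNReal.one_ne_top) (fun x => ENNReal.ofReal_ne_top)
      hlam1 hQ measurable_cc row col
    have hw := weakCost_le H ha lam Q K hbind hVm hVP hVQ
    rw [hmap, map_V] at hw
    refine hw.trans ?_
    refine cost_bound H ha hVm (R := fun j : ℕ => (1 / b) * cinv θ (t₀ ^ 2 + ((j : ℝ) + 1))) hR (fun j hj => R_near H hb hj)
      (fun j hj => R_far H hb hj) ae_lam (ae_ae_bind K hbind (ae_Q hQac))
      (ae_int_T K hbind hVQ) hK3 ?_ ?_ ?_
    · rw [hent]; exact pin_fwd hf hf0 hQ hk (fun k => qq (NN Q) k k) hq1 hq2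
    · refine le_trans (le_of_eq ?_) ((near_fwd hN h0 h1).trans (mul_le_mul_right hGA _))
      simp_rw [lam_cell]
    · exact hfarb.trans hFF

end WT

end WTproof

/-- **Proposition 4.1 (Gozlan–Roberto–Samson–Shu–Tetali).** For a convex cost `θ` which is
quadratic on `[0, t₀]` and suitably integrable, and a probability measure `μ` on `ℝ` which is
not a Dirac mass: `μ` satisfies `T̄(θ(a·))` for some `a > 0` iff
`Δ_μ(h) ≤ (1/b) θ⁻¹(t₀² + h)` for some `b > 0`; moreover (i) implies (ii) with `b = κ₁ a`,
`κ₁ = t₀/(8 θ⁻¹(log 3 + t₀²))`, and (ii) implies (i) with `a = κ₂ b`,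
`κ₂ = min(1,t₀)/(210 θ⁻¹(2 + t₀²))`. -/
theorem weakTransport_iff_deltaCondition
    (θ : ℝ → ℝ) (t₀ : ℝ) (ht₀ : 0 < t₀)
    (hθnn : ∀ t ≥ (0:ℝ), 0 ≤ θ t)
    (hθconv : ConvexOn ℝ (Set.Ici 0) θ)
    (hθquad : ∀ t ∈ Set.Icc (0:ℝ) t₀, θ t = t ^ 2)
    (hθint : ∀ d₁ > (0:ℝ), ∀ d₂ > (0:ℝ),
      IntegrableOn (fun x => θ (d₁ * x + d₂) * Real.exp (-x)) (Set.Ioi 0) volume)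
    (μ : Measure ℝ) [IsProbabilityMeasure μ]
    (hnd : ∀ x : ℝ, μ ≠ Measure.dirac x) :
    ((∃ a > (0:ℝ), Tminus (fun t => θ (a * t)) μ ∧ Tplus (fun t => θ (a * t)) μ) ↔
      (∃ b > (0:ℝ), ∀ h > (0:ℝ), ∀ x : ℝ,
        Umap μ (x + h) - Umap μ x ≤ (1 / b) * cinv θ (t₀ ^ 2 + h)))
    ∧
    (∀ a > (0:ℝ), Tminus (fun t => θ (a * t)) μ ∧ Tplus (fun t => θ (a * t)) μ →
      ∀ h > (0:ℝ), ∀ x : ℝ,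
        Umap μ (x + h) - Umap μ x ≤
          (1 / ((t₀ / (8 * cinv θ (Real.log 3 + t₀ ^ 2))) * a)) * cinv θ (t₀ ^ 2 + h))
    ∧
    (∀ b > (0:ℝ),
      (∀ h > (0:ℝ), ∀ x : ℝ,
        Umap μ (x + h) - Umap μ x ≤ (1 / b) * cinv θ (t₀ ^ 2 + h)) →
      Tminus (fun t => θ (((min 1 t₀ / (210 * cinv θ (2 + t₀ ^ 2))) * b) * t)) μ ∧
        Tplus (fun t => θ (((min 1 t₀ / (210 * cinv θ (2 + t₀ ^ 2))) * b) * t)) μ) := by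
  have H : WT.GoodCost θ t₀ := ⟨ht₀, hθnn, hθconv, hθquad⟩
  have fwd : ∀ a > (0:ℝ), Tminus (fun t => θ (a * t)) μ ∧ Tplus (fun t => θ (a * t)) μ →
      ∀ h > (0:ℝ), ∀ x : ℝ,
        Umap μ (x + h) - Umap μ x ≤
          (1 / ((t₀ / (8 * cinv θ (Real.log 3 + t₀ ^ 2))) * a)) * cinv θ (t₀ ^ 2 + h) :=
    fun a ha hT h hh x => WT.delta_of_T H μ ha hT.1 hT.2 hh x
  have bwd : ∀ b > (0:ℝ),
      (∀ h > (0:ℝ), ∀ x : ℝ,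
        Umap μ (x + h) - Umap μ x ≤ (1 / b) * cinv θ (t₀ ^ 2 + h)) →
      Tminus (fun t => θ (((min 1 t₀ / (210 * cinv θ (2 + t₀ ^ 2))) * b) * t)) μ ∧
        Tplus (fun t => θ (((min 1 t₀ / (210 * cinv θ (2 + t₀ ^ 2))) * b) * t)) μ :=
    fun b hb hδ => ⟨fun ν _ hν => (WT.T_of_delta H hb hδ ν hν).1,
      fun ν _ hν => (WT.T_of_delta H hb hδ ν hν).2⟩
  refine ⟨⟨?_, ?_⟩, fwd, bwd⟩
  · rintro ⟨a, ha, hT⟩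
    have h3 : 0 < Real.log 3 := Real.log_pos (by norm_num)
    have hc : 0 < cinv θ (Real.log 3 + t₀ ^ 2) := by
      have := H.c8 (s := Real.log 3) h3.le
      rw [add_comm]; linarith
    exact ⟨t₀ / (8 * cinv θ (Real.log 3 + t₀ ^ 2)) * a, by positivity, fwd a ha hT⟩
  · rintro ⟨b, hb, hδ⟩
    have hc := WT.Cpos H
    have hm : 0 < min 1 t₀ := lt_min one_pos ht₀
    exact ⟨min 1 t₀ / (210 * cinv θ (2 + t₀ ^ 2)) * b, by positivity, bwd b hb hδ⟩
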